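/- Let r > 0, p = 2r+1, let 0 ≤ λ < 1, and let n ≥ 1 satisfy (n−2)p < n. Define F(u₁,u₂) = (u₁^p − λ u₁^r u₂^{r+1}, u₂^p − λ u₁^{r+1} u₂^r) for u₁, u₂ ≥ 0. Then the system Uₜ − ΔU = F(U) on ℝⁿ×ℝ possesses no nontrivial nonnegative classical solution U = (u₁,u₂). -/

import Mathlib

open scoped BigOperators
open Set

/-- The Laplacian of `f : ℝⁿ → ℝ` at `x`, as the sum of the second partial
derivatives in the coordinate directions. -/
noncomputable def lap {n : ℕ} (f : EuclideanSpace ℝ (Fin n) → ℝ)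
    (x : EuclideanSpace ℝ (Fin n)) : ℝ :=
  ∑ i : Fin n,
    fderiv ℝ (fun y => fderiv ℝ f y (EuclideanSpace.single i 1)) x
      (EuclideanSpace.single i 1)

open MeasureTheory Filter Topology Metric
open scoped ContDiff

abbrev Eu (n : ℕ) := EuclideanSpace ℝ (Fin n)

/-- The `i`-th partial derivative. -/
noncomputable def pd {n : ℕ} (i : Fin n) (f : Eu n → ℝ) (x : Eu n) : ℝ :=
  fderiv ℝ f x (EuclideanSpace.single i 1)

section Calculus

variable {n : ℕ}

theorem lap_eq_sum_pd (f : Eu n → ℝ) (x : Eu n) : lap f x = ∑ i, pd i (pd i f) x := rfl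

theorem ContDiff.pd_one {f : Eu n → ℝ} (hf : ContDiff ℝ 2 f) (i : Fin n) :
    ContDiff ℝ 1 (pd i f) :=
  (hf.fderiv_right (m := 1) (by norm_num)).clm_apply contDiff_const

theorem ContDiff.continuous_pd {f : Eu n → ℝ} (hf : ContDiff ℝ 1 f) (i : Fin n) :
    Continuous (pd i f) :=
  ((hf.fderiv_right (m := 0) (by norm_num)).clm_apply contDiff_const).continuous

theorem ContDiff.continuous_lap {f : Eu n → ℝ} (hf : ContDiff ℝ 2 f) : Continuous (lap f) :=
  continuous_finsetSum _ fun i _ => (hf.pd_one i).continuous_pd i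

theorem pd_add {f g : Eu n → ℝ} (hf : Differentiable ℝ f) (hg : Differentiable ℝ g) (i : Fin n) :
    pd i (fun x => f x + g x) = fun x => pd i f x + pd i g x := by
  funext x
  simp [pd, fderiv_fun_add (hf x) (hg x)]

theorem pd_mul {f g : Eu n → ℝ} (hf : Differentiable ℝ f) (hg : Differentiable ℝ g) (i : Fin n) :
    pd i (fun x => f x * g x) = fun x => f x * pd i g x + g x * pd i f x := by
  funext x
  simp [pd, fderiv_fun_mul (hf x) (hg x)]

theorem pd_const_mul (c : ℝ) {f : Eu n → ℝ} (hf : Differentiable ℝ f) (i : Fin n) :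
    pd i (fun x => c * f x) = fun x => c * pd i f x := by
  funext x
  simp [pd, fderiv_const_mul (hf x)]

theorem lap_add {f g : Eu n → ℝ} (hf : ContDiff ℝ 2 f) (hg : ContDiff ℝ 2 g) (x : Eu n) :
    lap (fun x => f x + g x) x = lap f x + lap g x := by
  simp only [lap_eq_sum_pd, ← Finset.sum_add_distrib]
  refine Finset.sum_congr rfl fun i _ => ?_
  rw [pd_add (hf.differentiable (by norm_num)) (hg.differentiable (by norm_num)),
    pd_add ((hf.pd_one i).differentiable (by norm_num))
      ((hg.pd_one i).differentiable (by norm_num))]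

theorem lap_const_mul (c : ℝ) {f : Eu n → ℝ} (hf : ContDiff ℝ 2 f) (x : Eu n) :
    lap (fun x => c * f x) x = c * lap f x := by
  simp only [lap_eq_sum_pd, Finset.mul_sum]
  refine Finset.sum_congr rfl fun i _ => ?_
  rw [pd_const_mul c (hf.differentiable (by norm_num)),
    pd_const_mul c ((hf.pd_one i).differentiable (by norm_num))]

theorem lap_neg {f : Eu n → ℝ} (hf : ContDiff ℝ 2 f) (x : Eu n) :
    lap (fun x => -f x) x = -lap f x := by
  simpa using lap_const_mul (-1) hf x

theorem lap_sub {f g : Eu n → ℝ} (hf : ContDiff ℝ 2 f) (hg : ContDiff ℝ 2 g) (x : Eu n) :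
    lap (fun x => f x - g x) x = lap f x - lap g x := by
  have := lap_add hf hg.neg x
  simp only [lap_neg hg, ← sub_eq_add_neg] at this
  exact this

theorem pd_const (c : ℝ) (i : Fin n) : pd i (fun _ : Eu n => c) = fun _ => 0 := by
  funext x; simp [pd]

theorem lap_const (c : ℝ) (x : Eu n) : lap (fun _ : Eu n => c) x = 0 := by
  simp [lap_eq_sum_pd, pd_const]

theorem pd_comp_affine (f : Eu n → ℝ) (x₀ : Eu n) (μ : ℝ) (i : Fin n) :
    pd i (fun x => f (x₀ + μ • x)) = fun x => μ * pd i f (x₀ + μ • x) := by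
  funext x
  have h := fderiv_comp_smul (f := fun y => f (x₀ + y)) (x := x) μ (𝕜 := ℝ)
  simp only [pd, h, fderiv_comp_add_left]
  simp

theorem lap_comp_affine {f : Eu n → ℝ} (hf : ContDiff ℝ 2 f) (x₀ : Eu n) (μ : ℝ) (x : Eu n) :
    lap (fun x => f (x₀ + μ • x)) x = μ ^ 2 * lap f (x₀ + μ • x) := by
  simp only [lap_eq_sum_pd, Finset.mul_sum]
  refine Finset.sum_congr rfl fun i _ => ?_
  have hd : Differentiable ℝ fun x => pd i f (x₀ + μ • x) :=
    ((hf.pd_one i).differentiable (by norm_num)).comp (by fun_prop)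
  rw [pd_comp_affine, pd_const_mul μ hd, pd_comp_affine]
  ring

theorem lap_comp_sub_left {f : Eu n → ℝ} (hf : ContDiff ℝ 2 f) (x y : Eu n) :
    lap (fun y => f (x - y)) y = lap f (x - y) := by
  have := lap_comp_affine hf x (-1) y
  simpa [← sub_eq_add_neg] using this

theorem pd_comp {h : ℝ → ℝ} {q : Eu n → ℝ} (hh : Differentiable ℝ h) (hq : Differentiable ℝ q)
    (i : Fin n) : pd i (fun x => h (q x)) = fun x => deriv h (q x) * pd i q x := by
  funext x
  have := ((hh (q x)).hasDerivAt.comp_hasFDerivAt x (hq x).hasFDerivAt).fderiv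
  simp only [pd]
  rw [show (fun x => h (q x)) = h ∘ q from rfl, this]
  simp

theorem lap_comp {h : ℝ → ℝ} {q : Eu n → ℝ} (hh : ContDiff ℝ 2 h) (hq : ContDiff ℝ 2 q)
    (x : Eu n) : lap (fun x => h (q x)) x =
      deriv h (q x) * lap q x + deriv (deriv h) (q x) * ∑ i, pd i q x ^ 2 := by
  have hq' := hq.differentiable (by norm_num)
  have hh' : ContDiff ℝ 1 (deriv h) := by
    exact ((contDiff_succ_iff_deriv (n := 1)).1 (by simpa [one_add_one_eq_two] using hh)).2.2
  simp only [lap_eq_sum_pd, Finset.mul_sum, ← Finset.sum_add_distrib]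
  refine Finset.sum_congr rfl fun i _ => ?_
  rw [pd_comp (hh.differentiable (by norm_num)) hq',
    pd_mul (f := fun x => deriv h (q x)) ((hh'.differentiable (by norm_num)).comp hq')
      ((hq.pd_one i).differentiable (by norm_num)),
    pd_comp (hh'.differentiable (by norm_num)) hq']
  ring

theorem pd_norm_sq (i : Fin n) : pd i (fun x : Eu n => ‖x‖ ^ 2) = fun x => 2 * x i := by
  funext x
  simp [pd, EuclideanSpace.inner_single_right]

theorem lap_norm_sq (x : Eu n) : lap (fun x : Eu n => ‖x‖ ^ 2) x = 2 * n := by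
  have h : ∀ i : Fin n, pd i (fun x : Eu n => 2 * x i) x = 2 := fun i => by
    rw [pd_const_mul 2 (f := fun x : Eu n => x i) (by fun_prop)]
    have : (fun x : Eu n => x i) = (EuclideanSpace.proj (𝕜 := ℝ) i : Eu n →L[ℝ] ℝ) := rfl
    simp only [pd, this, ContinuousLinearMap.fderiv]
    simp
  simp [lap_eq_sum_pd, pd_norm_sq, h, mul_comm]

theorem sum_pd_norm_sq (x : Eu n) : ∑ i, pd i (fun x : Eu n => ‖x‖ ^ 2) x ^ 2 = 4 * ‖x‖ ^ 2 := by
  simp only [pd_norm_sq]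
  simp only [mul_pow, EuclideanSpace.norm_sq_eq, Finset.mul_sum, Real.norm_eq_abs, sq_abs]
  norm_num

theorem lap_radial {h : ℝ → ℝ} (hh : ContDiff ℝ 2 h) (x : Eu n) :
    lap (fun x : Eu n => h (‖x‖ ^ 2)) x =
      2 * n * deriv h (‖x‖ ^ 2) + 4 * ‖x‖ ^ 2 * deriv (deriv h) (‖x‖ ^ 2) := by
  rw [lap_comp hh (contDiff_norm_sq ℝ), lap_norm_sq, sum_pd_norm_sq]
  ring

end Calculus

section Calculus

variable {n : ℕ}

theorem hasDerivAt_line {f : Eu n → ℝ} (hf : Differentiable ℝ f) (x : Eu n) (i : Fin n) (s : ℝ) :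
    HasDerivAt (fun s : ℝ => f (x + s • EuclideanSpace.single i 1))
      (pd i f (x + s • EuclideanSpace.single i 1)) s := by
  have h1 : HasDerivAt (fun s : ℝ => x + s • (EuclideanSpace.single i 1 : Eu n))
      (EuclideanSpace.single i 1) s := by
    simpa using ((hasDerivAt_id s).smul_const (EuclideanSpace.single i (1 : ℝ))).const_add x
  exact (hf _).hasFDerivAt.comp_hasDerivAt s h1

theorem pd_pd_nonneg_of_isLocalMin {f : Eu n → ℝ} (hf : ContDiff ℝ 2 f) {x : Eu n}
    (hx : IsLocalMin f x) (i : Fin n) : 0 ≤ pd i (pd i f) x := by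
  set φ : ℝ → ℝ := fun s => f (x + s • EuclideanSpace.single i 1) with hφ
  have hf1 := hf.differentiable (by norm_num)
  have hd : deriv φ = fun s => pd i f (x + s • EuclideanSpace.single i 1) :=
    funext fun s => (hasDerivAt_line hf1 x i s).deriv
  have hdd : deriv (deriv φ) 0 = pd i (pd i f) x := by
    rw [hd]
    simpa using (hasDerivAt_line ((hf.pd_one i).differentiable (by norm_num)) x i 0).deriv
  have hcont : Continuous fun s : ℝ => x + s • (EuclideanSpace.single i 1 : Eu n) := by fun_prop
  have hmin : IsLocalMin φ 0 := by
    have h : Tendsto (fun s : ℝ => x + s • (EuclideanSpace.single i 1 : Eu n)) (𝓝 0) (𝓝 x) := by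
      simpa using hcont.tendsto 0
    have := h.eventually hx
    simpa [IsLocalMin, IsMinFilter, hφ] using this
  by_contra hneg
  push Not at hneg
  have hmax : IsLocalMin (fun s => -φ s) 0 := by
    apply isLocalMin_of_deriv_deriv_pos
    · have : deriv (fun s => -φ s) = fun s => -deriv φ s := by funext s; simp
      rw [this]
      simp only [deriv.fun_neg, gt_iff_lt]
      rw [hdd]; linarith
    · simp only [deriv.fun_neg, neg_eq_zero]
      exact hmin.deriv_eq_zero
    · exact (hf.continuous.comp hcont).neg.continuousAt
  have hev : φ =ᶠ[𝓝 0] fun _ => φ 0 := by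
    filter_upwards [hmin, hmax] with s h1 h2
    linarith
  have h0 : deriv (deriv φ) 0 = 0 := by
    rw [hev.deriv.deriv_eq]
    simp
  linarith

theorem lap_nonneg_of_isLocalMin {f : Eu n → ℝ} (hf : ContDiff ℝ 2 f) {x : Eu n}
    (hx : IsLocalMin f x) : 0 ≤ lap f x :=
  Finset.sum_nonneg fun i _ => pd_pd_nonneg_of_isLocalMin hf hx i

theorem HasCompactSupport.pd {f : Eu n → ℝ} (hf : HasCompactSupport f) (i : Fin n) :
    HasCompactSupport (pd i f) :=
  hf.fderiv_apply ℝ _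

theorem tsupport_pd_subset (f : Eu n → ℝ) (i : Fin n) : tsupport (pd i f) ⊆ tsupport f :=
  tsupport_fderiv_apply_subset ℝ _

theorem tsupport_lap_subset (f : Eu n → ℝ) : tsupport (lap f) ⊆ tsupport f := by
  refine closure_minimal (fun x hx => ?_) (isClosed_tsupport f)
  by_contra h
  refine hx (Finset.sum_eq_zero fun i _ => ?_)
  exact image_eq_zero_of_notMem_tsupport (f := pd i (pd i f))
    fun h' => h (tsupport_pd_subset _ i (tsupport_pd_subset _ i h'))

theorem HasCompactSupport.lap {f : Eu n → ℝ} (hf : HasCompactSupport f) :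
    HasCompactSupport (lap f) :=
  hf.of_isClosed_subset (isClosed_tsupport _) (tsupport_lap_subset f)

theorem integral_mul_pd {f φ : Eu n → ℝ} (hf : ContDiff ℝ 1 f) (hφ : ContDiff ℝ 1 φ)
    (hc : HasCompactSupport φ) (i : Fin n) :
    ∫ x, f x * pd i φ x = -∫ x, pd i f x * φ x := by
  apply integral_mul_fderiv_eq_neg_fderiv_mul_of_integrable
  · exact ((hf.continuous_pd i).mul hφ.continuous).integrable_of_hasCompactSupport hc.mul_left
  · exact (hf.continuous.mul (hφ.continuous_pd i)).integrable_of_hasCompactSupport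
      (hc.pd i).mul_left
  · exact (hf.continuous.mul hφ.continuous).integrable_of_hasCompactSupport hc.mul_left
  · exact fun x _ => hf.differentiable (by norm_num) x
  · exact fun x _ => hφ.differentiable (by norm_num) x

theorem integral_mul_lap {f φ : Eu n → ℝ} (hf : ContDiff ℝ 2 f) (hφ : ContDiff ℝ 2 φ)
    (hc : HasCompactSupport φ) : ∫ x, f x * lap φ x = ∫ x, lap f x * φ x := by
  simp only [lap_eq_sum_pd, Finset.mul_sum, Finset.sum_mul]
  rw [integral_finsetSum, integral_finsetSum]
  · refine Finset.sum_congr rfl fun i _ => ?_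
    rw [integral_mul_pd (hf.of_le (by norm_num)) (hφ.pd_one i) (hc.pd i),
      integral_mul_pd (hf.pd_one i) (hφ.of_le (by norm_num)) hc, neg_neg]
  · exact fun i _ => (((hf.pd_one i).continuous_pd i).mul
      hφ.continuous).integrable_of_hasCompactSupport hc.mul_left
  · exact fun i _ => (hf.continuous.mul
      ((hφ.pd_one i).continuous_pd i)).integrable_of_hasCompactSupport ((hc.pd i).pd i).mul_left

/-- The convolution `∫ f(y) κ(x - y) dy`. -/
noncomputable def mol (κ f : Eu n → ℝ) (x : Eu n) : ℝ := ∫ y, f y * κ (x - y)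

theorem mol_eq_convolution (κ f : Eu n → ℝ) :
    mol κ f = convolution f κ (ContinuousLinearMap.mul ℝ ℝ) volume := rfl

theorem contDiff_mol {κ f : Eu n → ℝ} {m : ℕ∞} (hκ : ContDiff ℝ m κ) (hc : HasCompactSupport κ)
    (hf : Continuous f) : ContDiff ℝ m (mol κ f) :=
  hc.contDiff_convolution_right (ContinuousLinearMap.mul ℝ ℝ) (μ := volume)
    hf.locallyIntegrable hκ

theorem pd_mol {κ f : Eu n → ℝ} (hκ : ContDiff ℝ 1 κ) (hc : HasCompactSupport κ)
    (hf : Continuous f) (i : Fin n) : pd i (mol κ f) = mol (pd i κ) f := by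
  funext x
  have h := (hc.hasFDerivAt_convolution_right (ContinuousLinearMap.mul ℝ ℝ)
    (hf.locallyIntegrable (μ := volume)) hκ x).fderiv
  rw [pd, mol_eq_convolution, h, convolution_precompR_apply _ hf.locallyIntegrable
    (hc.fderiv ℝ) (hκ.continuous_fderiv (by norm_num))]
  rfl

theorem integrable_mol {κ f : Eu n → ℝ} (hκ : Continuous κ) (hc : HasCompactSupport κ)
    (hf : Continuous f) (x : Eu n) : Integrable fun y => f y * κ (x - y) := by
  apply (hf.mul (hκ.comp (by fun_prop))).integrable_of_hasCompactSupport
  exact (hc.comp_homeomorph (Homeomorph.subLeft x)).mul_left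

theorem lap_mol {κ f : Eu n → ℝ} (hκ : ContDiff ℝ 2 κ) (hc : HasCompactSupport κ)
    (hf : Continuous f) : lap (mol κ f) = mol (lap κ) f := by
  funext x
  have h : ∀ i, pd i (pd i (mol κ f)) x = mol (pd i (pd i κ)) f x := fun i => by
    rw [pd_mol (hκ.of_le (by norm_num)) hc hf, pd_mol (hκ.pd_one i) (hc.pd i) hf]
  simp only [lap_eq_sum_pd, h]
  simp only [mol, lap_eq_sum_pd, Finset.mul_sum]
  rw [integral_finsetSum]
  exact fun i _ => integrable_mol ((hκ.pd_one i).continuous_pd i) ((hc.pd i).pd i) hf x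

/-- A smooth probability density supported in the ball of radius `ε`. -/
structure IsMoll (κ : Eu n → ℝ) (ε : ℝ) : Prop where
  smooth : ContDiff ℝ ∞ κ
  nonneg : ∀ x, 0 ≤ κ x
  supp : tsupport κ ⊆ closedBall 0 ε
  integral_eq_one : ∫ x, κ x = 1

theorem exists_isMoll (n : ℕ) {ε : ℝ} (hε : 0 < ε) : ∃ κ : Eu n → ℝ, IsMoll κ ε := by
  let b : ContDiffBump (0 : Eu n) := ⟨ε / 2, ε, by linarith, by linarith⟩
  exact ⟨b.normed volume, b.contDiff_normed, b.nonneg_normed,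
      (b.tsupport_normed_eq (μ := volume)).subset,
    b.integral_normed⟩

namespace IsMoll

variable {κ : Eu n → ℝ} {ε : ℝ}

theorem hasCompactSupport (h : IsMoll κ ε) : HasCompactSupport κ :=
  (isCompact_closedBall _ _).of_isClosed_subset (isClosed_tsupport _) h.supp

theorem eq_zero (h : IsMoll κ ε) {x : Eu n} (hx : ε < ‖x‖) : κ x = 0 :=
  image_eq_zero_of_notMem_tsupport fun h' => by
    have := h.supp h'
    simp at this
    linarith

theorem integral_sub (h : IsMoll κ ε) (x : Eu n) : ∫ y, κ (x - y) = 1 := by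
  rw [integral_sub_left_eq_self κ volume x, h.integral_eq_one]

theorem integrable_sub (h : IsMoll κ ε) (x : Eu n) : Integrable fun y => κ (x - y) := by
  simpa using integrable_mol (f := fun _ => 1) h.smooth.continuous h.hasCompactSupport
    continuous_const x

theorem mol_le (h : IsMoll κ ε) {f : Eu n → ℝ} (hf : Continuous f) {x : Eu n} {M : ℝ}
    (hM : ∀ y, ‖y - x‖ ≤ ε → f y ≤ M) : mol κ f x ≤ M := by
  calc mol κ f x ≤ ∫ y, M * κ (x - y) := by
        refine integral_mono (integrable_mol h.smooth.continuous h.hasCompactSupport hf x)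
          ((h.integrable_sub x).const_mul M) fun y => ?_
        by_cases hy : ‖y - x‖ ≤ ε
        · exact mul_le_mul_of_nonneg_right (hM y hy) (h.nonneg _)
        · simp [h.eq_zero (x := x - y) (by rw [norm_sub_rev]; linarith)]
    _ = M := by rw [integral_const_mul, h.integral_sub, mul_one]

theorem mol_neg (f : Eu n → ℝ) (x : Eu n) : mol κ (fun y => -f y) x = -mol κ f x := by
  simp [mol, integral_neg]

theorem le_mol (h : IsMoll κ ε) {f : Eu n → ℝ} (hf : Continuous f) {x : Eu n} {M : ℝ}
    (hM : ∀ y, ‖y - x‖ ≤ ε → M ≤ f y) : M ≤ mol κ f x := by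
  have := h.mol_le hf.neg (x := x) (M := -M) fun y hy => neg_le_neg (hM y hy)
  have h2 := mol_neg (κ := κ) f x
  change mol κ (fun y => -f y) x ≤ -M at this
  linarith

theorem abs_mol_le (h : IsMoll κ ε) {f : Eu n → ℝ} (hf : Continuous f) {x : Eu n} {M : ℝ}
    (hM : ∀ y, ‖y - x‖ ≤ ε → |f y| ≤ M) : |mol κ f x| ≤ M :=
  abs_le.2 ⟨h.le_mol hf fun y hy => (abs_le.1 (hM y hy)).1,
    h.mol_le hf fun y hy => (abs_le.1 (hM y hy)).2⟩

end IsMoll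

theorem tendsto_mol {κ : ℕ → Eu n → ℝ} {ε : ℕ → ℝ} (hκ : ∀ k, IsMoll (κ k) (ε k))
    (hε : Tendsto ε atTop (𝓝 0)) {f : Eu n → ℝ} (hf : Continuous f) (x : Eu n) :
    Tendsto (fun k => mol (κ k) f x) atTop (𝓝 (f x)) := by
  rw [Metric.tendsto_atTop]
  intro η hη
  obtain ⟨δ, hδ, hfδ⟩ := Metric.continuous_iff.1 hf x (η / 2) (by linarith)
  obtain ⟨K, hK⟩ := (hε.eventually (gt_mem_nhds hδ)).exists_forall_of_atTop
  refine ⟨K, fun k hk => ?_⟩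
  have h1 : ∀ y, ‖y - x‖ ≤ ε k → |f y - f x| < η / 2 := fun y hy => by
    have := hfδ y (by rw [dist_eq_norm]; exact hy.trans_lt (hK k hk))
    rwa [Real.dist_eq] at this
  rw [Real.dist_eq]
  refine lt_of_le_of_lt (abs_le.2 ⟨?_, ?_⟩) (half_lt_self hη)
  · have := (hκ k).le_mol hf (x := x) (M := f x - η / 2) fun y hy => by
      linarith [(abs_lt.1 (h1 y hy)).1]
    linarith
  · have := (hκ k).mol_le hf (x := x) (M := f x + η / 2) fun y hy => by
      linarith [(abs_lt.1 (h1 y hy)).2]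
    linarith

end Calculus

section Weak

variable {n : ℕ}

theorem continuousOn_integral_of_abs_le {Y : Type*} [TopologicalSpace Y]
    [FirstCountableTopology Y] {f : Eu n → Y → ℝ} {S : Set Y} {M R : ℝ}
    (hx : ∀ t ∈ S, Continuous fun x => f x t) (ht : ∀ x, ContinuousOn (f x) S)
    (hM : ∀ t ∈ S, ∀ x, |f x t| ≤ M) (hR : ∀ t ∈ S, ∀ x, R < ‖x‖ → f x t = 0) :
    ContinuousOn (fun t => ∫ x, f x t) S := by
  apply continuousOn_of_dominated (bound := (closedBall (0 : Eu n) R).indicator fun _ => M)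
  · exact fun t h => (hx t h).aestronglyMeasurable
  · intro t h
    filter_upwards with x
    by_cases hxR : ‖x‖ ≤ R
    · rw [indicator_of_mem (by simpa using hxR)]
      exact hM t h x
    · rw [hR t h x (not_le.1 hxR), indicator_of_notMem (by simpa using hxR)]
      simp
  · exact (integrable_indicator_iff measurableSet_closedBall).2
      (integrableOn_const (isCompact_closedBall _ _).measure_lt_top.ne)
  · filter_upwards with x using ht x

/-- `u` is separately continuous, and bounded by `N` on `closedBall 0 R × [a, b]`. -/
structure Reg (R a b N : ℝ) (u : Eu n → ℝ → ℝ) : Prop where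
  cx : ∀ t, Continuous fun x => u x t
  ct : ∀ x, Continuous (u x)
  bd : ∀ x, ‖x‖ ≤ R → ∀ t ∈ Icc a b, |u x t| ≤ N

/-- `φ` is a `C²` test function supported in the open ball of radius `R`. -/
structure Test (R : ℝ) (φ : Eu n → ℝ) : Prop where
  smooth : ContDiff ℝ 2 φ
  supp : tsupport φ ⊆ ball 0 R

/-- `uₜ = Δu + g` holds at all times of `I` when tested against spatial test functions. -/
def WeakEq (R : ℝ) (I : Set ℝ) (u g : Eu n → ℝ → ℝ) : Prop :=
  ∀ φ : Eu n → ℝ, Test R φ → ∀ t ∈ I,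
    HasDerivAt (fun t => ∫ x, u x t * φ x) (∫ x, (u x t * lap φ x + g x t * φ x)) t

namespace Test

variable {R : ℝ} {φ : Eu n → ℝ}

theorem hasCompactSupport (h : Test R φ) : HasCompactSupport φ :=
  (isCompact_closedBall 0 R).of_isClosed_subset (isClosed_tsupport _)
    (h.supp.trans ball_subset_closedBall)

theorem eq_zero (h : Test R φ) {x : Eu n} (hx : R ≤ ‖x‖) : φ x = 0 :=
  image_eq_zero_of_notMem_tsupport fun h' => by
    have := h.supp h'
    simp at this
    linarith

theorem lap_eq_zero (h : Test R φ) {x : Eu n} (hx : R ≤ ‖x‖) : lap φ x = 0 :=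
  image_eq_zero_of_notMem_tsupport fun h' => by
    have := h.supp (tsupport_lap_subset φ h')
    simp at this
    linarith

end Test

theorem exists_abs_le_of_hasCompactSupport {f : Eu n → ℝ} (hf : Continuous f)
    (hc : HasCompactSupport f) : ∃ C, 0 ≤ C ∧ ∀ x, |f x| ≤ C := by
  obtain ⟨C, hC⟩ := hc.exists_bound_of_continuous hf
  exact ⟨C, (norm_nonneg _).trans (hC 0), hC⟩

namespace Reg

variable {R a b N : ℝ} {u g : Eu n → ℝ → ℝ}

theorem mono (h : Reg R a b N u) {R' a' b' N' : ℝ} (hR : R' ≤ R) (ha : a ≤ a') (hb : b' ≤ b)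
    (hN : N ≤ N') : Reg R' a' b' N' u :=
  ⟨h.cx, h.ct, fun x hx t ht =>
    (h.bd x (hx.trans hR) t ⟨ha.trans ht.1, ht.2.trans hb⟩).trans hN⟩

theorem neg (h : Reg R a b N u) : Reg R a b N fun x t => -u x t :=
  ⟨fun t => (h.cx t).neg, fun x => (h.ct x).neg, fun x hx t ht => by
    rw [abs_neg]; exact h.bd x hx t ht⟩

theorem continuousOn_integral_mul (h : Reg R a b N u) {φ : Eu n → ℝ} (hφ : Continuous φ)
    (hc : HasCompactSupport φ) (hR : ∀ x, R < ‖x‖ → φ x = 0) :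
    ContinuousOn (fun t => ∫ x, u x t * φ x) (Icc a b) := by
  obtain ⟨C, hC0, hC⟩ := exists_abs_le_of_hasCompactSupport hφ hc
  apply continuousOn_integral_of_abs_le (M := |N| * C) (R := R)
  · exact fun t _ => (h.cx t).mul hφ
  · exact fun x => ((h.ct x).mul continuous_const).continuousOn
  · intro t ht x
    by_cases hx : ‖x‖ ≤ R
    · rw [abs_mul]
      exact mul_le_mul ((h.bd x hx t ht).trans (le_abs_self N)) (hC x) (abs_nonneg _)
        (abs_nonneg _)
    · simp [hR x (not_le.1 hx), mul_nonneg (abs_nonneg N) hC0]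
  · intro t _ x hx
    simp [hR x hx]

theorem continuousOn_integral_weak (hu : Reg R a b N u) (hg : Reg R a b N g) {φ : Eu n → ℝ}
    (hφ : Test R φ) :
    ContinuousOn (fun t => ∫ x, (u x t * lap φ x + g x t * φ x)) (Icc a b) := by
  have h1 := hu.continuousOn_integral_mul hφ.smooth.continuous_lap hφ.hasCompactSupport.lap
    fun x hx => hφ.lap_eq_zero hx.le
  have h2 := hg.continuousOn_integral_mul hφ.smooth.continuous hφ.hasCompactSupport
    fun x hx => hφ.eq_zero hx.le
  refine (h1.add h2).congr fun t _ => ?_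
  rw [integral_add]
  · rfl
  · exact ((hu.cx t).mul hφ.smooth.continuous_lap).integrable_of_hasCompactSupport
      hφ.hasCompactSupport.lap.mul_left
  · exact ((hg.cx t).mul hφ.smooth.continuous).integrable_of_hasCompactSupport
      hφ.hasCompactSupport.mul_left

theorem continuousOn_mol (h : Reg R a b N u) {κ : Eu n → ℝ} {ε : ℝ} (hκ : Continuous κ)
    (hs : tsupport κ ⊆ closedBall 0 ε) :
    ContinuousOn (fun z : Eu n × ℝ => mol κ (fun y => u y z.2) z.1)
      (closedBall 0 (R - ε) ×ˢ Icc a b) := by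
  have hc : HasCompactSupport κ :=
    (isCompact_closedBall _ _).of_isClosed_subset (isClosed_tsupport _) hs
  obtain ⟨C, hC0, hC⟩ := exists_abs_le_of_hasCompactSupport hκ hc
  have h0 : ∀ x y : Eu n, ‖x‖ ≤ R - ε → R < ‖y‖ → κ (x - y) = 0 := fun x y hx hy =>
    image_eq_zero_of_notMem_tsupport fun h' => by
      have := hs h'
      rw [mem_closedBall_zero_iff, norm_sub_rev] at this
      linarith [norm_sub_norm_le y x]
  apply continuousOn_integral_of_abs_le (f := fun y (z : Eu n × ℝ) => u y z.2 * κ (z.1 - y))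
    (M := |N| * C) (R := R)
  · exact fun z _ => (h.cx z.2).mul (hκ.comp (by fun_prop))
  · exact fun y => (((h.ct y).comp continuous_snd).mul (hκ.comp (by fun_prop))).continuousOn
  · rintro ⟨x, t⟩ ⟨hx, ht⟩ y
    by_cases hy : ‖y‖ ≤ R
    · rw [abs_mul]
      exact mul_le_mul ((h.bd y hy t ht).trans (le_abs_self N)) (hC _) (abs_nonneg _)
        (abs_nonneg _)
    · simp [h0 x y (by simpa using hx) (not_le.1 hy), mul_nonneg (abs_nonneg N) hC0]
  · rintro ⟨x, t⟩ ⟨hx, ht⟩ y hy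
    simp [h0 x y (by simpa using hx) hy]

end Reg

theorem Test.comp_sub_left {κ : Eu n → ℝ} {ε R : ℝ} (hκ : ContDiff ℝ 2 κ)
    (hs : tsupport κ ⊆ closedBall 0 ε) {x : Eu n} (hx : ‖x‖ + ε < R) :
    Test R fun y => κ (x - y) := by
  refine ⟨hκ.comp (by fun_prop), ?_⟩
  have hsub : Function.support (fun y => κ (x - y)) ⊆ closedBall x ε := fun y hy => by
    have := hs (subset_tsupport κ hy)
    rw [mem_closedBall_zero_iff] at this
    rwa [mem_closedBall, dist_comm, dist_eq_norm]
  refine (closure_minimal hsub isClosed_closedBall).trans fun y hy => ?_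
  rw [mem_closedBall, dist_eq_norm] at hy
  rw [mem_ball_zero_iff]
  linarith [norm_sub_norm_le y x]

theorem WeakEq.hasDerivAt_mol {R : ℝ} {I : Set ℝ} {u g : Eu n → ℝ → ℝ} (h : WeakEq R I u g)
    (hu : ∀ t, Continuous fun x => u x t) (hg : ∀ t, Continuous fun x => g x t)
    {κ : Eu n → ℝ} {ε : ℝ} (hκ : ContDiff ℝ 2 κ) (hs : tsupport κ ⊆ closedBall 0 ε)
    {x : Eu n} (hx : ‖x‖ + ε < R) {t : ℝ} (ht : t ∈ I) :
    HasDerivAt (fun t => mol κ (fun y => u y t) x)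
      (mol (lap κ) (fun y => u y t) x + mol κ (fun y => g y t) x) t := by
  have hc : HasCompactSupport κ :=
    (isCompact_closedBall _ _).of_isClosed_subset (isClosed_tsupport _) hs
  have := h _ (Test.comp_sub_left hκ hs hx) t ht
  simp only [lap_comp_sub_left hκ] at this
  rw [integral_add (integrable_mol hκ.continuous_lap hc.lap (hu t) x)
    (integrable_mol hκ.continuous hc (hg t) x)] at this
  exact this

theorem nonpos_of_hasDerivAt_of_forall_le {f : ℝ → ℝ} {f' a t : ℝ} (h : HasDerivAt f f' t)
    (hat : a < t) (hmin : ∀ s ∈ Icc a t, f t ≤ f s) : f' ≤ 0 := by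
  have h1 : Tendsto (slope f t) (𝓝[<] t) (𝓝 f') :=
    (hasDerivAt_iff_tendsto_slope.1 h).mono_left
      (nhdsWithin_mono _ fun s (hs : s < t) => ne_of_lt hs)
  refine le_of_tendsto h1 ?_
  filter_upwards [Ioo_mem_nhdsLT hat] with s hs
  rw [slope_def_field]
  exact div_nonpos_of_nonneg_of_nonpos (by linarith [hmin s ⟨hs.1.le, hs.2.le⟩])
    (by linarith [hs.2])

theorem mol_sub_le_mol {R a b N m ε ρ : ℝ} {u g : Eu n → ℝ → ℝ} (hu : Reg R a b N u)
    (hg : Reg R a b N g) (hw : WeakEq R (Ioo a b) u g)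
    (hm : ∀ φ, Test R φ → (∀ x, 0 ≤ φ x) → |∫ x, u x a * lap φ x| ≤ m * ∫ x, φ x)
    {κ : Eu n → ℝ} (hκ : IsMoll κ ε) (hρ : 0 < ρ) {x₀ : Eu n} (hx₀ : ‖x₀‖ + ρ + ε < R)
    {t : ℝ} (ht : t ∈ Ico a b) :
    mol κ (fun y => u y a) x₀ - (N + m + 8 * n * N / ρ ^ 2 + 1) * (t - a)
      ≤ mol κ (fun y => u y t) x₀ := by
  set C := N + m + 8 * n * N / ρ ^ 2 + 1 with hC
  have hκ2 : ContDiff ℝ 2 κ := contDiff_infty.1 hκ.smooth 2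
  have hin : ∀ x : Eu n, ‖x - x₀‖ ≤ ρ → ‖x‖ + ε < R := fun x hx => by
    linarith [norm_sub_norm_le x x₀]
  have hbd : ∀ x : Eu n, ‖x - x₀‖ ≤ ρ → ∀ s ∈ Icc a b, ∀ f : Eu n → ℝ → ℝ, Reg R a b N f →
      |mol κ (fun y => f y s) x| ≤ N := fun x hx s hs f hf =>
    hκ.abs_mol_le (hf.cx s) fun y hy => hf.bd y (by
      linarith [norm_sub_norm_le y x, hin x hx]) s hs
  have hlapa : ∀ x : Eu n, ‖x - x₀‖ ≤ ρ → |mol (lap κ) (fun y => u y a) x| ≤ m := fun x hx => by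
    have := hm _ (Test.comp_sub_left hκ2 hκ.supp (hin x hx)) fun y => hκ.nonneg _
    simp only [lap_comp_sub_left hκ2] at this
    rwa [hκ.integral_sub, mul_one] at this
  set v : Eu n × ℝ → ℝ := fun z => mol κ (fun y => u y z.2) z.1 - mol κ (fun y => u y a) z.1
    + C * (z.2 - a) + 4 * N / ρ ^ 2 * ‖z.1 - x₀‖ ^ 2 with hv
  have hab : a < b := ht.1.trans_lt ht.2
  have hN : 0 ≤ N := (abs_nonneg _).trans
    (hbd x₀ (by simpa using hρ.le) a (left_mem_Icc.2 hab.le) u hu)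
  have hKc : IsCompact (closedBall x₀ ρ ×ˢ Icc a t) :=
    (isCompact_closedBall _ _).prod isCompact_Icc
  have hsub : closedBall x₀ ρ ×ˢ Icc a t ⊆ closedBall 0 (R - ε) ×ˢ Icc a b :=
    prod_mono (fun x hx => by
      have := hin x (by simpa [dist_eq_norm] using hx)
      simp; linarith) (Icc_subset_Icc_right ht.2.le)
  have hvc : ContinuousOn v (closedBall x₀ ρ ×ˢ Icc a t) := by
    have h1 := (hu.continuousOn_mol hκ2.continuous hκ.supp).mono hsub
    have h2 : Continuous (mol κ (fun y => u y a)) :=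
      (contDiff_mol hκ.smooth hκ.hasCompactSupport (hu.cx a)).continuous
    refine ((h1.sub (h2.comp continuous_fst).continuousOn).add ?_).add ?_
    · exact Continuous.continuousOn (by fun_prop)
    · exact Continuous.continuousOn (by fun_prop)
  obtain ⟨⟨x, s⟩, ⟨hx, hs⟩, hmin⟩ := hKc.exists_isMinOn
    ⟨(x₀, t), mem_closedBall_self hρ.le, ht.1, le_rfl⟩ hvc
  rw [mem_closedBall, dist_eq_norm] at hx
  have hs' : s ∈ Icc a b := ⟨hs.1, hs.2.trans ht.2.le⟩
  have hkey : 0 ≤ v (x, s) := by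
    rcases hs.1.eq_or_lt with hsa | hsa
    · have hsa' : s = a := hsa.symm
      simp only [hv, hsa', sub_self, mul_zero, zero_add]
      positivity
    rcases hx.eq_or_lt with hxr | hxr
    · have h1 := abs_le.1 (hbd x hx s hs' u hu)
      have h2 := abs_le.1 (hbd x hx a (left_mem_Icc.2 hab.le) u hu)
      have h3 : 4 * N / ρ ^ 2 * ‖x - x₀‖ ^ 2 = 4 * N := by rw [hxr]; field_simp
      have hm0 : 0 ≤ m := (abs_nonneg _).trans (hlapa x hx)
      have h4 : 0 ≤ C * (s - a) := mul_nonneg (by positivity) (by linarith)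
      simp only [hv]
      linarith
    · exfalso
      have hmola : ContDiff ℝ 2 (mol κ fun y => u y a) :=
        contDiff_mol (m := 2) hκ2 hκ.hasCompactSupport (hu.cx a)
      have hmols : ContDiff ℝ 2 (mol κ fun y => u y s) :=
        contDiff_mol (m := 2) hκ2 hκ.hasCompactSupport (hu.cx s)
      have hd := hw.hasDerivAt_mol hu.cx hg.cx hκ2 hκ.supp (hin x hx)
        (⟨hsa, hs.2.trans_lt ht.2⟩ : s ∈ Ioo a b)
      have hd2 : HasDerivAt (fun τ => v (x, τ)) (mol (lap κ) (fun y => u y s) x +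
          mol κ (fun y => g y s) x + C) s := by
        refine (((hd.sub_const (mol κ (fun y => u y a) x)).add
          (((hasDerivAt_id s).sub_const a).const_mul C)).add_const
            (4 * N / ρ ^ 2 * ‖x - x₀‖ ^ 2)).congr_deriv (by simp)
      have h1 := nonpos_of_hasDerivAt_of_forall_le hd2 hsa fun τ hτ =>
        hmin ⟨by simpa [dist_eq_norm] using hx, hτ.1, hτ.2.trans hs.2⟩
      have hq : ContDiff ℝ 2 fun y : Eu n => 4 * N / ρ ^ 2 * ‖y - x₀‖ ^ 2 :=
        contDiff_const.mul ((contDiff_norm_sq ℝ).comp (contDiff_id.sub contDiff_const))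
      have hlq : lap (fun y : Eu n => 4 * N / ρ ^ 2 * ‖y - x₀‖ ^ 2) x
          = 8 * n * N / ρ ^ 2 := by
        have h5 : ContDiff ℝ 2 fun y : Eu n => ‖y - x₀‖ ^ 2 :=
          (contDiff_norm_sq ℝ).comp (contDiff_id.sub contDiff_const)
        have h6 := lap_comp_affine (contDiff_norm_sq ℝ (E := Eu n) (n := 2)) (-x₀) 1 x
        simp only [one_smul, neg_add_eq_sub] at h6
        rw [lap_const_mul _ h5, h6, lap_norm_sq]
        ring
      have hloc : IsLocalMin (fun y => v (y, s)) x := by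
        filter_upwards [isOpen_ball.mem_nhds (show x ∈ ball x₀ ρ by
          simpa [dist_eq_norm] using hxr)] with y hy
        exact hmin ⟨ball_subset_closedBall hy, hs⟩
      have hvs : ContDiff ℝ 2 fun y => v (y, s) :=
        ((hmols.sub hmola).add (contDiff_const (c := C * (s - a)))).add hq
      have h2 := lap_nonneg_of_isLocalMin hvs hloc
      have h3 : lap (fun y => v (y, s)) x = mol (lap κ) (fun y => u y s) x
          - mol (lap κ) (fun y => u y a) x + 0 + 8 * n * N / ρ ^ 2 := by
        simp only [hv]
        rw [lap_add ((hmols.sub hmola).add contDiff_const) hq,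
          lap_add (hmols.sub hmola) contDiff_const, lap_const, hlq, lap_sub hmols hmola,
          lap_mol hκ2 hκ.hasCompactSupport (hu.cx s), lap_mol hκ2 hκ.hasCompactSupport (hu.cx a)]
      have h4 := abs_le.1 (hlapa x hx)
      have h5 := abs_le.1 (hbd x hx s hs' g hg)
      linarith
  have := hkey.trans (hmin ⟨mem_closedBall_self hρ.le, ht.1, le_rfl⟩ : v (x, s) ≤ v (x₀, t))
  simp only [hv, sub_self, norm_zero] at this
  norm_num at this
  linarith

/-- A lower bound for the decrease of a solution after a time at which its Laplacian is bounded. -/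
theorem sub_le_of_weakEq {R a b N m ρ : ℝ} {u g : Eu n → ℝ → ℝ} (hu : Reg R a b N u)
    (hg : Reg R a b N g) (hw : WeakEq R (Ioo a b) u g)
    (hm : ∀ φ, Test R φ → (∀ x, 0 ≤ φ x) → |∫ x, u x a * lap φ x| ≤ m * ∫ x, φ x)
    (hρ : 0 < ρ) {x₀ : Eu n} (hx₀ : ‖x₀‖ + ρ < R) {t : ℝ} (ht : t ∈ Ico a b) :
    u x₀ a - (N + m + 8 * n * N / ρ ^ 2 + 1) * (t - a) ≤ u x₀ t := by
  set δ := R - (‖x₀‖ + ρ) with hδ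
  have hδ0 : 0 < δ := by linarith
  choose κ hκ using fun k : ℕ => exists_isMoll n (ε := δ / ((k : ℝ) + 2)) (by positivity)
  have hε : Tendsto (fun k : ℕ => δ / ((k : ℝ) + 2)) atTop (𝓝 0) :=
    tendsto_const_nhds.div_atTop
      (tendsto_atTop_add_const_right _ _ tendsto_natCast_atTop_atTop)
  refine le_of_tendsto_of_tendsto' ((tendsto_mol hκ hε (hu.cx a) x₀).sub_const _)
    (tendsto_mol hκ hε (hu.cx t) x₀) fun k => mol_sub_le_mol hu hg hw hm (hκ k) hρ ?_ ht
  have : δ / ((k : ℝ) + 2) < δ := div_lt_self hδ0 (by linarith [(Nat.cast_nonneg k : (0:ℝ) ≤ k)])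
  linarith

end Weak

section Weak

variable {n : ℕ}

theorem exists_isOpen_inter_subset {X : Type*} [TopologicalSpace X] [LocallyCompactSpace X]
    [T2Space X] {F : Set X} (hF : IsLocallyClosed F) (hne : F.Nonempty) {A : ℕ → Set X}
    (hA : ∀ m, IsClosed ((Subtype.val : F → X) ⁻¹' A m)) (hcov : ∀ x ∈ F, ∃ m, x ∈ A m) :
    ∃ m, ∃ U, IsOpen U ∧ (F ∩ U).Nonempty ∧ F ∩ U ⊆ A m := by
  have := hF.locallyCompactSpace
  have : Nonempty F := hne.to_subtype
  obtain ⟨m, ⟨x, hx⟩⟩ := nonempty_interior_of_iUnion_of_closed hA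
    (eq_univ_of_forall fun x : F => mem_iUnion.2 (hcov x x.2))
  obtain ⟨U, hU, hUe⟩ := isOpen_induced_iff.1 (isOpen_interior (s := (Subtype.val : F → X) ⁻¹' A m))
  refine ⟨m, U, hU, ⟨x, x.2, ?_⟩, fun y hy => ?_⟩
  · have : x ∈ Subtype.val ⁻¹' U := hUe ▸ hx
    exact this
  · have : (⟨y, hy.1⟩ : F) ∈ interior ((Subtype.val : F → X) ⁻¹' A m) := by
      rw [← hUe]; exact hy.2
    exact (interior_subset (s := (Subtype.val : F → X) ⁻¹' A m) this :)

theorem le_of_forall_gap {F : Set ℝ} {g : ℝ → ℝ} {s t : ℝ} (hst : s ≤ t) (hsF : s ∈ F)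
    (hF : IsClosed (F ∩ Icc s t)) (hg : ContinuousOn g (Icc s t))
    (hd : ∀ τ ∈ F ∩ Ico s t, ∀ᶠ τ' in 𝓝[>] τ, g τ ≤ g τ')
    (hgap : ∀ a ∈ F, ∀ b, s ≤ a → a < b → b ≤ t → (∀ τ ∈ Ioo a b, τ ∉ F) →
      ∀ τ ∈ Ico a b, g a ≤ g τ) : g s ≤ g t := by
  have hgap' : ∀ a ∈ F, ∀ b, s ≤ a → a < b → b ≤ t → (∀ τ ∈ Ioo a b, τ ∉ F) → g a ≤ g b := by
    intro a ha b hsa hab hbt hgb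
    have h1 : Tendsto g (𝓝[Ico a b] b) (𝓝 (g b)) :=
      (hg b ⟨hsa.trans hab.le, hbt⟩).mono_left
        (nhdsWithin_mono _ fun τ hτ => ⟨hsa.trans hτ.1, hτ.2.le.trans hbt⟩)
    have : (𝓝[Ico a b] b).NeBot := by
      rw [← mem_closure_iff_nhdsWithin_neBot, closure_Ico hab.ne]
      exact right_mem_Icc.2 hab.le
    refine ge_of_tendsto h1 ?_
    filter_upwards [self_mem_nhdsWithin] with τ hτ using hgap a ha b hsa hab hbt hgb τ hτ
  have hSc : IsCompact ((F ∩ Icc s t) ∩ {τ | g s ≤ g τ}) := by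
    have : IsClosed ((F ∩ Icc s t) ∩ g ⁻¹' Ici (g s)) :=
      (hg.mono inter_subset_right).preimage_isClosed_of_isClosed hF isClosed_Ici
    exact isCompact_Icc.of_isClosed_subset this fun τ hτ => hτ.1.2
  obtain ⟨σ, ⟨⟨hσF, hσ⟩, hσg⟩, hmax⟩ := hSc.exists_isGreatest ⟨s, ⟨hsF, le_rfl, hst⟩, le_refl (g s)⟩
  rcases hσ.2.eq_or_lt with h | hσt
  · rw [← h]; exact hσg
  by_cases hne : ∃ τ ∈ F, τ ∈ Ioc σ t
  · exfalso
    obtain ⟨η, hη, hηg⟩ := mem_nhdsGT_iff_exists_Ioc_subset.1 (hd σ ⟨hσF, hσ.1, hσt⟩)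
    have hFη : ∀ τ ∈ F, τ ∈ Ioc σ t → η < τ := by
      intro τ hτF hτ
      by_contra hle
      have h1 : g s ≤ g τ := (show g s ≤ g σ from hσg).trans (hηg ⟨hτ.1, not_lt.1 hle⟩)
      exact absurd (hmax ⟨⟨hτF, hσ.1.trans hτ.1.le, hτ.2⟩, h1⟩) (not_le.2 hτ.1)
    obtain ⟨τ₀, hτ₀F, hτ₀⟩ := hne
    have hc : IsCompact ((F ∩ Icc s t) ∩ Icc η t) :=
      isCompact_Icc.of_isClosed_subset (hF.inter isClosed_Icc) inter_subset_right
    obtain ⟨b, ⟨⟨hbF, hbs⟩, hb⟩, hmin⟩ := hc.exists_isLeast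
      ⟨τ₀, ⟨hτ₀F, hσ.1.trans hτ₀.1.le, hτ₀.2⟩, (hFη τ₀ hτ₀F hτ₀).le, hτ₀.2⟩
    have hσb : σ < b := lt_of_lt_of_le hη hb.1
    have h1 := hgap' σ hσF b hσ.1 hσb hb.2 fun τ hτ hτF => by
      have hτt : τ ∈ Ioc σ t := ⟨hτ.1, hτ.2.le.trans hb.2⟩
      exact absurd (hmin ⟨⟨hτF, hσ.1.trans hτ.1.le, hτt.2⟩, (hFη τ hτF hτt).le, hτt.2⟩)
        (not_le.2 hτ.2)
    exact absurd (hmax ⟨⟨hbF, hbs⟩, (show g s ≤ g σ from hσg).trans h1⟩) (not_le.2 hσb)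
  · push Not at hne
    exact (show g s ≤ g σ from hσg).trans (hgap' σ hσF t hσ.1 hσt le_rfl fun τ hτ hτF =>
      hne τ hτF ⟨hτ.1, hτ.2.le⟩)

theorem eventually_le_of_hasDerivAt_pos {g : ℝ → ℝ} {g' τ : ℝ} (h : HasDerivAt g g' τ)
    (hpos : 0 < g') : ∀ᶠ τ' in 𝓝[>] τ, g τ ≤ g τ' := by
  have h1 : Tendsto (slope g τ) (𝓝[>] τ) (𝓝 g') :=
    (hasDerivAt_iff_tendsto_slope.1 h).mono_left
      (nhdsWithin_mono _ fun s (hs : τ < s) => (ne_of_lt hs).symm)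
  filter_upwards [h1.eventually (lt_mem_nhds hpos), self_mem_nhdsWithin] with s hs hs2
  rw [slope_def_field] at hs
  have h3 : (0 : ℝ) < s - τ := sub_pos.2 hs2
  have := (div_pos_iff_of_pos_right h3).1 hs
  linarith

/-- A separately regular pointwise solution of `uₜ = Δu + g`. -/
structure ClassicalSol (u g : Eu n → ℝ → ℝ) : Prop where
  cx : ∀ t, ContDiff ℝ 2 fun x => u x t
  ct : ∀ x, ContDiff ℝ 1 (u x)
  gx : ∀ t, Continuous fun x => g x t
  gt : ∀ x, Continuous (g x)
  eq : ∀ x t, deriv (u x) t = lap (fun y => u y t) x + g x t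

theorem ClassicalSol.neg {u g : Eu n → ℝ → ℝ} (h : ClassicalSol u g) :
    ClassicalSol (fun x t => -u x t) (fun x t => -g x t) where
  cx t := (h.cx t).neg
  ct x := (h.ct x).neg
  gx t := (h.gx t).neg
  gt x := (h.gt x).neg
  eq x t := by
    rw [deriv.fun_neg, h.eq, lap_neg (h.cx t)]
    ring

theorem ClassicalSol.hasDerivAt {u g : Eu n → ℝ → ℝ} (h : ClassicalSol u g) (x : Eu n) (t : ℝ) :
    HasDerivAt (u x) (lap (fun y => u y t) x + g x t) t := by
  rw [← h.eq]
  exact ((h.ct x).differentiable (by norm_num) t).hasDerivAt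

theorem WeakEq.neg {R : ℝ} {I : Set ℝ} {u g : Eu n → ℝ → ℝ} (h : WeakEq R I u g) :
    WeakEq R I (fun x t => -u x t) (fun x t => -g x t) := by
  intro φ hφ t ht
  have := (h φ hφ t ht).neg
  simp only [neg_mul, ← neg_add, integral_neg]
  exact this

theorem abs_lap_le_of_forall_test {f : Eu n → ℝ} (hf : ContDiff ℝ 2 f) {R m : ℝ}
    (hm : ∀ φ, Test R φ → (∀ x, 0 ≤ φ x) → |∫ x, f x * lap φ x| ≤ m * ∫ x, φ x)
    {x : Eu n} (hx : ‖x‖ < R) : |lap f x| ≤ m := by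
  have hδ0 : 0 < R - ‖x‖ := by linarith
  choose κ hκ using fun k : ℕ => exists_isMoll n (ε := (R - ‖x‖) / ((k : ℝ) + 2)) (by positivity)
  have hε : Tendsto (fun k : ℕ => (R - ‖x‖) / ((k : ℝ) + 2)) atTop (𝓝 0) :=
    tendsto_const_nhds.div_atTop
      (tendsto_atTop_add_const_right _ _ tendsto_natCast_atTop_atTop)
  refine le_of_tendsto' (tendsto_mol hκ hε hf.continuous_lap x).abs fun k => ?_
  have h1 : (R - ‖x‖) / ((k : ℝ) + 2) < R - ‖x‖ :=
    div_lt_self hδ0 (by linarith [(Nat.cast_nonneg k : (0:ℝ) ≤ k)])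
  have hκ2 : ContDiff ℝ 2 (κ k) := contDiff_infty.1 (hκ k).smooth 2
  have ht := Test.comp_sub_left hκ2 (hκ k).supp (x := x) (R := R) (by linarith)
  have h2 := hm _ ht fun y => (hκ k).nonneg _
  rw [integral_mul_lap hf ht.smooth ht.hasCompactSupport, (hκ k).integral_sub, mul_one] at h2
  exact h2

theorem ClassicalSol.sub_le {R a b N m ρ α β : ℝ} {u g : Eu n → ℝ → ℝ} (h : ClassicalSol u g)
    (hu : Reg R a b N u)
    (hg : Reg R a b N g) {F : Set ℝ} (hJ : Ioo α β ⊆ Ioo a b)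
    (hF : ∀ s ∈ Ioo α β, ∀ t ∈ Ioo α β, IsClosed (F ∩ Icc s t))
    (hw : WeakEq R (Ioo α β \ F) u g)
    (hm : ∀ τ ∈ F ∩ Ioo α β, ∀ φ, Test R φ → (∀ x, 0 ≤ φ x) →
      |∫ x, u x τ * lap φ x| ≤ m * ∫ x, φ x)
    (hρ : 0 < ρ) {x : Eu n} (hx : ‖x‖ + ρ < R) {s t : ℝ} (hs : s ∈ F ∩ Ioo α β)
    (ht : t ∈ Ioo α β) (hst : s ≤ t) :
    u x s - (N + m + 8 * n * N / ρ ^ 2 + 1) * (t - s) ≤ u x t := by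
  set C := N + m + 8 * n * N / ρ ^ 2 + 1 with hC
  have hN : 0 ≤ N := (abs_nonneg _).trans (hu.bd x (by linarith) s ⟨(hJ hs.2).1.le, (hJ hs.2).2.le⟩)
  have hmem : ∀ τ ∈ Icc s t, τ ∈ Ioo α β := fun τ hτ =>
    ⟨hs.2.1.trans_le hτ.1, hτ.2.trans_lt ht.2⟩
  have key := le_of_forall_gap (g := fun τ => u x τ + C * (τ - s)) hst hs.1 (hF s hs.2 t ht)
    ((h.ct x).continuous.add (by fun_prop)).continuousOn ?_ ?_
  · simp only [sub_self, mul_zero, add_zero] at key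
    linarith
  · rintro τ ⟨hτF, hτ⟩
    have hτJ := hmem τ ⟨hτ.1, hτ.2.le⟩
    have hd := (h.hasDerivAt x τ).add (((hasDerivAt_id τ).sub_const s).const_mul C)
    refine eventually_le_of_hasDerivAt_pos hd ?_
    have h1 := (abs_le.1 (abs_lap_le_of_forall_test (h.cx τ) (hm τ ⟨hτF, hτJ⟩)
      (x := x) (by linarith))).1
    have h2 := (abs_le.1 (hg.bd x (by linarith) τ ⟨(hJ hτJ).1.le, (hJ hτJ).2.le⟩)).1
    have h3 : 0 ≤ 8 * n * N / ρ ^ 2 := by positivity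
    simp only [mul_one]
    linarith
  · intro a' ha' b' hsa hab hbt hgap τ hτ
    have ha'J := hmem a' ⟨hsa, hab.le.trans hbt⟩
    have hb'J := hmem b' ⟨hsa.trans hab.le, hbt⟩
    have := sub_le_of_weakEq (hu.mono le_rfl (hJ ha'J).1.le (hJ hb'J).2.le le_rfl)
      (hg.mono le_rfl (hJ ha'J).1.le (hJ hb'J).2.le le_rfl)
      (fun φ hφ σ hσ => hw φ hφ σ ⟨⟨ha'J.1.trans hσ.1, hσ.2.trans hb'J.2⟩, hgap σ hσ⟩)
      (hm a' ⟨ha', ha'J⟩) hρ hx hτ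
    linarith

theorem ClassicalSol.abs_sub_le {R a b N m ρ α β : ℝ} {u g : Eu n → ℝ → ℝ} (h : ClassicalSol u g)
    (hu : Reg R a b N u)
    (hg : Reg R a b N g) {F : Set ℝ} (hJ : Ioo α β ⊆ Ioo a b)
    (hF : ∀ s ∈ Ioo α β, ∀ t ∈ Ioo α β, IsClosed (F ∩ Icc s t))
    (hw : WeakEq R (Ioo α β \ F) u g)
    (hm : ∀ τ ∈ F ∩ Ioo α β, ∀ φ, Test R φ → (∀ x, 0 ≤ φ x) →
      |∫ x, u x τ * lap φ x| ≤ m * ∫ x, φ x)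
    (hρ : 0 < ρ) {x : Eu n} (hx : ‖x‖ + ρ < R) {s t : ℝ} (hs : s ∈ F ∩ Ioo α β)
    (ht : t ∈ Ioo α β) (hst : s ≤ t) :
    |u x t - u x s| ≤ (N + m + 8 * n * N / ρ ^ 2 + 1) * (t - s) := by
  have h1 := h.sub_le hu hg hJ hF hw hm hρ hx hs ht hst
  have h2 := h.neg.sub_le hu.neg hg.neg hJ hF hw.neg (fun τ hτ φ hφ hφ0 => by
    simp only [neg_mul, integral_neg, abs_neg]
    exact hm τ hτ φ hφ hφ0) hρ hx hs ht hst
  rw [abs_le]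
  constructor <;> linarith

theorem Test.exists_radius {R : ℝ} {φ : Eu n → ℝ} (hφ : Test R φ) :
    ∃ ρ < R, ∀ x, ρ < ‖x‖ → φ x = 0 := by
  by_cases hne : (tsupport φ).Nonempty
  · obtain ⟨x, hx, hmax⟩ := (hφ.hasCompactSupport : IsCompact _).exists_isMaxOn hne
      continuous_norm.continuousOn
    refine ⟨‖x‖, by simpa using hφ.supp hx, fun y hy => ?_⟩
    exact image_eq_zero_of_notMem_tsupport fun h' => absurd (hmax h') (not_le.2 hy)
  · refine ⟨R - 1, by linarith, fun x _ => image_eq_zero_of_notMem_tsupport fun h' => ?_⟩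
    exact hne ⟨x, h'⟩

theorem ClassicalSol.hasDerivWithinAt_integral {R s β C ρ : ℝ} {u g : Eu n → ℝ → ℝ}
    (h : ClassicalSol u g)
    {φ : Eu n → ℝ} (hφ : Test R φ) (hρ : ∀ x, ρ < ‖x‖ → φ x = 0) (hsβ : s < β)
    (hL : ∀ x, ‖x‖ ≤ ρ → ∀ t ∈ Ioo s β, |u x t - u x s| ≤ C * (t - s)) :
    HasDerivWithinAt (fun t => ∫ x, u x t * φ x) (∫ x, (u x s * lap φ x + g x s * φ x))
      (Ioi s) s := by
  have hI : ∀ t, Integrable fun x => u x t * φ x := fun t =>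
    ((h.cx t).continuous.mul hφ.smooth.continuous).integrable_of_hasCompactSupport
      hφ.hasCompactSupport.mul_left
  have hval : ∫ x, (u x s * lap φ x + g x s * φ x)
      = ∫ x, (lap (fun y => u y s) x + g x s) * φ x := by
    have hg : Integrable fun x => g x s * φ x :=
      ((h.gx s).mul hφ.smooth.continuous).integrable_of_hasCompactSupport
        hφ.hasCompactSupport.mul_left
    simp only [add_mul]
    rw [integral_add _ hg, integral_add _ hg,
      integral_mul_lap (h.cx s) hφ.smooth hφ.hasCompactSupport]
    · exact ((h.cx s).continuous_lap.mul hφ.smooth.continuous).integrable_of_hasCompactSupport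
        hφ.hasCompactSupport.mul_left
    · exact ((h.cx s).continuous.mul hφ.smooth.continuous_lap).integrable_of_hasCompactSupport
        hφ.hasCompactSupport.lap.mul_left
  rw [hval, hasDerivWithinAt_iff_tendsto_slope' (by simp)]
  have hslope : ∀ t, slope (fun t => ∫ x, u x t * φ x) s t = ∫ x, slope (u x) s t * φ x := by
    intro t
    simp only [slope_def_field, div_mul_eq_mul_div, sub_mul]
    rw [integral_div, integral_sub (hI t) (hI s)]
  simp only [funext hslope]
  refine tendsto_integral_filter_of_dominated_convergence (fun x => C * |φ x|) ?_ ?_ ?_ ?_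
  · refine Eventually.of_forall fun t => Continuous.aestronglyMeasurable ?_
    simp only [slope_def_field]
    exact (((h.cx t).continuous.sub (h.cx s).continuous).div_const _).mul hφ.smooth.continuous
  · filter_upwards [Ioo_mem_nhdsGT hsβ] with t ht
    refine Eventually.of_forall fun x => ?_
    by_cases hx : ‖x‖ ≤ ρ
    · rw [Real.norm_eq_abs, abs_mul, slope_def_field, abs_div]
      refine mul_le_mul_of_nonneg_right ?_ (abs_nonneg _)
      have : 0 < t - s := sub_pos.2 ht.1
      rw [abs_of_pos this, div_le_iff₀ this]
      exact hL x hx t ht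
    · simp [hρ x (not_le.1 hx)]
  · exact (hφ.smooth.continuous.abs.integrable_of_hasCompactSupport
      (hφ.hasCompactSupport.comp_left abs_zero)).const_mul C
  · refine Eventually.of_forall fun x => Tendsto.mul_const _ ?_
    exact (hasDerivAt_iff_tendsto_slope.1 (h.hasDerivAt x s)).mono_left
      (nhdsWithin_mono _ fun t (ht : s < t) => (ne_of_lt ht).symm)

theorem hasDerivAt_of_hasDerivWithinAt_Ioi {f f' : ℝ → ℝ} {α β : ℝ}
    (hf : ContinuousOn f (Ioo α β)) (hf' : ContinuousOn f' (Ioo α β))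
    (hd : ∀ t ∈ Ioo α β, HasDerivWithinAt f (f' t) (Ioi t) t) {t : ℝ} (ht : t ∈ Ioo α β) :
    HasDerivAt f (f' t) t := by
  obtain ⟨c, hc⟩ := exists_between ht.1
  have hcJ : c ∈ Ioo α β := ⟨hc.1, hc.2.trans ht.2⟩
  have hsub : ∀ s ∈ Ioo α β, uIcc c s ⊆ Ioo α β := fun s hs =>
    (ordConnected_Ioo).uIcc_subset hcJ hs
  have hint : ∀ s ∈ Ioo α β, IntervalIntegrable f' volume c s := fun s hs =>
    (hf'.mono (hsub s hs)).intervalIntegrable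
  have heq : ∀ s ∈ Ioo α β, f c + ∫ τ in c..s, f' τ = f s := by
    intro s hs
    rw [intervalIntegral.integral_eq_sub_of_hasDeriv_right (hf.mono (hsub s hs))
      (fun τ hτ => hd τ (hsub s hs (Ioo_subset_Icc_self hτ))) (hint s hs)]
    ring
  have h1 := (intervalIntegral.integral_hasDerivAt_right (hint t ht)
    (hf'.stronglyMeasurableAtFilter isOpen_Ioo t ht)
    (hf'.continuousAt (isOpen_Ioo.mem_nhds ht))).const_add (f c)
  refine h1.congr_of_eventuallyEq ?_
  filter_upwards [isOpen_Ioo.mem_nhds ht] with s hs using (heq s hs).symm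

/-- Locally bounded separately regular solutions are weak solutions. -/
theorem ClassicalSol.weakEq {R a b N : ℝ} {u g : Eu n → ℝ → ℝ} (h : ClassicalSol u g)
    (hu : Reg R a b N u)
    (hg : Reg R a b N g) : WeakEq R (Ioo a b) u g := by
  set P : ℝ → Prop := fun t => ∀ φ : Eu n → ℝ, Test R φ →
    HasDerivAt (fun t => ∫ x, u x t * φ x) (∫ x, (u x t * lap φ x + g x t * φ x)) t with hP
  set F : Set ℝ := Ioo a b ∩ (interior {t | P t})ᶜ with hFdef
  have hPout : ∀ t ∈ Ioo a b, t ∉ F → P t := fun t ht htF => by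
    by_contra hnP
    exact htF ⟨ht, fun hi => hnP (interior_subset hi)⟩
  suffices hFe : ¬ F.Nonempty from fun φ hφ t ht => hPout t ht (fun hF => hFe ⟨t, hF⟩) φ hφ
  intro hne
  have hFlc : IsLocallyClosed F :=
    isOpen_Ioo.isLocallyClosed.inter isOpen_interior.isClosed_compl.isLocallyClosed
  set A : ℕ → Set ℝ := fun m => {t | ∀ φ, Test R φ → (∀ x, 0 ≤ φ x) →
    |∫ x, u x t * lap φ x| ≤ m * ∫ x, φ x} with hA
  obtain ⟨m, U, hU, ⟨t₀, ht₀F, ht₀U⟩, hUA⟩ := exists_isOpen_inter_subset hFlc hne (A := A) (by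
    intro m
    have : (Subtype.val : F → ℝ) ⁻¹' A m = ⋂ φ : {φ : Eu n → ℝ // Test R φ ∧ ∀ x, 0 ≤ φ x},
        {t : F | |∫ x, u x t * lap φ.1 x| ≤ m * ∫ x, φ.1 x} := by
      ext t; simp [hA]
    rw [this]
    refine isClosed_iInter fun φ => isClosed_le (Continuous.abs ?_) continuous_const
    have h1 := hu.continuousOn_integral_mul φ.2.1.smooth.continuous_lap
      φ.2.1.hasCompactSupport.lap fun x hx => φ.2.1.lap_eq_zero hx.le
    exact h1.comp_continuous continuous_subtype_val fun t => Ioo_subset_Icc_self t.2.1) (by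
    intro t ht
    obtain ⟨C, hC⟩ := (isCompact_closedBall (0 : Eu n) R).exists_bound_of_continuousOn
      (h.cx t).continuous_lap.continuousOn
    obtain ⟨m, hm⟩ := exists_nat_ge C
    refine ⟨m, fun φ hφ hφ0 => ?_⟩
    rw [integral_mul_lap (h.cx t) hφ.smooth hφ.hasCompactSupport, ← integral_const_mul]
    refine norm_integral_le_of_norm_le (f := fun x => lap (fun y => u y t) x * φ x)
      (g := fun x => (m : ℝ) * φ x) ?_ ?_
    · exact (hφ.smooth.continuous.integrable_of_hasCompactSupport
        hφ.hasCompactSupport).const_mul _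
    · refine Eventually.of_forall fun x => ?_
      by_cases hx : ‖x‖ ≤ R
      · rw [norm_mul, Real.norm_of_nonneg (hφ0 x)]
        exact mul_le_mul_of_nonneg_right ((hC x (by simpa using hx)).trans hm) (hφ0 x)
      · simp [hφ.eq_zero (not_le.1 hx).le])
  obtain ⟨α, β, ht₀J, hJ⟩ := mem_nhds_iff_exists_Ioo_subset.1
    ((hU.inter isOpen_Ioo).mem_nhds ⟨ht₀U, ht₀F.1⟩)
  have hJab : Ioo α β ⊆ Ioo a b := fun t ht => (hJ ht).2
  have hFcl : ∀ s ∈ Ioo α β, ∀ t ∈ Ioo α β, IsClosed (F ∩ Icc s t) := by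
    intro s hs t ht
    have : F ∩ Icc s t = (interior {t | P t})ᶜ ∩ Icc s t := by
      ext τ
      refine ⟨fun hτ => ⟨hτ.1.2, hτ.2⟩, fun hτ => ⟨⟨hJab ?_, hτ.1⟩, hτ.2⟩⟩
      exact ⟨hs.1.trans_le hτ.2.1, hτ.2.2.trans_lt ht.2⟩
    rw [this]
    exact isOpen_interior.isClosed_compl.inter isClosed_Icc
  have hw : WeakEq R (Ioo α β \ F) u g := fun φ hφ t ht => hPout t (hJab ht.1) ht.2 φ hφ
  have hPJ : Ioo α β ⊆ {t | P t} := by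
    intro t ht φ hφ
    have hsub : Ioo α β ⊆ Icc a b := hJab.trans Ioo_subset_Icc_self
    refine hasDerivAt_of_hasDerivWithinAt_Ioi (f' := fun t =>
      ∫ x, (u x t * lap φ x + g x t * φ x))
      ((hu.continuousOn_integral_mul hφ.smooth.continuous hφ.hasCompactSupport
        fun x hx => hφ.eq_zero hx.le).mono hsub)
      ((hu.continuousOn_integral_weak hg hφ).mono hsub) (fun s hs => ?_) ht
    by_cases hsF : s ∈ F
    · obtain ⟨ρ, hρR, hρ⟩ := hφ.exists_radius
      refine h.hasDerivWithinAt_integral hφ hρ hs.2 fun x hx τ hτ =>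
        h.abs_sub_le hu hg hJab hFcl hw (m := m) (ρ := (R - ρ) / 2) (fun σ hσ => ?_)
          (by linarith) (by linarith) ⟨hsF, hs⟩ ⟨hs.1.trans hτ.1, hτ.2⟩ hτ.1.le
      exact hUA ⟨hσ.1, (hJ hσ.2).1⟩
    · exact (hw φ hφ s ⟨hs, hsF⟩).hasDerivWithinAt
  exact ht₀F.2 (mem_interior.2 ⟨Ioo α β, hPJ, isOpen_Ioo, ht₀J⟩)

end Weak

section Weak

variable {n : ℕ}

/-- Time-dependent test functions; `ψ'` is the time derivative of `ψ`. -/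
structure TimeTest (R : ℝ) (I : Set ℝ) (ψ ψ' : Eu n → ℝ → ℝ) : Prop where
  smooth : ∀ t ∈ I, ContDiff ℝ 2 fun x => ψ x t
  supp : ∃ ρ < R, ∀ t ∈ I, ∀ x, ρ < ‖x‖ → ψ x t = 0
  deriv : ∀ x, ∀ t ∈ I, HasDerivAt (ψ x) (ψ' x t) t
  cont : ContinuousOn (fun z : Eu n × ℝ => ψ' z.1 z.2) (univ ×ˢ I)

theorem TimeTest.test {R : ℝ} {I : Set ℝ} {ψ ψ' : Eu n → ℝ → ℝ} (h : TimeTest R I ψ ψ')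
    {t : ℝ} (ht : t ∈ I) : Test R fun x => ψ x t := by
  obtain ⟨ρ, hρ, h0⟩ := h.supp
  refine ⟨h.smooth t ht, (closure_minimal (fun x hx => ?_) isClosed_closedBall).trans
    (closedBall_subset_ball hρ)⟩
  rw [mem_closedBall_zero_iff]
  by_contra hn
  exact hx (h0 t ht x (not_le.1 hn))

theorem TimeTest.continuous_deriv {R : ℝ} {I : Set ℝ} {ψ ψ' : Eu n → ℝ → ℝ}
    (h : TimeTest R I ψ ψ') {t : ℝ} (ht : t ∈ I) : Continuous fun x => ψ' x t :=
  h.cont.comp_continuous (f := fun x : Eu n => (x, t)) (by fun_prop) fun x => ⟨mem_univ _, ht⟩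

theorem WeakEq.hasDerivAt_integral {R a b N : ℝ} {u g : Eu n → ℝ → ℝ} {I : Set ℝ}
    (h : WeakEq R (Ioo a b) u g)
    (hu : Reg R a b N u) (hg : ∀ t, Continuous fun x => g x t) {ψ ψ' : Eu n → ℝ → ℝ}
    (hψ : TimeTest R I ψ ψ') (hI : IsOpen I) {t : ℝ} (ht : t ∈ Ioo a b) (htI : t ∈ I) :
    HasDerivAt (fun t => ∫ x, u x t * ψ x t)
      (∫ x, (u x t * (ψ' x t + lap (fun y => ψ y t) x) + g x t * ψ x t)) t := by
  obtain ⟨ρ, hρR, hρ⟩ := hψ.supp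
  obtain ⟨η, hη, hηs⟩ := nhds_basis_closedBall.mem_iff.1
    ((hI.inter isOpen_Ioo).mem_nhds ⟨htI, ht⟩)
  rw [Real.closedBall_eq_Icc] at hηs
  obtain ⟨C, hC⟩ := ((isCompact_closedBall (0 : Eu n) ρ).prod
    (isCompact_Icc (a := t - η) (b := t + η))).exists_bound_of_continuousOn
    (hψ.cont.mono (prod_mono (subset_univ _) (hηs.trans inter_subset_left)))
  have hψ0 : ∀ x, ρ < ‖x‖ → ψ' x t = 0 := fun x hx => by
    have h1 : ψ x =ᶠ[𝓝 t] fun _ => 0 := by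
      filter_upwards [hI.mem_nhds htI] with s hs using hρ s hs x hx
    exact (hψ.deriv x t htI).unique ((hasDerivAt_const t (0 : ℝ)).congr_of_eventuallyEq h1)
  have hT := hψ.test htI
  have hint : ∀ s ∈ I, ∀ τ, Integrable fun x => u x τ * ψ x s := fun s hs τ =>
    ((hu.cx τ).mul (hψ.smooth s hs).continuous).integrable_of_hasCompactSupport
      (hψ.test hs).hasCompactSupport.mul_left
  have hcs' : HasCompactSupport fun x => ψ' x t :=
    HasCompactSupport.of_support_subset_isCompact (isCompact_closedBall (0 : Eu n) ρ) fun x hx => by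
      rw [mem_closedBall_zero_iff]
      by_contra hn
      exact hx (hψ0 x (not_le.1 hn))
  have hint' : Integrable fun x => u x t * ψ' x t :=
    ((hu.cx t).mul (hψ.continuous_deriv htI)).integrable_of_hasCompactSupport hcs'.mul_left
  have hD : HasDerivAt (fun s => ∫ x, u x s * (ψ x s - ψ x t)) (∫ x, u x t * ψ' x t) t := by
    rw [hasDerivAt_iff_tendsto_slope]
    have hslope : ∀ s, slope (fun s => ∫ x, u x s * (ψ x s - ψ x t)) t s
        = ∫ x, u x s * slope (ψ x) t s := by
      intro s
      simp only [slope_def_field, sub_self, mul_zero, integral_zero, sub_zero]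
      rw [← integral_div]
      refine integral_congr_ae (Eventually.of_forall fun x => ?_)
      simp only
      ring
    simp only [funext hslope]
    have hnear : ∀ᶠ s in 𝓝[≠] t, s ∈ Icc (t - η) (t + η) := by
      refine mem_nhdsWithin_of_mem_nhds (Icc_mem_nhds ?_ ?_) <;> linarith
    refine tendsto_integral_filter_of_dominated_convergence
      ((closedBall (0 : Eu n) ρ).indicator fun _ => |N| * |C|) ?_ ?_ ?_ ?_
    · filter_upwards [hnear] with s hs
      refine Continuous.aestronglyMeasurable ?_
      simp only [slope_def_field]
      exact (hu.cx s).mul (((hψ.smooth s (hηs hs).1).continuous.sub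
          hT.smooth.continuous).div_const _)
    · filter_upwards [hnear, self_mem_nhdsWithin] with s hs hst
      refine Eventually.of_forall fun x => ?_
      by_cases hx : ‖x‖ ≤ ρ
      · rw [indicator_of_mem (by simpa using hx), norm_mul]
        refine mul_le_mul ?_ ?_ (norm_nonneg _) (abs_nonneg _)
        · exact (hu.bd x (hx.trans hρR.le) s (Ioo_subset_Icc_self (hηs hs).2)).trans (le_abs_self _)
        · have h1 := (convex_Icc (t - η) (t + η)).norm_image_sub_le_of_norm_hasDerivWithin_le
            (f := ψ x) (f' := ψ' x) (C := |C|) (x := t) (y := s)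
            (fun τ hτ => (hψ.deriv x τ (hηs hτ).1).hasDerivWithinAt)
            (fun τ hτ => (hC (x, τ) ⟨by simpa using hx, hτ⟩).trans (le_abs_self _))
            ⟨by linarith, by linarith⟩ hs
          rw [slope_def_field, norm_div, div_le_iff₀ (norm_pos_iff.2 (sub_ne_zero.2 hst))]
          exact h1
      · rw [indicator_of_notMem (by simpa using hx), slope_def_field,
          hρ s (hηs hs).1 x (not_le.1 hx), hρ t htI x (not_le.1 hx)]
        simp
    · exact (integrable_indicator_iff measurableSet_closedBall).2
        (integrableOn_const (isCompact_closedBall _ _).measure_lt_top.ne)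
    · refine Eventually.of_forall fun x => Tendsto.mul ?_ ?_
      · exact ((hu.ct x).tendsto t).mono_left nhdsWithin_le_nhds
      · exact hasDerivAt_iff_tendsto_slope.1 (hψ.deriv x t htI)
  have h1 := (h _ hT t ht).add hD
  refine (h1.congr_of_eventuallyEq ?_).congr_deriv ?_
  · filter_upwards [hI.mem_nhds htI] with s hs
    rw [Pi.add_apply, ← integral_add (hint t htI s)]
    · refine integral_congr_ae (Eventually.of_forall fun x => ?_)
      simp only
      ring
    · simp only [mul_sub]
      exact (hint s hs s).sub (hint t htI s)
  · rw [← integral_add _ hint']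
    · refine integral_congr_ae (Eventually.of_forall fun x => ?_)
      simp only
      ring
    · refine (((hu.cx t).mul hT.smooth.continuous_lap).integrable_of_hasCompactSupport
        hT.hasCompactSupport.lap.mul_left).add (((hg t).mul
          hT.smooth.continuous).integrable_of_hasCompactSupport hT.hasCompactSupport.mul_left)

end Weak

section Nonlinearity

variable {n : ℕ}

/-- The first component of the nonlinearity; the second one is obtained by exchanging `a`, `b`. -/
noncomputable def nl (r lam a b : ℝ) : ℝ := a ^ (2 * r + 1) - lam * a ^ r * b ^ (r + 1)

theorem rpow_mul_rpow_succ_le {r a b w : ℝ} (hr : 0 < r) (ha : 0 ≤ a) (hb : 0 ≤ b) (haw : a ≤ w)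
    (hbw : b ≤ w) : a ^ r * b ^ (r + 1) ≤ w ^ (2 * r + 1) := by
  have hw : 0 ≤ w := ha.trans haw
  calc a ^ r * b ^ (r + 1) ≤ w ^ r * w ^ (r + 1) := by gcongr
    _ = w ^ (2 * r + 1) := by
      rw [← Real.rpow_add_of_nonneg hw hr.le (by linarith)]; congr 1; ring

theorem abs_nl_le {r lam a b : ℝ} (hr : 0 < r) (h0 : 0 ≤ lam) (h1 : lam < 1) (ha : 0 ≤ a)
    (hb : 0 ≤ b) : |nl r lam a b| ≤ (a + b) ^ (2 * r + 1) := by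
  have e1 : a ^ (2 * r + 1) ≤ (a + b) ^ (2 * r + 1) := by gcongr; linarith
  have e2 := rpow_mul_rpow_succ_le hr ha hb (by linarith : a ≤ a + b) (by linarith)
  have e3 : 0 ≤ a ^ r * b ^ (r + 1) := by positivity
  have e4 : 0 ≤ a ^ (2 * r + 1) := by positivity
  rw [nl, abs_le, mul_assoc]
  constructor <;> nlinarith

theorem le_nl_add_nl {r lam a b : ℝ} (hr : 0 < r) (h0 : 0 ≤ lam) (h1 : lam < 1) (ha : 0 ≤ a)
    (hb : 0 ≤ b) : (1 - lam) / 2 ^ (2 * r + 1) * (a + b) ^ (2 * r + 1)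
      ≤ nl r lam a b + nl r lam b a := by
  have key : a ^ r * b ^ (r + 1) + b ^ r * a ^ (r + 1) ≤ a ^ (2 * r + 1) + b ^ (2 * r + 1) := by
    have e : ∀ x : ℝ, 0 ≤ x → x ^ (2 * r + 1) = x ^ r * x ^ (r + 1) := fun x hx => by
      rw [← Real.rpow_add_of_nonneg hx hr.le (by linarith)]; congr 1; ring
    rw [e a ha, e b hb]
    have h : 0 ≤ (a ^ r - b ^ r) * (a ^ (r + 1) - b ^ (r + 1)) := by
      rcases le_total a b with hab | hab
      · exact mul_nonneg_of_nonpos_of_nonpos (sub_nonpos.2 (by gcongr)) (sub_nonpos.2 (by gcongr))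
      · exact mul_nonneg (sub_nonneg.2 (by gcongr)) (sub_nonneg.2 (by gcongr))
    nlinarith
  have h2 : ((a + b) / 2) ^ (2 * r + 1) ≤ a ^ (2 * r + 1) + b ^ (2 * r + 1) := by
    have ea : 0 ≤ a ^ (2 * r + 1) := by positivity
    have eb : 0 ≤ b ^ (2 * r + 1) := by positivity
    rcases le_total a b with hab | hab
    · have : ((a + b) / 2) ^ (2 * r + 1) ≤ b ^ (2 * r + 1) := by gcongr; linarith
      linarith
    · have : ((a + b) / 2) ^ (2 * r + 1) ≤ a ^ (2 * r + 1) := by gcongr; linarith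
      linarith
  rw [Real.div_rpow (by positivity) (by norm_num)] at h2
  calc _ = (1 - lam) * ((a + b) ^ (2 * r + 1) / 2 ^ (2 * r + 1)) := by ring
    _ ≤ (1 - lam) * (a ^ (2 * r + 1) + b ^ (2 * r + 1)) := by gcongr
    _ ≤ _ := by
      unfold nl
      nlinarith

theorem continuous_nl {X : Type*} [TopologicalSpace X] {r : ℝ} (hr : 0 < r) (lam : ℝ) {f g : X → ℝ}
    (hf : Continuous f) (hg : Continuous g) : Continuous fun x => nl r lam (f x) (g x) := by
  have h : ∀ s : ℝ, 0 ≤ s → ∀ k : X → ℝ, Continuous k → Continuous fun x => k x ^ s :=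
    fun s hs k hk => hk.rpow_const fun _ => Or.inr hs
  exact (h _ (by linarith) f hf).sub
    ((continuous_const.mul (h _ hr.le f hf)).mul (h _ (by linarith) g hg))

theorem nl_mul {r : ℝ} (hr : 0 < r) (lam : ℝ) {c a b : ℝ} (hc : 0 ≤ c) (ha : 0 ≤ a) (hb : 0 ≤ b) :
    nl r lam (c * a) (c * b) = c ^ (2 * r + 1) * nl r lam a b := by
  have e : c ^ (2 * r + 1) = c ^ r * c ^ (r + 1) := by
    rw [← Real.rpow_add_of_nonneg hc hr.le (by linarith)]; congr 1; ring
  unfold nl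
  rw [Real.mul_rpow hc ha, Real.mul_rpow hc ha, Real.mul_rpow hc hb, mul_sub, e]
  ring

theorem ClassicalSol.add {u g v k : Eu n → ℝ → ℝ} (h : ClassicalSol u g) (h' : ClassicalSol v k) :
    ClassicalSol (fun x t => u x t + v x t) (fun x t => g x t + k x t) where
  cx t := (h.cx t).add (h'.cx t)
  ct x := (h.ct x).add (h'.ct x)
  gx t := (h.gx t).add (h'.gx t)
  gt x := (h.gt x).add (h'.gt x)
  eq x t := by
    rw [show deriv (fun t => u x t + v x t) t = _ from
      ((h.hasDerivAt x t).add (h'.hasDerivAt x t)).deriv, lap_add (h.cx t) (h'.cx t)]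
    ring

theorem Reg.mono_bd {R a b N M : ℝ} {u : Eu n → ℝ → ℝ} (h : Reg R a b N u) (hNM : N ≤ M) :
    Reg R a b M u :=
  ⟨h.cx, h.ct, fun x hx t ht => (h.bd x hx t ht).trans hNM⟩

theorem ClassicalSol.weakEq' {R a b N M : ℝ} {u g : Eu n → ℝ → ℝ} (h : ClassicalSol u g)
    (hu : Reg R a b N u) (hg : Reg R a b M g) : WeakEq R (Ioo a b) u g :=
  h.weakEq (hu.mono_bd (le_max_left N M)) (hg.mono_bd (le_max_right N M))

theorem ClassicalSol.scale {u g : Eu n → ℝ → ℝ} (h : ClassicalSol u g) (x₀ : Eu n) (t₀ c μ : ℝ) :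
    ClassicalSol (fun x t => c * u (x₀ + μ • x) (t₀ + μ ^ 2 * t))
      (fun x t => c * μ ^ 2 * g (x₀ + μ • x) (t₀ + μ ^ 2 * t)) where
  cx t := contDiff_const.mul ((h.cx _).comp (by fun_prop))
  ct x := contDiff_const.mul ((h.ct _).comp (by fun_prop))
  gx t := continuous_const.mul ((h.gx _).comp (by fun_prop))
  gt x := continuous_const.mul ((h.gt _).comp (by fun_prop))
  eq x t := by
    have e1 : HasDerivAt (fun t => t₀ + μ ^ 2 * t) (μ ^ 2) t := by
      simpa using ((hasDerivAt_id t).const_mul (μ ^ 2)).const_add t₀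
    have e2 := ((h.hasDerivAt (x₀ + μ • x) (t₀ + μ ^ 2 * t)).comp t e1).const_mul c
    have e3 := lap_const_mul c ((h.cx (t₀ + μ ^ 2 * t)).comp (g := fun x => u x (t₀ + μ ^ 2 * t))
      (f := fun x : Eu n => x₀ + μ • x) (by fun_prop)) x
    have e4 := lap_comp_affine (h.cx (t₀ + μ ^ 2 * t)) x₀ μ x
    rw [show deriv (fun t => c * u (x₀ + μ • x) (t₀ + μ ^ 2 * t)) t = _ from e2.deriv]
    simp only [Function.comp_def] at e3
    rw [e3, e4]
    ring

/-- A nonnegative classical solution of the system. -/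
structure Sol (r lam : ℝ) (u v : Eu n → ℝ → ℝ) : Prop where
  left : ClassicalSol u fun x t => nl r lam (u x t) (v x t)
  right : ClassicalSol v fun x t => nl r lam (v x t) (u x t)
  nonneg_left : ∀ x t, 0 ≤ u x t
  nonneg_right : ∀ x t, 0 ≤ v x t

theorem Sol.scale {r lam : ℝ} {u v : Eu n → ℝ → ℝ} (h : Sol r lam u v) (hr : 0 < r) (x₀ : Eu n)
    (t₀ : ℝ) {c μ : ℝ} (hc : 0 < c) (hμ : c ^ r = μ) :
    Sol r lam (fun x t => c * u (x₀ + μ • x) (t₀ + μ ^ 2 * t))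
      (fun x t => c * v (x₀ + μ • x) (t₀ + μ ^ 2 * t)) := by
  have e : c ^ (2 * r + 1) = c * μ ^ 2 := by
    rw [← hμ, Real.rpow_add hc, Real.rpow_one, mul_comm 2 r, Real.rpow_mul hc.le]
    norm_num [mul_comm]
  refine ⟨?_, ?_, fun x t => mul_nonneg hc.le (h.nonneg_left _ _),
    fun x t => mul_nonneg hc.le (h.nonneg_right _ _)⟩
  · simp only [nl_mul hr lam hc.le (h.nonneg_left _ _) (h.nonneg_right _ _), e]
    exact h.left.scale x₀ t₀ c μ
  · simp only [nl_mul hr lam hc.le (h.nonneg_right _ _) (h.nonneg_left _ _), e]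
    exact h.right.scale x₀ t₀ c μ

/-- Nonnegative solutions of `wₜ = Δw + H` with `c w ^ p ≤ H ≤ 2 w ^ p`. -/
structure PowSol (p c : ℝ) (w H : Eu n → ℝ → ℝ) : Prop where
  sol : ClassicalSol w H
  nonneg : ∀ x t, 0 ≤ w x t
  lower : ∀ x t, c * w x t ^ p ≤ H x t
  upper : ∀ x t, H x t ≤ 2 * w x t ^ p

theorem Sol.powSol {r lam : ℝ} {u v : Eu n → ℝ → ℝ} (h : Sol r lam u v) (hr : 0 < r) (h0 : 0 ≤ lam)
    (h1 : lam < 1) : PowSol (2 * r + 1) ((1 - lam) / 2 ^ (2 * r + 1)) (fun x t => u x t + v x t)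
      (fun x t => nl r lam (u x t) (v x t) + nl r lam (v x t) (u x t)) where
  sol := h.left.add h.right
  nonneg x t := add_nonneg (h.nonneg_left x t) (h.nonneg_right x t)
  lower x t := le_nl_add_nl hr h0 h1 (h.nonneg_left x t) (h.nonneg_right x t)
  upper x t := by
    have e1 := (abs_le.1 (abs_nl_le hr h0 h1 (h.nonneg_left x t) (h.nonneg_right x t))).2
    have e2 := (abs_le.1 (abs_nl_le hr h0 h1 (h.nonneg_right x t) (h.nonneg_left x t))).2
    rw [add_comm (v x t)] at e2
    linarith

theorem PowSol.reg {p c R a b N : ℝ} {w H : Eu n → ℝ → ℝ} (h : PowSol p c w H)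
    (hb : ∀ x, ‖x‖ ≤ R → ∀ t ∈ Icc a b, w x t ≤ N) : Reg R a b N w where
  cx t := (h.sol.cx t).continuous
  ct x := (h.sol.ct x).continuous
  bd x hx t ht := by rw [abs_of_nonneg (h.nonneg x t)]; exact hb x hx t ht

theorem PowSol.reg_rhs {p c R a b N : ℝ} {w H : Eu n → ℝ → ℝ} (h : PowSol p c w H) (hp : 0 ≤ p)
    (hc : 0 ≤ c) (hb : ∀ x, ‖x‖ ≤ R → ∀ t ∈ Icc a b, w x t ≤ N) : Reg R a b (2 * N ^ p) H where
  cx t := h.sol.gx t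
  ct x := h.sol.gt x
  bd x hx t ht := by
    have hw := h.nonneg x t
    rw [abs_of_nonneg (le_trans (by positivity) (h.lower x t))]
    refine (h.upper x t).trans ?_
    gcongr
    exact hb x hx t ht

theorem PowSol.weakEq {p c R a b N : ℝ} {w H : Eu n → ℝ → ℝ} (h : PowSol p c w H) (hp : 0 ≤ p)
    (hc : 0 ≤ c) (hb : ∀ x, ‖x‖ ≤ R → ∀ t ∈ Icc a b, w x t ≤ N) : WeakEq R (Ioo a b) w H :=
  h.sol.weakEq' (h.reg hb) (h.reg_rhs hp hc hb)

theorem mul_le_rpow_add {p c C : ℝ} (hp : 1 < p) (hc : 0 < c) (hC : 0 ≤ C) {X : ℝ} (hX : 0 ≤ X) :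
    C * X ≤ c * X ^ p + C * (C / c) ^ (1 / (p - 1)) := by
  have hp' : 0 < p - 1 := by linarith
  rcases le_total X ((C / c) ^ (1 / (p - 1))) with h | h
  · have : C * X ≤ C * (C / c) ^ (1 / (p - 1)) := by gcongr
    have : 0 ≤ c * X ^ p := by positivity
    linarith
  · have e : C / c ≤ X ^ (p - 1) := by
      calc C / c = ((C / c) ^ (1 / (p - 1))) ^ (p - 1) := by
            rw [← Real.rpow_mul (by positivity), one_div_mul_cancel hp'.ne', Real.rpow_one]
        _ ≤ _ := by gcongr
    have e2 : X ^ p = X ^ (p - 1) * X := by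
      rcases hX.eq_or_lt with h0 | h0
      · rw [← h0, Real.zero_rpow (by linarith)]; simp
      · rw [← Real.rpow_add_one h0.ne']; ring_nf
    have e3 : C ≤ c * X ^ (p - 1) := by rwa [div_le_iff₀' hc] at e
    have : C * X ≤ c * X ^ p := by
      rw [e2, ← mul_assoc]
      gcongr
    have : 0 ≤ C * (C / c) ^ (1 / (p - 1)) := by positivity
    linarith

end Nonlinearity

section PosPow

theorem hasDerivAt_posPow (k : ℕ) (q : ℝ) :
    HasDerivAt (fun q : ℝ => (max q 0) ^ (k + 2)) ((k + 2) * (max q 0) ^ (k + 1)) q := by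
  induction k with
  | zero =>
    rcases lt_trichotomy q 0 with h | h | h
    · have : (fun q : ℝ => (max q 0) ^ (0 + 2)) =ᶠ[𝓝 q] fun _ => 0 := by
        filter_upwards [gt_mem_nhds h] with y hy
        simp [hy.le]
      rw [max_eq_right h.le]
      simpa using (hasDerivAt_const q (0:ℝ)).congr_of_eventuallyEq this
    · subst h
      rw [hasDerivAt_iff_tendsto_slope_zero]
      have : Tendsto (fun t : ℝ => max t 0) (𝓝[≠] 0) (𝓝 0) := by
        have : Continuous fun t : ℝ => max t 0 := by fun_prop
        simpa using (this.tendsto 0).mono_left nhdsWithin_le_nhds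
      simp only [max_self, zero_add]
      norm_num
      refine this.congr' ?_
      filter_upwards [self_mem_nhdsWithin] with t ht
      rcases le_total t 0 with h | h
      · simp [h]
      · rw [max_eq_left h]; field_simp
    · have : (fun q : ℝ => (max q 0) ^ (0 + 2)) =ᶠ[𝓝 q] fun q => q ^ 2 := by
        filter_upwards [lt_mem_nhds h] with y hy
        simp [hy.le]
      rw [max_eq_left h.le]
      simpa using (hasDerivAt_pow 2 q).congr_of_eventuallyEq this
  | succ k ih =>
    have h := (hasDerivAt_id q).mul ih
    have e : (fun q : ℝ => (max q 0) ^ (k + 1 + 2)) = id * fun q : ℝ => (max q 0) ^ (k + 2) := by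
      funext y
      rcases le_total y 0 with hy | hy
      · simp [hy]
      · simp only [Pi.mul_apply, id, max_eq_left hy]; ring
    rw [e]
    refine h.congr_deriv ?_
    rcases le_total q 0 with hy | hy
    · simp [hy]
    · simp only [id, max_eq_left hy]; push_cast; ring

theorem deriv_posPow (k : ℕ) : deriv (fun q : ℝ => (max q 0) ^ (k + 2))
    = fun q : ℝ => (k + 2) * (max q 0) ^ (k + 1) :=
  funext fun q => (hasDerivAt_posPow k q).deriv

theorem contDiff_posPow_one (k : ℕ) : ContDiff ℝ 1 fun q : ℝ => (max q 0) ^ (k + 2) := by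
  rw [contDiff_one_iff_deriv, deriv_posPow]
  exact ⟨fun q => (hasDerivAt_posPow k q).differentiableAt, by fun_prop⟩

theorem contDiff_posPow (k : ℕ) : ContDiff ℝ 2 fun q : ℝ => (max q 0) ^ (k + 3) := by
  rw [show (2 : WithTop ℕ∞) = 1 + 1 by norm_num, contDiff_succ_iff_deriv]
  refine ⟨fun q => (hasDerivAt_posPow (k + 1) q).differentiableAt, by simp, ?_⟩
  rw [deriv_posPow (k + 1)]
  exact contDiff_const.mul (contDiff_posPow_one k)

end PosPow

section Loc

variable {n : ℕ}

/-- Separately continuous functions that are bounded on a cylinder. -/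
structure Bdd (R a b : ℝ) (f : Eu n → ℝ → ℝ) : Prop where
  cx : ∀ t ∈ Icc a b, Continuous fun x => f x t
  ct : ∀ x, ‖x‖ ≤ R → ContinuousOn (f x) (Icc a b)
  bd : ∃ M, ∀ x, ‖x‖ ≤ R → ∀ t ∈ Icc a b, |f x t| ≤ M

/-- Functions as in `Bdd` that vanish outside the cylinder. -/
structure Loc (R a b : ℝ) (f : Eu n → ℝ → ℝ) : Prop extends Bdd R a b f where
  supp : ∀ x, R < ‖x‖ → ∀ t ∈ Icc a b, f x t = 0

theorem Reg.bdd {R a b N : ℝ} {u : Eu n → ℝ → ℝ} (h : Reg R a b N u) : Bdd R a b u :=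
  ⟨fun t _ => h.cx t, fun x _ => (h.ct x).continuousOn, N, h.bd⟩

theorem Bdd.comp₂ {R a b : ℝ} {f g : Eu n → ℝ → ℝ} (hf : Bdd R a b f) (hg : Bdd R a b g)
    {Φ : ℝ → ℝ → ℝ} (hΦ : Continuous fun z : ℝ × ℝ => Φ z.1 z.2) :
    Bdd R a b fun x t => Φ (f x t) (g x t) := by
  obtain ⟨M, hM⟩ := hf.bd
  obtain ⟨N, hN⟩ := hg.bd
  obtain ⟨C, hC⟩ := (isCompact_Icc.prod isCompact_Icc : IsCompact (Icc (-M) M ×ˢ Icc (-N) N))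
    |>.exists_bound_of_continuousOn hΦ.continuousOn
  exact ⟨fun t ht => hΦ.comp ((hf.cx t ht).prodMk (hg.cx t ht)),
    fun x hx => hΦ.comp_continuousOn ((hf.ct x hx).prodMk (hg.ct x hx)),
    C, fun x hx t ht => hC (f x t, g x t) ⟨abs_le.1 (hM x hx t ht), abs_le.1 (hN x hx t ht)⟩⟩

theorem Bdd.comp {R a b : ℝ} {f : Eu n → ℝ → ℝ} (hf : Bdd R a b f) {Φ : ℝ → ℝ}
    (hΦ : Continuous Φ) : Bdd R a b fun x t => Φ (f x t) :=
  hf.comp₂ (Φ := fun y _ => Φ y) hf (by fun_prop)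

theorem Bdd.add {R a b : ℝ} {f g : Eu n → ℝ → ℝ} (hf : Bdd R a b f) (hg : Bdd R a b g) :
    Bdd R a b fun x t => f x t + g x t := hf.comp₂ hg (Φ := fun y z => y + z) (by fun_prop)

theorem Bdd.sub {R a b : ℝ} {f g : Eu n → ℝ → ℝ} (hf : Bdd R a b f) (hg : Bdd R a b g) :
    Bdd R a b fun x t => f x t - g x t := hf.comp₂ hg (Φ := fun y z => y - z) (by fun_prop)

theorem Bdd.mul {R a b : ℝ} {f g : Eu n → ℝ → ℝ} (hf : Bdd R a b f) (hg : Bdd R a b g) :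
    Bdd R a b fun x t => f x t * g x t := hf.comp₂ hg (Φ := fun y z => y * z) (by fun_prop)

theorem Bdd.abs {R a b : ℝ} {f : Eu n → ℝ → ℝ} (hf : Bdd R a b f) :
    Bdd R a b fun x t => |f x t| := hf.comp (Φ := fun y => |y|) (by fun_prop)

theorem Bdd.pow {R a b : ℝ} {f : Eu n → ℝ → ℝ} (hf : Bdd R a b f) (k : ℕ) :
    Bdd R a b fun x t => f x t ^ k := hf.comp (Φ := fun y => y ^ k) (by fun_prop)

theorem Bdd.rpow {R a b : ℝ} {f : Eu n → ℝ → ℝ} (hf : Bdd R a b f) {p : ℝ} (hp : 0 < p) :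
    Bdd R a b fun x t => f x t ^ p :=
  hf.comp (Φ := fun y => y ^ p) (Real.continuous_rpow_const hp.le)

theorem Bdd.sum {ι : Type*} (s : Finset ι) {R a b : ℝ} {f : ι → Eu n → ℝ → ℝ}
    (hf : ∀ i ∈ s, Bdd R a b (f i)) : Bdd R a b fun x t => ∑ i ∈ s, f i x t where
  cx t ht := continuous_finsetSum _ fun i hi => (hf i hi).cx t ht
  ct x hx := continuousOn_finsetSum _ fun i hi => (hf i hi).ct x hx
  bd := by
    choose! M hM using fun i hi => (hf i hi).bd
    exact ⟨∑ i ∈ s, M i, fun x hx t ht => (Finset.abs_sum_le_sum_abs _ _).trans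
      (Finset.sum_le_sum fun i hi => hM i hi x hx t ht)⟩

theorem bdd_space {φ : Eu n → ℝ} (h : Continuous φ) (R a b : ℝ) : Bdd R a b fun x _ => φ x := by
  obtain ⟨M, hM⟩ := (isCompact_closedBall (0 : Eu n) R).exists_bound_of_continuousOn h.continuousOn
  exact ⟨fun _ _ => h, fun x _ => continuousOn_const, M,
    fun x hx t _ => hM x (mem_closedBall_zero_iff.2 hx)⟩

theorem bdd_time {a b : ℝ} {θ : ℝ → ℝ} (h : ContinuousOn θ (Icc a b)) (R : ℝ) :
    Bdd R a b fun (_ : Eu n) t => θ t := by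
  obtain ⟨M, hM⟩ := isCompact_Icc.exists_bound_of_continuousOn h
  exact ⟨fun _ _ => continuous_const, fun x _ => h, M, fun x hx t ht => hM t ht⟩

theorem Bdd.const_mul {R a b : ℝ} {f : Eu n → ℝ → ℝ} (hf : Bdd R a b f) (c : ℝ) :
    Bdd R a b fun x t => c * f x t := hf.comp (Φ := fun y => c * y) (by fun_prop)

theorem Bdd.mono {R a b R' a' b' : ℝ} {f : Eu n → ℝ → ℝ} (hf : Bdd R a b f) (hR : R' ≤ R)
    (ha : a ≤ a') (hb : b' ≤ b) : Bdd R' a' b' f where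
  cx t ht := hf.cx t (Icc_subset_Icc ha hb ht)
  ct x hx := (hf.ct x (hx.trans hR)).mono (Icc_subset_Icc ha hb)
  bd := hf.bd.imp fun _ hM x hx t ht => hM x (hx.trans hR) t (Icc_subset_Icc ha hb ht)

theorem Loc.mul {R a b : ℝ} {f g : Eu n → ℝ → ℝ} (hf : Loc R a b f) (hg : Bdd R a b g) :
    Loc R a b fun x t => f x t * g x t where
  toBdd := hf.toBdd.mul hg
  supp x hx t ht := by rw [hf.supp x hx t ht, zero_mul]

theorem Loc.mul' {R a b : ℝ} {f g : Eu n → ℝ → ℝ} (hf : Loc R a b f) (hg : Bdd R a b g) :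
    Loc R a b fun x t => g x t * f x t where
  toBdd := hg.mul hf.toBdd
  supp x hx t ht := by rw [hf.supp x hx t ht, mul_zero]

theorem Loc.add {R a b : ℝ} {f g : Eu n → ℝ → ℝ} (hf : Loc R a b f) (hg : Loc R a b g) :
    Loc R a b fun x t => f x t + g x t where
  toBdd := hf.toBdd.add hg.toBdd
  supp x hx t ht := by rw [hf.supp x hx t ht, hg.supp x hx t ht, add_zero]

theorem Loc.sub {R a b : ℝ} {f g : Eu n → ℝ → ℝ} (hf : Loc R a b f) (hg : Loc R a b g) :
    Loc R a b fun x t => f x t - g x t where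
  toBdd := hf.toBdd.sub hg.toBdd
  supp x hx t ht := by rw [hf.supp x hx t ht, hg.supp x hx t ht, sub_zero]

theorem Loc.const_mul {R a b : ℝ} {f : Eu n → ℝ → ℝ} (hf : Loc R a b f) (c : ℝ) :
    Loc R a b fun x t => c * f x t where
  toBdd := hf.toBdd.const_mul c
  supp x hx t ht := by rw [hf.supp x hx t ht, mul_zero]

theorem Loc.abs {R a b : ℝ} {f : Eu n → ℝ → ℝ} (hf : Loc R a b f) :
    Loc R a b fun x t => |f x t| where
  toBdd := hf.toBdd.abs
  supp x hx t ht := by rw [hf.supp x hx t ht, abs_zero]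

theorem Loc.integrable {R a b : ℝ} {f : Eu n → ℝ → ℝ} (hf : Loc R a b f) {t : ℝ}
    (ht : t ∈ Icc a b) : Integrable fun x => f x t := by
  refine (hf.cx t ht).integrable_of_hasCompactSupport
    (HasCompactSupport.intro (isCompact_closedBall 0 R) fun x hx => hf.supp x ?_ t ht)
  simpa using hx

theorem Loc.continuousOn {R a b : ℝ} {f : Eu n → ℝ → ℝ} (hf : Loc R a b f) :
    ContinuousOn (fun t => ∫ x, f x t) (Icc a b) := by
  obtain ⟨M, hM⟩ := hf.bd
  refine continuousOn_integral_of_abs_le (M := max M 0) (R := R) (fun t ht => hf.cx t ht)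
    (fun x => ?_) (fun t ht x => ?_) (fun t ht x hx => hf.supp x hx t ht)
  · rcases le_or_gt ‖x‖ R with h | h
    · exact hf.ct x h
    · exact continuousOn_const.congr fun t ht => hf.supp x h t ht
  · rcases le_or_gt ‖x‖ R with h | h
    · exact (hM x h t ht).trans (le_max_left _ _)
    · rw [hf.supp x h t ht, abs_zero]; exact le_max_right _ _

/-- The iterated space-time integral. -/
noncomputable def dint (a b : ℝ) (f : Eu n → ℝ → ℝ) : ℝ := ∫ t in a..b, ∫ x, f x t

theorem Loc.intervalIntegrable {R a b : ℝ} {f : Eu n → ℝ → ℝ} (hf : Loc R a b f) (hab : a ≤ b) :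
    IntervalIntegrable (fun t => ∫ x, f x t) volume a b :=
  ContinuousOn.intervalIntegrable (by rw [uIcc_of_le hab]; exact hf.continuousOn)

theorem dint_congr {a b : ℝ} (hab : a ≤ b) {f g : Eu n → ℝ → ℝ}
    (h : ∀ x, ∀ t ∈ Icc a b, f x t = g x t) : dint a b f = dint a b g :=
  intervalIntegral.integral_congr fun t ht => by
    rw [uIcc_of_le hab] at ht
    exact integral_congr_ae (Eventually.of_forall fun x => h x t ht)

theorem dint_mono {R R' a b : ℝ} (hab : a ≤ b) {f g : Eu n → ℝ → ℝ} (hf : Loc R a b f)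
    (hg : Loc R' a b g) (h : ∀ x, ∀ t ∈ Icc a b, f x t ≤ g x t) : dint a b f ≤ dint a b g :=
  intervalIntegral.integral_mono_on hab (hf.intervalIntegrable hab) (hg.intervalIntegrable hab)
    fun t ht => integral_mono (hf.integrable ht) (hg.integrable ht) fun x => h x t ht

theorem dint_add {R R' a b : ℝ} (hab : a ≤ b) {f g : Eu n → ℝ → ℝ} (hf : Loc R a b f)
    (hg : Loc R' a b g) : dint a b (fun x t => f x t + g x t) = dint a b f + dint a b g := by
  rw [dint, dint, dint, ← intervalIntegral.integral_add (hf.intervalIntegrable hab)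
    (hg.intervalIntegrable hab)]
  refine intervalIntegral.integral_congr fun t ht => ?_
  rw [uIcc_of_le hab] at ht
  exact integral_add (hf.integrable ht) (hg.integrable ht)

theorem dint_sub {R R' a b : ℝ} (hab : a ≤ b) {f g : Eu n → ℝ → ℝ} (hf : Loc R a b f)
    (hg : Loc R' a b g) : dint a b (fun x t => f x t - g x t) = dint a b f - dint a b g := by
  rw [dint, dint, dint, ← intervalIntegral.integral_sub (hf.intervalIntegrable hab)
    (hg.intervalIntegrable hab)]
  refine intervalIntegral.integral_congr fun t ht => ?_
  rw [uIcc_of_le hab] at ht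
  exact integral_sub (hf.integrable ht) (hg.integrable ht)

theorem dint_const_mul (a b c : ℝ) (f : Eu n → ℝ → ℝ) :
    dint a b (fun x t => c * f x t) = c * dint a b f := by
  simp only [dint, integral_const_mul, intervalIntegral.integral_const_mul]

theorem abs_dint_le {R a b : ℝ} (hab : a ≤ b) {f : Eu n → ℝ → ℝ} (hf : Loc R a b f) :
    |dint a b f| ≤ dint a b fun x t => |f x t| := by
  refine (intervalIntegral.abs_integral_le_integral_abs hab).trans ?_
  refine intervalIntegral.integral_mono_on hab (hf.intervalIntegrable hab).abs
    (hf.abs.intervalIntegrable hab) fun t _ => abs_integral_le_integral_abs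

/-- The volume of the unit ball of `ℝⁿ`, up to scaling: the volume of the ball of radius `R`. -/
noncomputable def vb (n : ℕ) (R : ℝ) : ℝ := (volume (closedBall (0 : Eu n) R)).toReal

theorem integral_le_vb {R M : ℝ} {f : Eu n → ℝ} (hf : Integrable f) (hM : ∀ x, ‖x‖ ≤ R → f x ≤ M)
    (h0 : ∀ x, R < ‖x‖ → f x ≤ 0) : ∫ x, f x ≤ M * vb n R := by
  have e : ∫ x, (closedBall (0 : Eu n) R).indicator (fun _ => M) x = M * vb n R := by
    rw [integral_indicator isClosed_closedBall.measurableSet, setIntegral_const, smul_eq_mul,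
      mul_comm, vb, Measure.real]
  rw [← e]
  refine integral_mono hf ?_ fun x => ?_
  · rw [integrable_indicator_iff isClosed_closedBall.measurableSet]
    exact integrableOn_const (isCompact_closedBall _ _).measure_lt_top.ne
  · by_cases hx : ‖x‖ ≤ R
    · rw [indicator_of_mem (mem_closedBall_zero_iff.2 hx)]; exact hM x hx
    · rw [indicator_of_notMem (by simpa using hx)]; exact h0 x (not_le.1 hx)

theorem dint_le_vb {R a b M : ℝ} (hab : a ≤ b) {f : Eu n → ℝ → ℝ} (hf : Loc R a b f)
    (hM : ∀ x, ‖x‖ ≤ R → ∀ t ∈ Icc a b, f x t ≤ M) : dint a b f ≤ (b - a) * (M * vb n R) := by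
  have := intervalIntegral.integral_mono_on hab (hf.intervalIntegrable hab)
    (g := fun _ => M * vb n R) (by simp) fun t ht => integral_le_vb (hf.integrable ht)
      (fun x hx => hM x hx t ht) fun x hx => (hf.supp x hx t ht).le
  rw [intervalIntegral.integral_const, smul_eq_mul] at this
  exact this

theorem vb_nonneg (n : ℕ) (R : ℝ) : 0 ≤ vb n R := ENNReal.toReal_nonneg

theorem vb_mul (n : ℕ) {R : ℝ} (hR : 0 < R) : vb n R = R ^ n * vb n 1 := by
  rw [vb, vb, Measure.addHaar_closedBall _ _ hR.le, Measure.addHaar_closedBall _ _ zero_le_one]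
  simp [ENNReal.toReal_mul, ENNReal.toReal_ofReal (pow_nonneg hR.le n)]

theorem tendsto_dint {R a b M : ℝ} (hab : a ≤ b) {F : ℕ → Eu n → ℝ → ℝ} {f : Eu n → ℝ → ℝ}
    (hF : ∀ k, Loc R a b (F k)) (hM : ∀ k x, ‖x‖ ≤ R → ∀ t ∈ Icc a b, |F k x t| ≤ M)
    (h : ∀ x, ‖x‖ ≤ R → ∀ t ∈ Icc a b, Tendsto (fun k => F k x t) atTop (𝓝 (f x t)))
    (h0 : ∀ x, R < ‖x‖ → ∀ t ∈ Icc a b, f x t = 0) :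
    Tendsto (fun k => dint a b (F k)) atTop (𝓝 (dint a b f)) := by
  have hM' : ∀ k, ∀ t ∈ Icc a b, ∀ x, ‖F k x t‖ ≤ (closedBall (0 : Eu n) R).indicator
      (fun _ => M) x := by
    intro k t ht x
    by_cases hx : ‖x‖ ≤ R
    · rw [indicator_of_mem (mem_closedBall_zero_iff.2 hx)]; exact hM k x hx t ht
    · rw [indicator_of_notMem (by simpa using hx), (hF k).supp x (not_le.1 hx) t ht]; simp
  have hi : Integrable ((closedBall (0 : Eu n) R).indicator fun _ => M) := by
    rw [integrable_indicator_iff isClosed_closedBall.measurableSet]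
    exact integrableOn_const (isCompact_closedBall _ _).measure_lt_top.ne
  refine intervalIntegral.tendsto_integral_filter_of_dominated_convergence
    (fun _ => ∫ x, (closedBall (0 : Eu n) R).indicator (fun _ => M) x) ?_ ?_ (by simp) ?_
  · refine Eventually.of_forall fun k => ?_
    rw [uIoc_of_le hab]
    exact ((hF k).continuousOn.mono Ioc_subset_Icc_self).aestronglyMeasurable measurableSet_Ioc
  · refine Eventually.of_forall fun k => Eventually.of_forall fun t ht => ?_
    rw [uIoc_of_le hab] at ht
    exact norm_integral_le_of_norm_le hi (Eventually.of_forall (hM' k t (Ioc_subset_Icc_self ht)))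
  · refine Eventually.of_forall fun t ht => ?_
    rw [uIoc_of_le hab] at ht
    have ht' := Ioc_subset_Icc_self ht
    refine tendsto_integral_of_dominated_convergence _
      (fun k => ((hF k).cx t ht').aestronglyMeasurable) hi
      (fun k => Eventually.of_forall (hM' k t ht')) (Eventually.of_forall fun x => ?_)
    rcases le_or_gt ‖x‖ R with hx | hx
    · exact h x hx t ht'
    · rw [h0 x hx t ht']
      simp only [fun k => (hF k).supp x hx t ht']
      exact tendsto_const_nhds

end Loc

section Cutoff

variable {n : ℕ}

/-- The positive part of `1 - |x|² / R²`. -/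
noncomputable def cut (R : ℝ) (x : Eu n) : ℝ := max (1 - ‖R⁻¹ • x‖ ^ 2) 0

theorem continuous_cut (R : ℝ) : Continuous (cut R : Eu n → ℝ) := by unfold cut; fun_prop

theorem cut_nonneg (R : ℝ) (x : Eu n) : 0 ≤ cut R x := le_max_right _ _

theorem cut_le_one (R : ℝ) (x : Eu n) : cut R x ≤ 1 := max_le (by nlinarith [sq_nonneg ‖R⁻¹ • x‖])
    zero_le_one

theorem cut_eq_zero {R : ℝ} (hR : 0 < R) {x : Eu n} (hx : R ≤ ‖x‖) : cut R x = 0 := by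
  refine max_eq_right ?_
  have : 1 ≤ ‖R⁻¹ • x‖ := by
    rw [norm_smul, norm_inv, Real.norm_of_nonneg hR.le, inv_mul_eq_div, le_div_iff₀ hR]
    linarith
  nlinarith

theorem le_cut {R : ℝ} (hR : 0 < R) {x : Eu n} {q : ℝ} (hx : ‖x‖ ≤ q * R) :
    1 - q ^ 2 ≤ cut R x := by
  refine le_trans ?_ (le_max_left _ _)
  have : ‖R⁻¹ • x‖ ≤ q := by
    rw [norm_smul, norm_inv, Real.norm_of_nonneg hR.le, inv_mul_eq_div, div_le_iff₀ hR]
    exact hx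
  have := norm_nonneg (R⁻¹ • x)
  gcongr

theorem contDiff_posPow_one_sub (j : ℕ) : ContDiff ℝ 2 fun q : ℝ => (max (1 - q) 0) ^ (j + 3) :=
  (contDiff_posPow j).comp (contDiff_const.sub contDiff_id)

theorem hasDerivAt_posPow_one_sub (j : ℕ) (q : ℝ) :
    HasDerivAt (fun q : ℝ => (max (1 - q) 0) ^ (j + 2))
        (-((j + 2) * (max (1 - q) 0) ^ (j + 1))) q := by
  have := (hasDerivAt_posPow j (1 - q)).comp q ((hasDerivAt_id q).const_sub 1)
  simpa [Function.comp_def] using this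

theorem contDiff_cut_pow (R : ℝ) (j : ℕ) : ContDiff ℝ 2 fun x : Eu n => cut R x ^ (j + 3) :=
  (contDiff_posPow_one_sub j).comp (f := fun x : Eu n => ‖R⁻¹ • x‖ ^ 2)
    ((contDiff_norm_sq ℝ).comp (contDiff_const_smul _))

theorem test_cut_pow {R R' : ℝ} (hR : 0 < R) (hR' : R < R') (j : ℕ) :
    Test R' fun x : Eu n => cut R x ^ (j + 3) := by
  refine ⟨contDiff_cut_pow R j, (closure_minimal (fun x hx => ?_) isClosed_closedBall).trans
    (closedBall_subset_ball hR')⟩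
  rw [mem_closedBall_zero_iff]
  by_contra hn
  exact hx (by simp [cut_eq_zero hR (not_le.1 hn).le])

/-- The constant in the bound for the Laplacian of a power of the cut-off. -/
noncomputable def lapC (n j : ℕ) : ℝ := (j + 3) * (2 * n + 4 * (j + 2))

theorem lapC_nonneg (n j : ℕ) : 0 ≤ lapC n j := by unfold lapC; positivity

theorem abs_lap_cut_pow {R : ℝ} (hR : 0 < R) (j : ℕ) (x : Eu n) :
    |lap (fun x => cut R x ^ (j + 3)) x| ≤ lapC n j * R⁻¹ ^ 2 * cut R x ^ (j + 1) := by
  set h : ℝ → ℝ := fun q => (max (1 - q) 0) ^ (j + 3) with hh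
  have hC : ContDiff ℝ 2 h := contDiff_posPow_one_sub j
  have h1 : deriv h = fun q : ℝ => -((j + 3 : ℝ) * (max (1 - q) 0) ^ (j + 2)) := by
    funext q
    rw [(hasDerivAt_posPow_one_sub (j + 1) q).deriv]
    push_cast; ring
  have h2 : deriv (deriv h) = fun q : ℝ => (j + 3 : ℝ) * (j + 2) * (max (1 - q) 0) ^ (j + 1) := by
    rw [h1]
    funext q
    refine HasDerivAt.deriv (((hasDerivAt_posPow_one_sub j q).const_mul
      (j + 3 : ℝ)).neg.congr_deriv ?_)
    ring
  have h3 := lap_comp_affine (hC.comp (contDiff_norm_sq ℝ (E := Eu n))) 0 R⁻¹ x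
  simp only [zero_add] at h3
  have h4 := lap_radial hC (R⁻¹ • x)
  simp only [Function.comp_def] at h3
  rw [h4, h2, h1] at h3
  rw [show (fun x : Eu n => cut R x ^ (j + 3)) = fun x => h (‖R⁻¹ • x‖ ^ 2) from rfl, h3]
  have hm : max (1 - ‖R⁻¹ • x‖ ^ 2) 0 = cut R x := rfl
  simp only [hm]
  have c0 := cut_nonneg R x
  have c1 := cut_le_one R x
  rw [abs_mul, abs_of_nonneg (by positivity)]
  have e1 : cut R x ^ (j + 2) ≤ cut R x ^ (j + 1) := pow_le_pow_of_le_one c0 c1 (by lia)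
  have e2 : ‖R⁻¹ • x‖ ^ 2 * cut R x ^ (j + 1) ≤ cut R x ^ (j + 1) := by
    rcases le_total (‖R⁻¹ • x‖ ^ 2) 1 with h | h
    · exact mul_le_of_le_one_left (by positivity) h
    · rw [show cut R x = 0 from max_eq_right (by linarith)]; simp
  have e3 : 0 ≤ cut R x ^ (j + 2) := by positivity
  have e4 : 0 ≤ ‖R⁻¹ • x‖ ^ 2 * cut R x ^ (j + 1) := by positivity
  calc _ ≤ R⁻¹ ^ 2 * (lapC n j * cut R x ^ (j + 1)) := by
        gcongr
        refine (abs_add_le _ _).trans ?_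
        rw [mul_neg, abs_neg, abs_of_nonneg (by positivity), abs_of_nonneg (by positivity), lapC]
        have : (2 : ℝ) * n * ((j + 3) * cut R x ^ (j + 2)) ≤
            2 * n * ((j + 3) * cut R x ^ (j + 1)) := by gcongr
        have : 4 * (((j : ℝ) + 3) * (j + 2)) * (‖R⁻¹ • x‖ ^ 2 * cut R x ^ (j + 1)) ≤
            4 * (((j : ℝ) + 3) * (j + 2)) * cut R x ^ (j + 1) := by gcongr
        linarith
    _ = _ := by ring

theorem mul_pow_le_add {p δ C : ℝ} {j : ℕ} (hp : 1 < p) (hj : (j : ℝ) + 3 ≤ p * (j + 1))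
    (hδ : 0 < δ) (hC : 0 ≤ C) {m X : ℝ} (hm : 0 ≤ m) (hm1 : m ≤ 1) (hX : 0 ≤ X) :
    C * (X * m ^ (j + 1)) ≤ δ * (X ^ p * m ^ (j + 3)) + C * (C / δ) ^ (1 / (p - 1)) := by
  have hp0 : 0 < p := by linarith
  set Y := X * m ^ (((j : ℝ) + 3) / p) with hY
  have h1 : m ^ (j + 1) ≤ m ^ (((j : ℝ) + 3) / p) := by
    rcases hm.eq_or_lt with h0 | h0
    · rw [← h0, zero_pow (by lia)]; positivity
    · rw [← Real.rpow_natCast]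
      refine Real.rpow_le_rpow_of_exponent_ge h0 hm1 ?_
      rw [div_le_iff₀ hp0]; push_cast; linarith
  have h2 : Y ^ p = X ^ p * m ^ (j + 3) := by
    rw [hY, Real.mul_rpow hX (by positivity), ← Real.rpow_mul hm, div_mul_cancel₀ _ hp0.ne',
      ← Real.rpow_natCast]
    push_cast; rfl
  rw [← h2]
  refine le_trans ?_ (mul_le_rpow_add hp hδ hC (by positivity : 0 ≤ Y))
  rw [hY]
  gcongr

end Cutoff

section Apriori

variable {n : ℕ}

theorem Bdd.mul_test {R a b : ℝ} {u : Eu n → ℝ → ℝ} (hu : Bdd R a b u) {φ : Eu n → ℝ}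
    (hφ : Continuous φ) (h0 : ∀ x, R < ‖x‖ → φ x = 0) : Loc R a b fun x t => u x t * φ x :=
  ⟨hu.mul (bdd_space hφ R a b), fun x hx t _ => by simp [h0 x hx]⟩

theorem WeakEq.dint_eq {R a b s e N M : ℝ} {u g : Eu n → ℝ → ℝ} (h : WeakEq R (Ioo a b) u g)
    (hu : Reg R a b N u) (hg : Reg R a b M g) {φ : Eu n → ℝ} (hφ : Test R φ) {θ θ' : ℝ → ℝ}
    (hθ : ∀ t, HasDerivAt θ (θ' t) t) (hθ' : Continuous θ') (hse : s ≤ e) (has : a < s)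
    (heb : e < b) (hs : θ s = 0) (he : θ e = 0) :
    dint s e (fun x t => θ t * (g x t * φ x)) = -dint s e (fun x t => θ' t * (u x t * φ x))
      - dint s e (fun x t => θ t * (u x t * lap φ x)) := by
  have hθc : Continuous θ := continuous_iff_continuousAt.2 fun t => (hθ t).continuousAt
  have hsub : Icc s e ⊆ Ioo a b := fun t ht => ⟨has.trans_le ht.1, ht.2.trans_lt heb⟩
  have hu' := hu.bdd.mono le_rfl has.le heb.le
  have hg' := hg.bdd.mono le_rfl has.le heb.le
  have l1 : Loc R s e fun x t => u x t * φ x :=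
    hu'.mul_test hφ.smooth.continuous fun x hx => hφ.eq_zero hx.le
  have l2 : Loc R s e fun x t => u x t * lap φ x :=
    hu'.mul_test hφ.smooth.continuous_lap fun x hx => hφ.lap_eq_zero hx.le
  have l3 : Loc R s e fun x t => g x t * φ x :=
    hg'.mul_test hφ.smooth.continuous fun x hx => hφ.eq_zero hx.le
  have b1 := bdd_time (n := n) (a := s) (b := e) hθc.continuousOn R
  have b2 := bdd_time (n := n) (a := s) (b := e) hθ'.continuousOn R
  have m1 := l1.mul' b2
  have m2 := l2.mul' b1
  have m3 := l3.mul' b1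
  have key := intervalIntegral.integral_eq_sub_of_hasDerivAt (a := s) (b := e)
    (f := fun t => θ t * ∫ x, u x t * φ x)
    (f' := fun t => ∫ x, (θ' t * (u x t * φ x) + (θ t * (u x t * lap φ x) + θ t * (g x t * φ x))))
    (fun t ht => by
      rw [uIcc_of_le hse] at ht
      refine ((hθ t).mul (h φ hφ t (hsub ht))).congr_deriv ?_
      rw [integral_add (m1.integrable ht) ((m2.add m3).integrable ht),
        integral_add (m2.integrable ht) (m3.integrable ht), integral_const_mul, integral_const_mul,
        integral_const_mul, integral_add (l2.integrable ht) (l3.integrable ht)]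
      ring) ((m1.add (m2.add m3)).intervalIntegrable hse)
  have e1 := dint_add hse m1 (m2.add m3)
  rw [dint_add hse m2 m3] at e1
  rw [hs, he] at key
  unfold dint at *
  linarith

/-- The constant produced by Young's inequality. -/
noncomputable def young (p δ C : ℝ) : ℝ := C * (C / δ) ^ (1 / (p - 1))

theorem young_nonneg {p δ C : ℝ} (hδ : 0 < δ) (hC : 0 ≤ C) : 0 ≤ young p δ C := by
  unfold young; positivity

theorem PowSol.dint_le {p c R R' a b s e N : ℝ} {j : ℕ} {w H : Eu n → ℝ → ℝ} (h : PowSol p c w H)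
    (hp : 1 < p) (hc : 0 < c) (hj : (j : ℝ) + 3 ≤ p * (j + 1)) (hR : 0 < R) (hR' : R < R')
    (hb : ∀ x, ‖x‖ ≤ R' → ∀ t ∈ Icc a b, w x t ≤ N) {θ θ' : ℝ → ℝ}
    (hθ : ∀ t, HasDerivAt θ (θ' t) t) (hθ' : Continuous θ') (hθ0 : ∀ t, 0 ≤ θ t)
    (hθ1 : ∀ t, θ t ≤ 1) (hse : s ≤ e) (has : a < s)
    (heb : e < b) (hs : θ s = 0) (he : θ e = 0) :
    c / 2 * dint s e (fun x t => θ t * (w x t ^ p * cut R x ^ (j + 3)))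
      ≤ -dint s e (fun x t => θ' t * (w x t * cut R x ^ (j + 3)))
        + (e - s) * (young p (c / 2) (lapC n j * R⁻¹ ^ 2) * vb n R) := by
  have hφ := test_cut_pow (n := n) hR hR' j
  have h1 := (h.weakEq (by linarith) hc.le hb).dint_eq (h.reg hb) (h.reg_rhs (by linarith) hc.le hb)
    hφ hθ hθ' hse has heb hs he
  have hθc : Continuous θ := continuous_iff_continuousAt.2 fun t => (hθ t).continuousAt
  have hz : ∀ x : Eu n, R < ‖x‖ → cut R x ^ (j + 3) = 0 := fun x hx => by
    simp [cut_eq_zero hR hx.le]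
  have hzl : ∀ x : Eu n, R < ‖x‖ → lap (fun x : Eu n => cut R x ^ (j + 3)) x = 0 := fun x hx => by
    have := abs_lap_cut_pow hR j x
    rw [cut_eq_zero hR hx.le] at this
    simpa using this
  have bw : Bdd R s e w := (h.reg hb).bdd.mono hR'.le has.le heb.le
  have bH : Bdd R s e H := (h.reg_rhs (by linarith) hc.le hb).bdd.mono hR'.le has.le heb.le
  have bθ := bdd_time (n := n) (a := s) (b := e) hθc.continuousOn R
  have lH := (bH.mul_test hφ.smooth.continuous hz).mul' bθ
  have lp := ((bw.rpow (p := p) (by linarith)).mul_test hφ.smooth.continuous hz).mul' bθ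
  have ll := (bw.mul_test hφ.smooth.continuous_lap hzl).mul' bθ
  have h2 : c * dint s e (fun x t => θ t * (w x t ^ p * cut R x ^ (j + 3)))
      ≤ dint s e (fun x t => θ t * (H x t * cut R x ^ (j + 3))) := by
    rw [← dint_const_mul]
    refine dint_mono hse (lp.const_mul c) lH fun x t _ => ?_
    have := h.lower x t
    have := cut_nonneg R x
    calc _ = θ t * ((c * w x t ^ p) * cut R x ^ (j + 3)) := by ring
      _ ≤ _ := by
        have := hθ0 t
        gcongr
  set Y := young p (c / 2) (lapC n j * R⁻¹ ^ 2) with hY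
  have hY0 : 0 ≤ Y := young_nonneg (by positivity) (mul_nonneg (lapC_nonneg n j) (by positivity))
  have h3 : -dint s e (fun x t => θ t * (w x t * lap (fun x => cut R x ^ (j + 3)) x))
      - c / 2 * dint s e (fun x t => θ t * (w x t ^ p * cut R x ^ (j + 3)))
      ≤ (e - s) * (Y * vb n R) := by
    rw [← neg_one_mul, ← dint_const_mul, ← dint_const_mul,
      ← dint_sub hse (ll.const_mul _) (lp.const_mul _)]
    refine dint_le_vb hse ((ll.const_mul _).sub (lp.const_mul _)) fun x _ t _ => ?_
    have a1 := (neg_le_abs _).trans (abs_lap_cut_pow hR j x)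
    have hw := h.nonneg x t
    have a2 := mul_pow_le_add hp hj (by positivity : 0 < c / 2)
      (mul_nonneg (lapC_nonneg n j) (sq_nonneg R⁻¹)) (cut_nonneg R x) (cut_le_one R x) hw
    change _ ≤ _ + Y at a2
    have a3 : -(w x t * lap (fun x => cut R x ^ (j + 3)) x)
        ≤ c / 2 * (w x t ^ p * cut R x ^ (j + 3)) + Y := by
      refine le_trans ?_ a2
      nlinarith
    have a4 := mul_le_mul_of_nonneg_left a3 (hθ0 t)
    have a5 := mul_le_mul_of_nonneg_right (hθ1 t) hY0
    linarith
  linarith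

/-- The temporal cut-off. -/
noncomputable def tcut (j : ℕ) (t : ℝ) : ℝ := (max (1 - t ^ 2) 0) ^ (j + 3)

theorem hasDerivAt_tcut (j : ℕ) (t : ℝ) :
    HasDerivAt (tcut j) (-((j + 3) * (max (1 - t ^ 2) 0) ^ (j + 2)) * (2 * t)) t := by
  have := (hasDerivAt_posPow_one_sub (j + 1) (t ^ 2)).comp t (hasDerivAt_pow 2 t)
  refine this.congr_deriv ?_
  push_cast; ring

/-- The a priori bound for space-time integrals of `w ^ p`. -/
theorem PowSol.exists_dint_le (n : ℕ) {p c : ℝ} {j : ℕ} (hp : 1 < p) (hc : 0 < c)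
    (hj : (j : ℝ) + 3 ≤ p * (j + 1)) : ∃ C, ∀ (w H : Eu n → ℝ → ℝ) (N : ℝ), PowSol p c w H →
      (∀ x, ‖x‖ ≤ 2 → ∀ t ∈ Icc (-2 : ℝ) 2, w x t ≤ N) →
      dint (-1) 1 (fun x t => tcut j t * (w x t ^ p * cut 1 x ^ (j + 3))) ≤ C := by
  refine ⟨(c / 4)⁻¹ * (2 * (young p (c / 4) (2 * (j + 3)) * vb n 1) +
    2 * (young p (c / 2) (lapC n j * (1 : ℝ)⁻¹ ^ 2) * vb n 1)), fun w H N h hb => ?_⟩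
  have t0 : ∀ t, 0 ≤ max (1 - t ^ 2 : ℝ) 0 := fun t => le_max_right _ _
  have t1 : ∀ t, max (1 - t ^ 2 : ℝ) 0 ≤ 1 := fun t => max_le (by nlinarith) zero_le_one
  have h1 := h.dint_le hp hc hj one_pos one_lt_two hb (s := -1) (e := 1) (hasDerivAt_tcut j)
    (by fun_prop) (fun t => pow_nonneg (t0 t) _) (fun t => pow_le_one₀ (t0 t) (t1 t)) (by norm_num)
    (by norm_num) (by norm_num) (by simp [tcut]) (by simp [tcut])
  have bw : Bdd 1 (-1) 1 w := (h.reg hb).bdd.mono (by norm_num) (by norm_num) (by norm_num)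
  have hz : ∀ x : Eu n, 1 < ‖x‖ → cut 1 x ^ (j + 3) = 0 := fun x hx => by
    simp [cut_eq_zero one_pos hx.le]
  have hφ : Continuous fun x : Eu n => cut 1 x ^ (j + 3) := (continuous_cut 1).pow _
  have lp := ((bw.rpow (p := p) (by linarith)).mul_test hφ hz).mul' (bdd_time (θ := tcut j)
    (continuous_iff_continuousAt.2 fun t => (hasDerivAt_tcut j t).continuousAt).continuousOn 1)
  have lw := (bw.mul_test hφ hz).mul' (bdd_time
    (θ := fun t => -((j + 3 : ℝ) * (max (1 - t ^ 2) 0) ^ (j + 2)) * (2 * t))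
    (by fun_prop : Continuous _).continuousOn 1)
  have h2 : -dint (-1) 1 (fun x t => -((j + 3 : ℝ) * (max (1 - t ^ 2) 0) ^ (j + 2)) * (2 * t)
      * (w x t * cut 1 x ^ (j + 3)))
      - c / 4 * dint (-1) 1 (fun x t => tcut j t * (w x t ^ p * cut 1 x ^ (j + 3)))
      ≤ (1 - -1) * (young p (c / 4) (2 * (j + 3)) * vb n 1) := by
    rw [← neg_one_mul, ← dint_const_mul, ← dint_const_mul,
      ← dint_sub (by norm_num) (lw.const_mul _) (lp.const_mul _)]
    refine dint_le_vb (by norm_num) ((lw.const_mul _).sub (lp.const_mul _)) fun x _ t ht => ?_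
    have hw := h.nonneg x t
    have c0 := cut_nonneg 1 x
    have c1 := cut_le_one 1 x
    have m0 : 0 ≤ cut 1 x * max (1 - t ^ 2) 0 := mul_nonneg c0 (t0 t)
    have m1 : cut 1 x * max (1 - t ^ 2) 0 ≤ 1 := mul_le_one₀ c1 (t0 t) (t1 t)
    have a2 := mul_pow_le_add hp hj (by positivity : 0 < c / 4)
      (by positivity : (0:ℝ) ≤ 2 * (j + 3)) m0 m1 hw
    change _ ≤ _ + young p (c / 4) (2 * (j + 3)) at a2
    rw [mul_pow, mul_pow] at a2
    have e1 : (max (1 - t ^ 2) 0) ^ (j + 2) ≤ (max (1 - t ^ 2) 0) ^ (j + 1) :=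
      pow_le_pow_of_le_one (t0 t) (t1 t) (by lia)
    have e2 : cut 1 x ^ (j + 3) ≤ cut 1 x ^ (j + 1) := pow_le_pow_of_le_one c0 c1 (by lia)
    have e3 : t * ((max (1 - t ^ 2) 0) ^ (j + 2) * cut 1 x ^ (j + 3))
        ≤ cut 1 x ^ (j + 1) * (max (1 - t ^ 2) 0) ^ (j + 1) := by
      have e4 := pow_nonneg (t0 t) (j + 2)
      calc _ ≤ 1 * ((max (1 - t ^ 2) 0) ^ (j + 2) * cut 1 x ^ (j + 3)) := by gcongr; exact ht.2
        _ ≤ 1 * ((max (1 - t ^ 2) 0) ^ (j + 1) * cut 1 x ^ (j + 1)) := by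
          have := t0 t
          gcongr
        _ = _ := by ring
    have e5 := mul_le_mul_of_nonneg_left e3 (by positivity : 0 ≤ 2 * ((j : ℝ) + 3) * w x t)
    unfold tcut
    linarith
  rw [le_inv_mul_iff₀ (by positivity)]
  linarith

end Apriori

section Smooth

variable {n : ℕ}

theorem Loc.hasDerivAt {R a b : ℝ} {f f' : Eu n → ℝ → ℝ} (hf : Loc R a b f) (hf' : Loc R a b f')
    (h : ∀ x, ∀ t ∈ Ioo a b, HasDerivAt (f x) (f' x t) t) {t : ℝ} (ht : t ∈ Ioo a b) :
    HasDerivAt (fun t => ∫ x, f x t) (∫ x, f' x t) t := by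
  obtain ⟨M, hM⟩ := hf'.bd
  refine (hasDerivAt_integral_of_dominated_loc_of_deriv_le
    (bound := (closedBall (0 : Eu n) R).indicator fun _ => M) (F := fun t x => f x t)
    (F' := fun t x => f' x t) (Ioo_mem_nhds ht.1 ht.2) ?_ (hf.integrable (Ioo_subset_Icc_self ht))
    (hf'.cx t (Ioo_subset_Icc_self ht)).aestronglyMeasurable ?_ ?_ ?_).2
  · filter_upwards [Ioo_mem_nhds ht.1 ht.2] with τ hτ
    exact (hf.cx τ (Ioo_subset_Icc_self hτ)).aestronglyMeasurable
  · refine Eventually.of_forall fun x τ hτ => ?_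
    by_cases hx : ‖x‖ ≤ R
    · rw [indicator_of_mem (mem_closedBall_zero_iff.2 hx)]; exact hM x hx τ (Ioo_subset_Icc_self hτ)
    · rw [indicator_of_notMem (by simpa using hx), hf'.supp x (not_le.1 hx) τ
        (Ioo_subset_Icc_self hτ), norm_zero]
  · rw [integrable_indicator_iff isClosed_closedBall.measurableSet]
    exact integrableOn_const (isCompact_closedBall _ _).measure_lt_top.ne
  · exact Eventually.of_forall fun x τ hτ => h x τ hτ

/-- Integration by parts in time against a product weight. -/
theorem Bdd.dint_deriv {R a b : ℝ} (hab : a ≤ b) {f f' : Eu n → ℝ → ℝ} (hf : Bdd R a b f)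
    (hf' : Bdd R a b f') (h : ∀ x, ‖x‖ ≤ R → ∀ t ∈ Ioo a b, HasDerivAt (f x) (f' x t) t)
    {φ : Eu n → ℝ} (hφ : Continuous φ) (h0 : ∀ x, R < ‖x‖ → φ x = 0) {θ θ' : ℝ → ℝ}
    (hθ : ∀ t, HasDerivAt θ (θ' t) t) (hθ' : Continuous θ') (ha : θ a = 0) (hb : θ b = 0) :
    dint a b (fun x t => θ' t * (f x t * φ x)) = -dint a b (fun x t => θ t * (f' x t * φ x)) := by
  have hθc : Continuous θ := continuous_iff_continuousAt.2 fun t => (hθ t).continuousAt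
  have b1 := bdd_time (n := n) (a := a) (b := b) hθc.continuousOn R
  have b2 := bdd_time (n := n) (a := a) (b := b) hθ'.continuousOn R
  have l0 := (hf.mul_test hφ h0).mul' b1
  have l1 := (hf.mul_test hφ h0).mul' b2
  have l2 := (hf'.mul_test hφ h0).mul' b1
  have key := intervalIntegral.integral_eq_sub_of_hasDerivAt_of_le hab l0.continuousOn
    (fun t ht => l0.hasDerivAt (l1.add l2) (fun x t ht => by
      rcases le_or_gt ‖x‖ R with hx | hx
      · exact ((hθ t).mul ((h x hx t ht).mul_const (φ x)))
      · simpa [h0 x hx] using hasDerivAt_const t (0:ℝ)) ht) ((l1.add l2).intervalIntegrable hab)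
  have e := dint_add hab l1 l2
  simp only [ha, hb, zero_mul, integral_zero, sub_zero] at key
  unfold dint at *
  linarith

theorem pd_comm {f : Eu n → ℝ} (hf : ContDiff ℝ 2 f) (i j : Fin n) :
    pd i (pd j f) = pd j (pd i f) := by
  funext x
  have h1 : Differentiable ℝ (fderiv ℝ f) :=
    (hf.fderiv_right (m := 1) (by norm_num)).differentiable (by norm_num)
  have h2 : ∀ i j : Fin n, pd i (pd j f) x = fderiv ℝ (fderiv ℝ f) x (EuclideanSpace.single i 1)
      (EuclideanSpace.single j 1) := fun i j => by
    rw [pd, show pd j f = fun y => fderiv ℝ f y (EuclideanSpace.single j 1) from rfl,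
      fderiv_clm_apply (h1 x) (differentiableAt_const _)]
    simp
  rw [h2, h2]
  exact (hf.contDiffAt.isSymmSndFDerivAt (by simp)).eq _ _

theorem ContDiff.pd_infty {f : Eu n → ℝ} (hf : ContDiff ℝ ∞ f) (i : Fin n) :
    ContDiff ℝ ∞ (pd i f) :=
  (hf.fderiv_right (m := ∞) (by simp)).clm_apply contDiff_const

theorem ContDiff.lap_infty {f : Eu n → ℝ} (hf : ContDiff ℝ ∞ f) : ContDiff ℝ ∞ (lap f) := by
  rw [show lap f = fun x => ∑ i, pd i (pd i f) x from funext (lap_eq_sum_pd f)]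
  exact ContDiff.sum fun i _ => (hf.pd_infty i).pd_infty i

theorem pd_sum {ι : Type*} (s : Finset ι) {f : ι → Eu n → ℝ} (hf : ∀ j ∈ s, Differentiable ℝ (f j))
    (i : Fin n) : pd i (fun x => ∑ j ∈ s, f j x) = fun x => ∑ j ∈ s, pd i (f j) x := by
  funext x
  rw [pd, fderiv_fun_sum fun j hj => hf j hj x]
  simp [pd]

theorem lap_pd {f : Eu n → ℝ} (hf : ContDiff ℝ ∞ f) (i : Fin n) :
    lap (pd i f) = pd i (lap f) := by
  have h2 : ∀ {f : Eu n → ℝ}, ContDiff ℝ ∞ f → ContDiff ℝ 2 f := fun h => contDiff_infty.1 h 2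
  rw [show lap f = fun x => ∑ j, pd j (pd j f) x from funext (lap_eq_sum_pd f),
    pd_sum _ fun j _ => (((hf.pd_infty j).pd_infty j).differentiable (by simp))]
  funext x
  rw [lap_eq_sum_pd]
  refine Finset.sum_congr rfl fun j _ => ?_
  rw [pd_comm (h2 hf) j i, pd_comm (h2 (hf.pd_infty j)) j i]

/-- Spatially smooth solutions of `aₜ = Δa + g` on a cylinder. -/
structure SmoothSol (R s e : ℝ) (a g : Eu n → ℝ → ℝ) : Prop where
  smooth : ∀ t, ContDiff ℝ ∞ fun x => a x t
  gsmooth : ∀ t, ContDiff ℝ ∞ fun x => g x t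
  bdd : Bdd R s e a
  gbdd : Bdd R s e g
  bdd_pd : ∀ i, Bdd R s e fun x t => pd i (fun y => a y t) x
  bdd_lap : Bdd R s e fun x t => lap (fun y => a y t) x
  bdd_pd_rhs : ∀ i, Bdd R s e fun x t => pd i (fun y => lap (fun z => a z t) y + g y t) x
  deriv : ∀ x, ‖x‖ ≤ R → ∀ t ∈ Icc s e, HasDerivAt (a x) (lap (fun y => a y t) x + g x t) t
  deriv_pd : ∀ i x, ‖x‖ ≤ R → ∀ t ∈ Icc s e, HasDerivAt (fun t => pd i (fun y => a y t) x)
    (pd i (fun y => lap (fun z => a z t) y + g y t) x) t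

theorem Reg.bdd_mol {R R' a b s e N ε : ℝ} {u : Eu n → ℝ → ℝ} (h : Reg R a b N u) {κ : Eu n → ℝ}
    (hκ : Continuous κ) (hs : tsupport κ ⊆ closedBall 0 ε) (hR : R' + ε ≤ R) (has : a ≤ s)
    (heb : e ≤ b) : Bdd R' s e fun x t => mol κ (fun y => u y t) x := by
  have hc : HasCompactSupport κ :=
    (isCompact_closedBall _ _).of_isClosed_subset (isClosed_tsupport _) hs
  have h1 := (h.continuousOn_mol hκ hs).mono (prod_mono (closedBall_subset_closedBall
    (by linarith : R' ≤ R - ε)) (Icc_subset_Icc has heb))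
  obtain ⟨C, hC⟩ := ((isCompact_closedBall (0 : Eu n) R').prod
    (isCompact_Icc (a := s) (b := e))).exists_bound_of_continuousOn h1
  refine ⟨fun t _ => ?_, fun x hx => ?_, C, fun x hx t ht => hC (x, t)
    ⟨mem_closedBall_zero_iff.2 hx, ht⟩⟩
  · exact (contDiff_mol (m := 0) (contDiff_zero.2 hκ) hc (h.cx t)).continuous
  · exact h1.comp (f := fun t => (x, t)) (by fun_prop) fun t ht =>
      ⟨mem_closedBall_zero_iff.2 hx, ht⟩

theorem WeakEq.smoothSol_mol {R R' a b s e N M ε : ℝ} {u g : Eu n → ℝ → ℝ}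
    (h : WeakEq R (Ioo a b) u g) (hu : Reg R a b N u) (hg : Reg R a b M g) {κ : Eu n → ℝ}
    (hκ : IsMoll κ ε) (hR : R' + ε < R) (has : a < s) (heb : e < b) :
    SmoothSol R' s e (fun x t => mol κ (fun y => u y t) x)
      (fun x t => mol κ (fun y => g y t) x) := by
  have hc := hκ.hasCompactSupport
  have h2 : ∀ {f : Eu n → ℝ}, ContDiff ℝ ∞ f → ContDiff ℝ 2 f := fun h => contDiff_infty.1 h 2
  have h1 : ∀ {f : Eu n → ℝ}, ContDiff ℝ ∞ f → ContDiff ℝ 1 f := fun h => contDiff_infty.1 h 1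
  have hs1 : ∀ i, tsupport (pd i κ) ⊆ closedBall 0 ε := fun i =>
    (tsupport_pd_subset κ i).trans hκ.supp
  have hsl : ∀ {f : Eu n → ℝ}, tsupport f ⊆ closedBall 0 ε → tsupport (lap f) ⊆ closedBall 0 ε :=
    fun h => (tsupport_lap_subset _).trans h
  have el : ∀ t, lap (fun y => mol κ (fun y => u y t) y) = mol (lap κ) fun y => u y t :=
    fun t => lap_mol (h2 hκ.smooth) hc (hu.cx t)
  have ep : ∀ t i, pd i (fun y => mol κ (fun y => u y t) y) = mol (pd i κ) fun y => u y t :=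
    fun t i => pd_mol (h1 hκ.smooth) hc (hu.cx t) i
  have er : ∀ t i, pd i (fun y => mol (lap κ) (fun y => u y t) y + mol κ (fun y => g y t) y)
      = fun x => mol (lap (pd i κ)) (fun y => u y t) x + mol (pd i κ) (fun y => g y t) x := by
    intro t i
    have s1 := contDiff_mol (m := 1) (h1 hκ.smooth.lap_infty) hc.lap (hu.cx t)
    have s2 := contDiff_mol (m := 1) (h1 hκ.smooth) hc (hg.cx t)
    rw [pd_add (s1.differentiable (by simp)) (s2.differentiable (by simp)),
      pd_mol (h1 hκ.smooth.lap_infty) hc.lap (hu.cx t), pd_mol (h1 hκ.smooth) hc (hg.cx t),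
      lap_pd hκ.smooth]
  have hR' : R' + ε ≤ R := hR.le
  have hsub : Icc s e ⊆ Ioo a b := fun t ht => ⟨has.trans_le ht.1, ht.2.trans_lt heb⟩
  constructor
  · exact fun t => contDiff_mol hκ.smooth hc (hu.cx t)
  · exact fun t => contDiff_mol hκ.smooth hc (hg.cx t)
  · exact hu.bdd_mol hκ.smooth.continuous hκ.supp hR' has.le heb.le
  · exact hg.bdd_mol hκ.smooth.continuous hκ.supp hR' has.le heb.le
  · intro i
    simp only [ep]
    exact hu.bdd_mol (hκ.smooth.pd_infty i).continuous (hs1 i) hR' has.le heb.le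
  · simp only [el]
    exact hu.bdd_mol hκ.smooth.lap_infty.continuous (hsl hκ.supp) hR' has.le heb.le
  · intro i
    simp only [el, er]
    exact (hu.bdd_mol (hκ.smooth.pd_infty i).lap_infty.continuous (hsl (hs1 i)) hR' has.le
      heb.le).add (hg.bdd_mol (hκ.smooth.pd_infty i).continuous (hs1 i) hR' has.le heb.le)
  · intro x hx t ht
    simp only [el]
    exact h.hasDerivAt_mol hu.cx hg.cx (h2 hκ.smooth) hκ.supp (by linarith) (hsub ht)
  · intro i x hx t ht
    simp only [el, ep, er]
    exact h.hasDerivAt_mol hu.cx hg.cx (h2 (hκ.smooth.pd_infty i)) (hs1 i) (by linarith) (hsub ht)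

end Smooth

section Energy

variable {n : ℕ}

/-- The squared length of the spatial gradient. -/
noncomputable def gsq (a : Eu n → ℝ → ℝ) (x : Eu n) (t : ℝ) : ℝ :=
  ∑ i, pd i (fun y => a y t) x ^ 2

theorem gsq_nonneg (a : Eu n → ℝ → ℝ) (x : Eu n) (t : ℝ) : 0 ≤ gsq a x t :=
  Finset.sum_nonneg fun _ _ => sq_nonneg _

theorem SmoothSol.bdd_gsq {R s e : ℝ} {a g : Eu n → ℝ → ℝ} (h : SmoothSol R s e a g) :
    Bdd R s e (gsq a) := Bdd.sum _ fun i _ => (h.bdd_pd i).pow 2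

/-- The time derivative of a smooth solution. -/
noncomputable def rate (a g : Eu n → ℝ → ℝ) (x : Eu n) (t : ℝ) : ℝ :=
  lap (fun y => a y t) x + g x t

theorem SmoothSol.bdd_rate {R s e : ℝ} {a g : Eu n → ℝ → ℝ} (h : SmoothSol R s e a g) :
    Bdd R s e (rate a g) := h.bdd_lap.add h.gbdd

theorem hasCompactSupport_of_eq_zero {φ : Eu n → ℝ} {R : ℝ} (h0 : ∀ x, R < ‖x‖ → φ x = 0) :
    HasCompactSupport φ :=
  HasCompactSupport.intro (isCompact_closedBall 0 R) fun x hx => h0 x (by simpa using hx)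

theorem integral_mul_lap_self {a φ : Eu n → ℝ} (ha : ContDiff ℝ ∞ a) (hφ : ContDiff ℝ 2 φ)
    (hc : HasCompactSupport φ) :
    ∫ x, a x * lap a x * φ x = (∫ x, 1 / 2 * a x ^ 2 * lap φ x) - ∫ x,
        (∑ i, pd i a x ^ 2) * φ x := by
  have h2 : ContDiff ℝ 2 a := contDiff_infty.1 ha 2
  have el : ∀ x, lap (fun x => a x ^ 2) x = 2 * a x * lap a x + 2 * ∑ i, pd i a x ^ 2 := by
    intro x
    rw [lap_comp (h := fun q => q ^ 2) (by fun_prop) h2]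
    have e1 : deriv (fun q : ℝ => q ^ 2) = fun q => 2 * q := by funext q; simp
    have e2 : deriv (fun q : ℝ => 2 * q) = fun _ => 2 := by
      funext q; rw [deriv_const_mul_field]; simp
    rw [e1, e2]
  have key := integral_mul_lap (h2.pow 2) hφ hc
  have c1 : Continuous fun x => a x * lap a x := h2.continuous.mul h2.continuous_lap
  have c2 : Continuous fun x => ∑ i, pd i a x ^ 2 :=
    continuous_finsetSum _ fun i _ => ((h2.of_le (by norm_num)).continuous_pd i).pow 2
  have i1 : Integrable fun x => a x * lap a x * φ x :=
    (c1.mul hφ.continuous).integrable_of_hasCompactSupport hc.mul_left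
  have i2 : Integrable fun x => (∑ i, pd i a x ^ 2) * φ x :=
    (c2.mul hφ.continuous).integrable_of_hasCompactSupport hc.mul_left
  have e3 : ∀ x, lap (fun x => a x ^ 2) x * φ x
      = 2 * (a x * lap a x * φ x) + 2 * ((∑ i, pd i a x ^ 2) * φ x) := fun x => by rw [el]; ring
  simp only [e3] at key
  rw [integral_add (i1.const_mul 2) (i2.const_mul 2), integral_const_mul, integral_const_mul] at key
  simp only [mul_assoc, integral_const_mul] at key ⊢
  linarith

theorem SmoothSol.caccioppoli {R s e : ℝ} {a g : Eu n → ℝ → ℝ} (h : SmoothSol R s e a g)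
    (hse : s ≤ e) {φ : Eu n → ℝ} (hφ : ContDiff ℝ 2 φ) (h0 : ∀ x, R < ‖x‖ → φ x = 0)
    (hl0 : ∀ x, R < ‖x‖ → lap φ x = 0) {θ θ' : ℝ → ℝ} (hθ : ∀ t, HasDerivAt θ (θ' t) t)
    (hθ' : Continuous θ') (hs : θ s = 0) (he : θ e = 0) :
    dint s e (fun x t => θ t * (gsq a x t * φ x)) =
      dint s e (fun x t => θ' t * (1 / 2 * a x t ^ 2 * φ x))
      + dint s e (fun x t => θ t * (1 / 2 * a x t ^ 2 * lap φ x))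
      + dint s e (fun x t => θ t * (a x t * g x t * φ x)) := by
  have hc := hasCompactSupport_of_eq_zero h0
  have hθc : Continuous θ := continuous_iff_continuousAt.2 fun t => (hθ t).continuousAt
  have b1 := bdd_time (n := n) (a := s) (b := e) hθc.continuousOn R
  have hq := (h.bdd.pow 2).const_mul (1 / 2)
  have key := hq.dint_deriv hse (h.bdd.mul h.bdd_rate) (fun x hx t ht => by
    have := ((h.deriv x hx t (Ioo_subset_Icc_self ht)).pow 2).const_mul (1 / 2)
    refine this.congr_deriv ?_
    simp only [rate]; ring) hφ.continuous h0 hθ hθ' hs he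
  have l1 := ((h.bdd.mul h.bdd_lap).mul_test hφ.continuous h0).mul' b1
  have l2 := ((h.bdd.mul h.gbdd).mul_test hφ.continuous h0).mul' b1
  have l3 := (hq.mul_test hφ.continuous_lap hl0).mul' b1
  have l4 := (h.bdd_gsq.mul_test hφ.continuous h0).mul' b1
  have e1 : dint s e (fun x t => θ t * (a x t * rate a g x t * φ x))
      = dint s e (fun x t => θ t * (a x t * lap (fun y => a y t) x * φ x)) +
        dint s e (fun x t => θ t * (a x t * g x t * φ x)) := by
    rw [← dint_add hse l1 l2]
    exact dint_congr hse fun x t _ => by simp only [rate]; ring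
  have e2 : dint s e (fun x t => θ t * (a x t * lap (fun y => a y t) x * φ x))
      = dint s e (fun x t => θ t * (1 / 2 * a x t ^ 2 * lap φ x))
        - dint s e (fun x t => θ t * (gsq a x t * φ x)) := by
    rw [← dint_sub hse l3 l4]
    refine intervalIntegral.integral_congr fun t ht => ?_
    rw [uIcc_of_le hse] at ht
    rw [integral_sub (l3.integrable ht) (l4.integrable ht)]
    simp only [integral_const_mul]
    rw [integral_mul_lap_self (h.smooth t) hφ hc, mul_sub]
    rfl
  linarith

theorem integral_grad_mul_grad {a q φ : Eu n → ℝ} (ha : ContDiff ℝ ∞ a) (hq : ContDiff ℝ ∞ q)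
    (hφ : ContDiff ℝ 2 φ) (hc : HasCompactSupport φ) :
    ∫ x, (∑ i, pd i a x * pd i q x) * φ x
      = -∫ x, (lap a x * q x * φ x + (∑ i, pd i φ x * pd i a x) * q x) := by
  have h1 : ∀ {f : Eu n → ℝ}, ContDiff ℝ ∞ f → ContDiff ℝ 1 f := fun h => contDiff_infty.1 h 1
  have hφ1 : ContDiff ℝ 1 φ := hφ.of_le (by norm_num)
  have hp : ∀ i, ContDiff ℝ 1 fun x => pd i a x * φ x := fun i => (h1 (ha.pd_infty i)).mul hφ1
  have hcp : ∀ i, HasCompactSupport fun x => pd i a x * φ x := fun i => hc.mul_left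
  have key : ∀ i, ∫ x, q x * pd i (fun x => pd i a x * φ x) x
      = -∫ x, pd i q x * (pd i a x * φ x) := fun i => integral_mul_pd (h1 hq) (hp i) (hcp i) i
  have j1 : ∀ i ∈ Finset.univ, Integrable fun x => pd i q x * (pd i a x * φ x) := fun i _ =>
    (((h1 hq).continuous_pd i).mul (hp i).continuous).integrable_of_hasCompactSupport
      (hcp i).mul_left
  have j2 : ∀ i ∈ Finset.univ, Integrable fun x => q x * pd i (fun x => pd i a x * φ x) x :=
    fun i _ => ((h1 hq).continuous.mul ((hp i).continuous_pd i)).integrable_of_hasCompactSupport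
      ((hcp i).pd i).mul_left
  calc ∫ x, (∑ i, pd i a x * pd i q x) * φ x
      = ∫ x, ∑ i, pd i q x * (pd i a x * φ x) := by
        refine integral_congr_ae (Eventually.of_forall fun x => ?_)
        simp only [Finset.sum_mul]
        exact Finset.sum_congr rfl fun i _ => by ring
    _ = -∫ x, ∑ i, q x * pd i (fun x => pd i a x * φ x) x := by
        rw [integral_finsetSum _ j1, integral_finsetSum _ j2, ← Finset.sum_neg_distrib]
        exact Finset.sum_congr rfl fun i _ => by rw [key, neg_neg]
    _ = _ := by
        congr 1
        refine integral_congr_ae (Eventually.of_forall fun x => ?_)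
        simp only [lap_eq_sum_pd, Finset.sum_mul, ← Finset.sum_add_distrib]
        refine Finset.sum_congr rfl fun i _ => ?_
        rw [pd_mul ((h1 (ha.pd_infty i)).differentiable (by simp)) (hφ1.differentiable (by simp))]
        ring

theorem SmoothSol.energy {R s e : ℝ} {a g : Eu n → ℝ → ℝ} (h : SmoothSol R s e a g)
    (hse : s ≤ e) {φ : Eu n → ℝ} (hφ : ContDiff ℝ 2 φ) (h0 : ∀ x, R < ‖x‖ → φ x = 0)
    (hd0 : ∀ i x, R < ‖x‖ → pd i φ x = 0) {θ θ' : ℝ → ℝ} (hθ : ∀ t, HasDerivAt θ (θ' t) t)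
    (hθ' : Continuous θ') (hs : θ s = 0) (he : θ e = 0) :
    dint s e (fun x t => θ t * (rate a g x t ^ 2 * φ x)) =
      dint s e (fun x t => θ' t * (1 / 2 * gsq a x t * φ x))
      - dint s e (fun x t => θ t * ((∑ i, pd i φ x * pd i (fun y => a y t) x) * rate a g x t))
      + dint s e (fun x t => θ t * (g x t * rate a g x t * φ x)) := by
  have hc := hasCompactSupport_of_eq_zero h0
  have hθc : Continuous θ := continuous_iff_continuousAt.2 fun t => (hθ t).continuousAt
  have b1 := bdd_time (n := n) (a := s) (b := e) hθc.continuousOn R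
  have hq := h.bdd_gsq.const_mul (1 / 2)
  have hφ1 : ContDiff ℝ 1 φ := hφ.of_le (by norm_num)
  have hf' : Bdd R s e fun x t => ∑ i, pd i (fun y => a y t) x *
      pd i (fun y => rate a g y t) x := Bdd.sum _ fun i _ => (h.bdd_pd i).mul (h.bdd_pd_rhs i)
  have key := hq.dint_deriv hse hf' (fun x hx t ht => by
    have := (HasDerivAt.fun_sum (u := Finset.univ) fun i _ =>
      (h.deriv_pd i x hx t (Ioo_subset_Icc_self ht)).pow 2).const_mul (1 / 2)
    refine this.congr_deriv ?_
    rw [Finset.mul_sum]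
    refine Finset.sum_congr rfl fun i _ => ?_
    unfold rate
    norm_num
    ring) hφ.continuous h0 hθ hθ' hs he
  have l1 := (((h.bdd_rate.pow 2).mul_test hφ.continuous h0)).mul' b1
  have l2 := (((h.gbdd.mul h.bdd_rate).mul_test hφ.continuous h0)).mul' b1
  have l3 : Loc R s e fun x t => θ t *
      ((∑ i, pd i φ x * pd i (fun y => a y t) x) * rate a g x t) := by
    refine (Loc.mul ⟨Bdd.sum _ fun i _ => (bdd_space (hφ1.continuous_pd i) R s e).mul
      (h.bdd_pd i), fun x hx t ht => ?_⟩ h.bdd_rate).mul' b1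
    exact Finset.sum_eq_zero fun i _ => by rw [hd0 i x hx, zero_mul]
  have e2 : dint s e (fun x t => θ t * ((∑ i, pd i (fun y => a y t) x *
      pd i (fun y => rate a g y t) x) * φ x)) = dint s e (fun x t =>
        θ t * (g x t * rate a g x t * φ x)) - dint s e (fun x t => θ t * (rate a g x t ^ 2 * φ x))
        - dint s e (fun x t => θ t * ((∑ i, pd i φ x * pd i (fun y => a y t) x) *
          rate a g x t)) := by
    rw [← dint_sub hse l2 l1, ← dint_sub hse (l2.sub l1) l3]
    refine intervalIntegral.integral_congr fun t ht => ?_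
    rw [uIcc_of_le hse] at ht
    have hr : ContDiff ℝ ∞ fun y => rate a g y t := (h.smooth t).lap_infty.add (h.gsmooth t)
    have := integral_grad_mul_grad (h.smooth t) hr hφ hc
    simp only [integral_const_mul]
    rw [this, mul_neg, ← integral_const_mul, ← integral_neg]
    refine integral_congr_ae (Eventually.of_forall fun x => ?_)
    simp only [rate]
    ring
  linarith

end Energy

section EnergyBounds

variable {n : ℕ}

/-- The potential of the nonlinearity. -/
noncomputable def pot (r lam a b : ℝ) : ℝ :=
  (a ^ (2 * r + 2) + b ^ (2 * r + 2)) / (2 * r + 2) - lam / (r + 1) * (a ^ (r + 1) * b ^ (r + 1))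

theorem hasDerivAt_pot {r : ℝ} (hr : 0 < r) (lam : ℝ) {a b : ℝ → ℝ} {a' b' t : ℝ}
    (ha : HasDerivAt a a' t) (hb : HasDerivAt b b' t) :
    HasDerivAt (fun t => pot r lam (a t) (b t))
      (nl r lam (a t) (b t) * a' + nl r lam (b t) (a t) * b') t := by
  have h1 : ∀ {f : ℝ → ℝ} {f' : ℝ}, HasDerivAt f f' t →
      HasDerivAt (fun t => f t ^ (2 * r + 2)) (f' * (2 * r + 2) * f t ^ (2 * r + 1)) t := by
    intro f f' hf
    have := hf.rpow_const (p := 2 * r + 2) (Or.inr (by linarith))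
    rwa [show 2 * r + 2 - 1 = 2 * r + 1 by ring] at this
  have h2 : ∀ {f : ℝ → ℝ} {f' : ℝ}, HasDerivAt f f' t →
      HasDerivAt (fun t => f t ^ (r + 1)) (f' * (r + 1) * f t ^ r) t := by
    intro f f' hf
    have := hf.rpow_const (p := r + 1) (Or.inr (by linarith))
    rwa [show r + 1 - 1 = r by ring] at this
  have key := (((h1 ha).add (h1 hb)).div_const (2 * r + 2)).sub
    (((h2 ha).mul (h2 hb)).const_mul (lam / (r + 1)))
  refine key.congr_deriv ?_
  have : r + 1 ≠ 0 := by linarith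
  unfold nl
  field_simp
  ring

theorem continuous_pot {r : ℝ} (hr : 0 < r) (lam : ℝ) :
    Continuous fun z : ℝ × ℝ => pot r lam z.1 z.2 := by
  have h : ∀ s : ℝ, 0 ≤ s → ∀ k : ℝ × ℝ → ℝ, Continuous k → Continuous fun x => k x ^ s :=
    fun s hs k hk => hk.rpow_const fun _ => Or.inr hs
  exact (((h _ (by linarith) _ continuous_fst).add (h _ (by linarith) _ continuous_snd)).div_const
    _).sub (continuous_const.mul ((h _ (by linarith) _ continuous_fst).mul
      (h _ (by linarith) _ continuous_snd)))

theorem abs_pot_le {r lam a b : ℝ} (hr : 0 < r) (h0 : 0 ≤ lam) (h1 : lam < 1) (ha : 0 ≤ a)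
    (hb : 0 ≤ b) : |pot r lam a b| ≤ (a + b) * (a + b) ^ (2 * r + 1) := by
  have hw : 0 ≤ a + b := add_nonneg ha hb
  have e0 : (a + b) * (a + b) ^ (2 * r + 1) = (a + b) ^ (2 * r + 2) := by
    rw [show 2 * r + 2 = 1 + (2 * r + 1) by ring, Real.rpow_add_of_nonneg hw zero_le_one
      (by linarith), Real.rpow_one]
  have e1 : a ^ (2 * r + 2) ≤ (a + b) ^ (2 * r + 2) := by gcongr; linarith
  have e2 : b ^ (2 * r + 2) ≤ (a + b) ^ (2 * r + 2) := by gcongr; linarith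
  have e3 : a ^ (r + 1) * b ^ (r + 1) ≤ (a + b) ^ (2 * r + 2) := by
    calc a ^ (r + 1) * b ^ (r + 1) ≤ (a + b) ^ (r + 1) * (a + b) ^ (r + 1) := by
          gcongr <;> linarith
      _ = _ := by rw [← Real.rpow_add_of_nonneg hw (by linarith) (by linarith)]; congr 1; ring
  have p1 : 0 ≤ a ^ (2 * r + 2) := by positivity
  have p2 : 0 ≤ b ^ (2 * r + 2) := by positivity
  have p3 : 0 ≤ a ^ (r + 1) * b ^ (r + 1) := by positivity
  have l1 : lam / (r + 1) ≤ 1 := by rw [div_le_one (by linarith)]; linarith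
  have l0 : 0 ≤ lam / (r + 1) := by positivity
  have q1 : (a ^ (2 * r + 2) + b ^ (2 * r + 2)) / (2 * r + 2) ≤ (a + b) ^ (2 * r + 2) := by
    rw [div_le_iff₀ (by linarith)]
    nlinarith
  have q0 : 0 ≤ (a ^ (2 * r + 2) + b ^ (2 * r + 2)) / (2 * r + 2) := by positivity
  rw [e0, pot, abs_le]
  constructor <;> nlinarith

theorem abs_deriv_tcut_le (j : ℕ) {t : ℝ} (ht : t ∈ Icc (-1 : ℝ) 1) :
    |-((j + 1 + 3 : ℝ) * (max (1 - t ^ 2) 0) ^ (j + 3)) * (2 * t)| ≤ 2 * (j + 4) * tcut j t := by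
  have h0 : 0 ≤ (max (1 - t ^ 2) 0) ^ (j + 3) := by positivity
  rw [abs_mul, abs_neg, abs_of_nonneg (by positivity), abs_mul, abs_two, tcut]
  have := abs_le.2 ht
  nlinarith [mul_nonneg (by positivity : (0:ℝ) ≤ j + 4) h0, abs_nonneg t]

theorem tcut_nonneg (j : ℕ) (t : ℝ) : 0 ≤ tcut j t := by unfold tcut; positivity

theorem tcut_le {i j : ℕ} (h : i ≤ j) (t : ℝ) : tcut j t ≤ tcut i t :=
  pow_le_pow_of_le_one (le_max_right _ _) (max_le (by nlinarith [sq_nonneg t]) zero_le_one)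
    (by omega)

theorem cut_pow_le {i j : ℕ} (h : i ≤ j) (x : Eu n) : cut 1 x ^ j ≤ cut 1 x ^ i :=
  pow_le_pow_of_le_one (cut_nonneg _ _) (cut_le_one _ _) h

theorem cut_pow_eq_zero (j : ℕ) (x : Eu n) (hx : 1 < ‖x‖) : cut 1 x ^ (j + 1) = 0 := by
  rw [cut_eq_zero one_pos hx.le, zero_pow (by omega)]

theorem lap_cut_pow_eq_zero (j : ℕ) (x : Eu n) (hx : 1 < ‖x‖) :
    lap (fun x : Eu n => cut 1 x ^ (j + 3)) x = 0 := by
  have := abs_lap_cut_pow one_pos j x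
  rw [cut_pow_eq_zero j x hx, mul_zero] at this
  exact abs_nonpos_iff.1 this

theorem pd_cut_pow (j : ℕ) (i : Fin n) (x : Eu n) :
    pd i (fun x : Eu n => cut 1 x ^ (j + 3)) x = -((j + 3) * cut 1 x ^ (j + 2)) * (2 * x i) := by
  have e : (fun x : Eu n => cut 1 x ^ (j + 3))
      = fun x : Eu n => (fun q : ℝ => (max (1 - q) 0) ^ (j + 3)) (‖x‖ ^ 2) := by
    funext x; simp [cut]
  rw [e, pd_comp (hh := (contDiff_posPow_one_sub j).differentiable (by norm_num))
    (hq := (contDiff_norm_sq ℝ (n := 1)).differentiable (by norm_num))]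
  have : deriv (fun q : ℝ => (max (1 - q) 0) ^ (j + 3)) (‖x‖ ^ 2) = _ :=
    (hasDerivAt_posPow_one_sub (j + 1) (‖x‖ ^ 2)).deriv
  simp only [this, pd_norm_sq, cut, inv_one, one_smul]
  push_cast
  ring

theorem mul_sum_pd_cut_le (j : ℕ) (x : Eu n) (y : Fin n → ℝ) (A : ℝ) :
    -((∑ i, pd i (fun x : Eu n => cut 1 x ^ (j + 3)) x * y i) * A) ≤
      1 / 4 * (cut 1 x ^ (j + 3) * A ^ 2)
        + 4 * (j + 3) ^ 2 * (cut 1 x ^ (j + 1) * ∑ i, y i ^ 2) := by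
  rcases le_or_gt 1 ‖x‖ with hx | hx
  · simp [pd_cut_pow, cut_eq_zero one_pos hx]
  set m := cut 1 x
  have hm : 0 ≤ m := cut_nonneg _ _
  set S := ∑ i, x i * y i
  have e : ∑ i, pd i (fun x : Eu n => cut 1 x ^ (j + 3)) x * y i
      = -(2 * (j + 3) * m ^ (j + 2)) * S := by
    rw [Finset.mul_sum]
    exact Finset.sum_congr rfl fun i _ => by rw [pd_cut_pow]; ring
  have hS : S ^ 2 ≤ ∑ i, y i ^ 2 := by
    have h1 := Finset.sum_mul_sq_le_sq_mul_sq Finset.univ (fun i => x i) y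
    have h2 : ∑ i, x i ^ 2 = ‖x‖ ^ 2 := by
      rw [EuclideanSpace.norm_sq_eq]; simp
    rw [h2] at h1
    have h3 : 0 ≤ ∑ i, y i ^ 2 := Finset.sum_nonneg fun _ _ => sq_nonneg _
    have h4 : ‖x‖ ^ 2 ≤ 1 := by nlinarith [norm_nonneg x]
    nlinarith
  rw [e]
  have h1 : 0 ≤ m ^ (j + 1) := by positivity
  have h2 : 2 * (j + 3) * m * S * A ≤ 1 / 4 * (m ^ 2 * A ^ 2) + 4 * (j + 3) ^ 2 * S ^ 2 := by
    nlinarith [sq_nonneg (1 / 2 * (m * A) - 2 * (j + 3) * S)]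
  have h3 := mul_le_mul_of_nonneg_left h2 h1
  have h4 : 4 * ((j : ℝ) + 3) ^ 2 * (m ^ (j + 1) * S ^ 2)
      ≤ 4 * (j + 3) ^ 2 * (m ^ (j + 1) * ∑ i, y i ^ 2) := by gcongr
  have e1 : m ^ (j + 3) = m ^ (j + 1) * m ^ 2 := by rw [← pow_add]
  have e2 : m ^ (j + 2) = m ^ (j + 1) * m := by rw [← pow_succ]
  rw [e1, e2]
  nlinarith

theorem tcut_one (j : ℕ) : tcut j 1 = 0 := by simp [tcut]

theorem tcut_neg_one (j : ℕ) : tcut j (-1) = 0 := by simp [tcut]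

theorem continuous_tcut (j : ℕ) : Continuous (tcut j) := by unfold tcut; fun_prop

/-- The derivative of `tcut (j + 1)`. -/
noncomputable def dtcut (j : ℕ) (t : ℝ) : ℝ := -((j + 1 + 3) * (max (1 - t ^ 2) 0) ^ (j + 3)) *
    (2 * t)

theorem hasDerivAt_tcut_succ (j : ℕ) (t : ℝ) : HasDerivAt (tcut (j + 1)) (dtcut j t) t :=
  (hasDerivAt_tcut (j + 1) t).congr_deriv (by unfold dtcut; push_cast; ring)

theorem continuous_dtcut (j : ℕ) : Continuous (dtcut j) := by unfold dtcut; fun_prop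

theorem abs_dtcut_le (j : ℕ) {t : ℝ} (ht : t ∈ Icc (-1 : ℝ) 1) :
    |dtcut j t| ≤ 2 * (j + 4) * tcut j t := abs_deriv_tcut_le j ht

theorem SmoothSol.energy_le {a g f : Eu n → ℝ → ℝ} (h : SmoothSol 1 (-1) 1 a g) (j : ℕ)
    (hf : Bdd 1 (-1) 1 f) :
    1 / 2 * dint (-1) 1 (fun x t => tcut (j + 2) t * (rate a g x t ^ 2 * cut 1 x ^ (j + 5))) ≤
      ((j + 5) + 4 * (j + 5) ^ 2) *
        dint (-1) 1 (fun x t => tcut j t * (gsq a x t * cut 1 x ^ (j + 3)))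
      + dint (-1) 1 (fun x t => tcut (j + 2) t * ((g x t - f x t) ^ 2 * cut 1 x ^ (j + 5)))
      + dint (-1) 1 (fun x t => tcut (j + 2) t * (f x t * rate a g x t * cut 1 x ^ (j + 5))) := by
  have hab : (-1 : ℝ) ≤ 1 := by norm_num
  have cφ : ContDiff ℝ 2 fun x : Eu n => cut 1 x ^ (j + 5) := contDiff_cut_pow 1 (j + 2)
  have cφ1 : ContDiff ℝ 1 fun x : Eu n => cut 1 x ^ (j + 5) := cφ.of_le (by norm_num)
  have c2 : Continuous fun x : Eu n => cut 1 x ^ (j + 3) := (continuous_cut 1).pow _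
  have z0 : ∀ x : Eu n, 1 < ‖x‖ → cut 1 x ^ (j + 5) = 0 := cut_pow_eq_zero (j + 4)
  have z2 : ∀ x : Eu n, 1 < ‖x‖ → cut 1 x ^ (j + 3) = 0 := cut_pow_eq_zero (j + 2)
  have zd : ∀ i (x : Eu n), 1 < ‖x‖ → pd i (fun x : Eu n => cut 1 x ^ (j + 5)) x = 0 :=
    fun i x hx => by
      rw [pd_cut_pow (j + 2), show j + 2 + 2 = j + 3 + 1 by ring, cut_pow_eq_zero _ x hx]; simp
  have key := h.energy hab cφ z0 zd (hasDerivAt_tcut_succ (j + 1)) (continuous_dtcut (j + 1))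
    (tcut_neg_one _) (tcut_one _)
  have bt := bdd_time (n := n) (a := -1) (b := 1) (continuous_tcut (j + 2)).continuousOn 1
  have bt' := bdd_time (n := n) (a := -1) (b := 1) (continuous_dtcut (j + 1)).continuousOn 1
  have bt2 := bdd_time (n := n) (a := -1) (b := 1) (continuous_tcut j).continuousOn 1
  have l0 := ((h.bdd_rate.pow 2).mul_test cφ.continuous z0).mul' bt
  have l1 := ((h.bdd_gsq.const_mul (1 / 2)).mul_test cφ.continuous z0).mul' bt'
  have l3 := ((h.gbdd.mul h.bdd_rate).mul_test cφ.continuous z0).mul' bt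
  have lg := (h.bdd_gsq.mul_test c2 z2).mul' bt2
  have ld := (((h.gbdd.sub hf).pow 2).mul_test cφ.continuous z0).mul' bt
  have lf := ((hf.mul h.bdd_rate).mul_test cφ.continuous z0).mul' bt
  have l2 : Loc 1 (-1) 1 fun x t => tcut (j + 2) t *
      ((∑ i, pd i (fun x : Eu n => cut 1 x ^ (j + 5)) x * pd i (fun y => a y t) x) *
        rate a g x t) := by
    refine (Loc.mul ⟨Bdd.sum _ fun i _ => (bdd_space (cφ1.continuous_pd i) 1 (-1) 1).mul
      (h.bdd_pd i), fun x hx t ht => ?_⟩ h.bdd_rate).mul' bt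
    exact Finset.sum_eq_zero fun i _ => by rw [zd i x hx, zero_mul]
  have hg0 : ∀ x : Eu n, 0 ≤ cut 1 x ^ (j + 5) := fun x => pow_nonneg (cut_nonneg _ _) _
  have m1 : dint (-1) 1 (fun x t => dtcut (j + 1) t * (1 / 2 * gsq a x t * cut 1 x ^ (j + 5)))
      ≤ (j + 5) * dint (-1) 1 (fun x t => tcut j t * (gsq a x t * cut 1 x ^ (j + 3))) := by
    rw [← dint_const_mul]
    refine dint_mono hab l1 (lg.const_mul _) fun x t ht => ?_
    have e1 := (le_abs_self _).trans (abs_dtcut_le (j + 1) ht)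
    have e2 := tcut_le (show j ≤ j + 1 by omega) t
    have e3 := cut_pow_le (show j + 3 ≤ j + 5 by omega) x
    have e4 := gsq_nonneg a x t
    have e5 : dtcut (j + 1) t ≤ 2 * (j + 5) * tcut j t := by
      push_cast at e1
      nlinarith [mul_nonneg (by positivity : (0:ℝ) ≤ j + 5) (sub_nonneg.2 e2)]
    calc dtcut (j + 1) t * (1 / 2 * gsq a x t * cut 1 x ^ (j + 5))
        ≤ 2 * (j + 5) * tcut j t * (1 / 2 * gsq a x t * cut 1 x ^ (j + 3)) := by
          have := tcut_nonneg j t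
          have := hg0 x
          gcongr
      _ = _ := by ring
  have m2 : -dint (-1) 1 (fun x t => tcut (j + 2) t *
      ((∑ i, pd i (fun x : Eu n => cut 1 x ^ (j + 5)) x * pd i (fun y => a y t) x) *
        rate a g x t)) ≤
      1 / 4 * dint (-1) 1 (fun x t => tcut (j + 2) t * (rate a g x t ^ 2 * cut 1 x ^ (j + 5)))
      + 4 * (j + 5) ^ 2 *
        dint (-1) 1 (fun x t => tcut j t * (gsq a x t * cut 1 x ^ (j + 3))) := by
    rw [← dint_const_mul, ← dint_const_mul, ← dint_add hab (l0.const_mul _) (lg.const_mul _),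
      ← neg_one_mul, ← dint_const_mul]
    refine dint_mono hab (l2.const_mul _) ((l0.const_mul _).add (lg.const_mul _)) fun x t ht => ?_
    have e1 := mul_le_mul_of_nonneg_left (mul_sum_pd_cut_le (j + 2) x
      (fun i => pd i (fun y => a y t) x) (rate a g x t)) (tcut_nonneg (j + 2) t)
    have e2 := tcut_le (show j ≤ j + 2 by omega) t
    have e4 : 0 ≤ 4 * ((j : ℝ) + 5) ^ 2 * (gsq a x t * cut 1 x ^ (j + 3)) :=
      mul_nonneg (by positivity) (mul_nonneg (gsq_nonneg a x t) (pow_nonneg (cut_nonneg _ _) _))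
    have e5 := mul_le_mul_of_nonneg_right e2 e4
    rw [← gsq] at e1
    push_cast at e1
    have e6 : ((j : ℝ) + 2 + 3) = j + 5 := by ring
    rw [e6] at e1
    linarith
  have m3 : dint (-1) 1 (fun x t => tcut (j + 2) t * (g x t * rate a g x t * cut 1 x ^ (j + 5))) ≤
      1 / 4 * dint (-1) 1 (fun x t => tcut (j + 2) t * (rate a g x t ^ 2 * cut 1 x ^ (j + 5)))
      + dint (-1) 1 (fun x t => tcut (j + 2) t * ((g x t - f x t) ^ 2 * cut 1 x ^ (j + 5)))
      + dint (-1) 1 (fun x t => tcut (j + 2) t * (f x t * rate a g x t * cut 1 x ^ (j + 5))) := by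
    rw [← dint_const_mul, ← dint_add hab (l0.const_mul _) ld,
      ← dint_add hab ((l0.const_mul _).add ld) lf]
    refine dint_mono hab l3 (((l0.const_mul _).add ld).add lf) fun x t ht => ?_
    have e1 : g x t * rate a g x t ≤ 1 / 4 * rate a g x t ^ 2 + (g x t - f x t) ^ 2
        + f x t * rate a g x t := by
      nlinarith [sq_nonneg (1 / 2 * rate a g x t - (g x t - f x t))]
    have e2 := mul_le_mul_of_nonneg_left e1 (mul_nonneg (tcut_nonneg (j + 2) t) (hg0 x))
    linarith
  linarith

end EnergyBounds

section Approx

variable {n : ℕ}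

/-- Uniformly bounded pointwise convergence on a cylinder. -/
structure Conv (R a b : ℝ) (F : ℕ → Eu n → ℝ → ℝ) (f : Eu n → ℝ → ℝ) : Prop where
  bdd : ∀ k, Bdd R a b (F k)
  bd : ∃ M, ∀ k x, ‖x‖ ≤ R → ∀ t ∈ Icc a b, |F k x t| ≤ M
  lim : ∀ x, ‖x‖ ≤ R → ∀ t ∈ Icc a b, Tendsto (fun k => F k x t) atTop (𝓝 (f x t))

theorem Conv.comp₂ {R a b : ℝ} {F G : ℕ → Eu n → ℝ → ℝ} {f g : Eu n → ℝ → ℝ} (hf : Conv R a b F f)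
    (hg : Conv R a b G g) {Φ : ℝ → ℝ → ℝ} (hΦ : Continuous fun z : ℝ × ℝ => Φ z.1 z.2) :
    Conv R a b (fun k x t => Φ (F k x t) (G k x t)) fun x t => Φ (f x t) (g x t) := by
  obtain ⟨M, hM⟩ := hf.bd
  obtain ⟨N, hN⟩ := hg.bd
  obtain ⟨C, hC⟩ := (isCompact_Icc.prod isCompact_Icc : IsCompact (Icc (-M) M ×ˢ Icc (-N) N))
    |>.exists_bound_of_continuousOn hΦ.continuousOn
  exact ⟨fun k => (hf.bdd k).comp₂ (hg.bdd k) hΦ, ⟨C, fun k x hx t ht =>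
    hC (F k x t, G k x t) ⟨abs_le.1 (hM k x hx t ht), abs_le.1 (hN k x hx t ht)⟩⟩,
    fun x hx t ht => (hΦ.tendsto (f x t, g x t)).comp
      ((hf.lim x hx t ht).prodMk_nhds (hg.lim x hx t ht))⟩

theorem Conv.tendsto_dint {R a b : ℝ} (hab : a ≤ b) {F : ℕ → Eu n → ℝ → ℝ} {f : Eu n → ℝ → ℝ}
    (hf : Conv R a b F f) {φ : Eu n → ℝ} (hφ : Continuous φ) (h0 : ∀ x, R < ‖x‖ → φ x = 0)
    {θ : ℝ → ℝ} (hθ : Continuous θ) :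
    Tendsto (fun k => dint a b fun x t => θ t * (F k x t * φ x)) atTop
      (𝓝 (dint a b fun x t => θ t * (f x t * φ x))) := by
  obtain ⟨M, hM⟩ := hf.bd
  have bt := bdd_time (n := n) (a := a) (b := b) hθ.continuousOn R
  obtain ⟨P, hP⟩ := (bdd_space hφ R a b).bd
  obtain ⟨Q, hQ⟩ := bt.bd
  refine _root_.tendsto_dint (R := R) (M := Q * (M * P)) hab
    (fun k => ((hf.bdd k).mul_test hφ h0).mul' bt)
    (fun k x hx t ht => ?_) (fun x hx t ht => ?_) fun x hx t ht => ?_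
  · rw [abs_mul, abs_mul]
    have h1 := hM k x hx t ht
    have h2 := hP x hx t ht
    have h3 := hQ x hx t ht
    have := (abs_nonneg _).trans h1
    have := (abs_nonneg _).trans h3
    gcongr
  · exact ((hf.lim x hx t ht).mul_const _).const_mul _
  · simp [h0 x hx]

theorem Reg.conv_mol {R a b N R' s e : ℝ} {u : Eu n → ℝ → ℝ} (hu : Reg R a b N u)
    {κ : ℕ → Eu n → ℝ} {ε : ℕ → ℝ} (hκ : ∀ k, IsMoll (κ k) (ε k)) (hε : Tendsto ε atTop (𝓝 0))
    (hR : ∀ k, R' + ε k ≤ R) (has : a ≤ s) (heb : e ≤ b) :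
    Conv R' s e (fun k x t => mol (κ k) (fun y => u y t) x) u where
  bdd k := hu.bdd_mol (hκ k).smooth.continuous (hκ k).supp (hR k) has heb
  bd := ⟨N, fun k x hx t ht => (hκ k).abs_mol_le (hu.cx t) fun y hy => hu.bd y (by
    have := norm_add_le (y - x) x
    rw [sub_add_cancel] at this
    linarith [hR k]) t (Icc_subset_Icc has heb ht)⟩
  lim x _ t _ := tendsto_mol hκ hε (hu.cx t) x

/-- The weight `(1 + w^p)` integrated against cutoffs. -/
noncomputable def wint (n : ℕ) (p : ℝ) (j : ℕ) (w : Eu n → ℝ → ℝ) : ℝ :=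
  dint (-1) 1 fun x t => tcut j t * ((1 + w x t ^ p) * cut 1 x ^ (j + 3))

theorem dint_le_wint {p : ℝ} (hp : 0 < p) {j : ℕ} {w : Eu n → ℝ → ℝ} (hw : Bdd 1 (-1) 1 w)
    (hw0 : ∀ x t, 0 ≤ w x t)
    {f : Eu n → ℝ → ℝ} (hf : Bdd 1 (-1) 1 f) {θ : ℝ → ℝ} (hθ : Continuous θ) {φ : Eu n → ℝ}
    (hφ : Continuous φ) (h0 : ∀ x, 1 < ‖x‖ → φ x = 0) {c d N : ℝ} (hc : 0 ≤ c)
    (hN : 0 ≤ N)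
    (h1 : ∀ t ∈ Icc (-1 : ℝ) 1, |θ t| ≤ c * tcut j t) (h2 : ∀ x, |φ x| ≤ d * cut 1 x ^ (j + 3))
    (h : ∀ x, ‖x‖ ≤ 1 → ∀ t ∈ Icc (-1 : ℝ) 1, |f x t| ≤ N * (1 + w x t ^ p)) :
    |dint (-1) 1 fun x t => θ t * (f x t * φ x)| ≤ c * d * N * wint n p j w := by
  have hab : (-1 : ℝ) ≤ 1 := by norm_num
  have l := (hf.mul_test hφ h0).mul' (bdd_time (n := n) (a := -1) (b := 1) hθ.continuousOn 1)
  have c2 : Continuous fun x : Eu n => cut 1 x ^ (j + 3) := (continuous_cut 1).pow _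
  have hw1 : Bdd 1 (-1) 1 fun x t => 1 + w x t ^ p :=
    (bdd_space continuous_const 1 (-1) 1).add (hw.rpow hp)
  have l2 := ((hw1.mul_test c2 (cut_pow_eq_zero (j + 2))).mul' (bdd_time (n := n) (a := -1) (b := 1)
    (continuous_tcut j).continuousOn 1)).const_mul (c * d * N)
  refine (abs_dint_le hab l).trans ?_
  rw [wint, ← dint_const_mul]
  refine dint_mono hab l.abs l2 fun x t ht => ?_
  rcases le_or_gt ‖x‖ 1 with hx | hx
  · rw [abs_mul, abs_mul]
    have e1 := h1 t ht
    have e2 := h2 x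
    have e3 := h x hx t ht
    have := tcut_nonneg j t
    have : 0 ≤ cut 1 x ^ (j + 3) := pow_nonneg (cut_nonneg _ _) _
    have : 0 ≤ w x t ^ p := Real.rpow_nonneg (hw0 x t) _
    calc |θ t| * (|f x t| * |φ x|)
        ≤ c * tcut j t * (N * (1 + w x t ^ p) * (d * cut 1 x ^ (j + 3))) := by gcongr
      _ = _ := by ring
  · rw [h0 x hx, cut_pow_eq_zero (j + 2) x hx]; simp

/-- Constant in the local bound for the gradient. -/
noncomputable def gradC (n j : ℕ) : ℝ := 2 * (j + 5) + lapC n (j + 2) + 2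

theorem SmoothSol.dint_gsq_eventually {p N B : ℝ} (hp : 1 < p) (hN : 0 < N) (hB : 0 < B) {j : ℕ}
    {w u F : Eu n → ℝ → ℝ} {a g : ℕ → Eu n → ℝ → ℝ} (h : ∀ k, SmoothSol 1 (-1) 1 (a k) (g k))
    (ha : Conv 1 (-1) 1 a u) (hg : Conv 1 (-1) 1 g F) (hu : Bdd 1 (-1) 1 u) (hF : Bdd 1 (-1) 1 F)
    (hw : Bdd 1 (-1) 1 w) (hu0 : ∀ x t, 0 ≤ u x t) (huw : ∀ x t, u x t ≤ w x t)
    (hFw : ∀ x t, |F x t| ≤ w x t ^ p)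
    (hwN : ∀ x, ‖x‖ ≤ 1 → ∀ t ∈ Icc (-1 : ℝ) 1, w x t ≤ N) (hWB : wint n p j w ≤ B) :
    ∀ᶠ k in atTop, dint (-1) 1 (fun x t => tcut (j + 2) t * (gsq (a k) x t * cut 1 x ^ (j + 5)))
      ≤ gradC n j * N * B := by
  have hab : (-1 : ℝ) ≤ 1 := by norm_num
  have hw0 : ∀ x t, 0 ≤ w x t := fun x t => (hu0 x t).trans (huw x t)
  have hww : ∀ x t, w x t ≤ 1 + w x t ^ p := fun x t => by
    rcases le_total (w x t) 1 with h1 | h1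
    · have := Real.rpow_nonneg (hw0 x t) p; linarith
    · have := Real.rpow_le_rpow_of_exponent_le h1 hp.le
      rw [Real.rpow_one] at this; linarith
  have cφ : ContDiff ℝ 2 fun x : Eu n => cut 1 x ^ (j + 5) := contDiff_cut_pow 1 (j + 2)
  have z0 : ∀ x : Eu n, 1 < ‖x‖ → cut 1 x ^ (j + 5) = 0 := cut_pow_eq_zero (j + 4)
  have zl : ∀ x : Eu n, 1 < ‖x‖ → lap (fun x : Eu n => cut 1 x ^ (j + 5)) x = 0 :=
    lap_cut_pow_eq_zero (j + 2)
  have csq : Continuous fun z : ℝ × ℝ => 1 / 2 * z.1 ^ 2 := by fun_prop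
  have ca := ha.comp₂ ha (Φ := fun y _ => 1 / 2 * y ^ 2) csq
  have cg := ha.comp₂ hg (Φ := fun y z => y * z) (by fun_prop)
  have hasq : ∀ x, ‖x‖ ≤ 1 → ∀ t ∈ Icc (-1 : ℝ) 1, |1 / 2 * u x t ^ 2| ≤ N * (1 + w x t ^ p) := by
    intro x hx t ht
    have e1 := hwN x hx t ht
    have e2 := huw x t
    have e3 := hu0 x t
    have e4 := hww x t
    rw [abs_of_nonneg (by positivity)]
    nlinarith [mul_le_mul e1 e4 (hw0 x t) hN.le, mul_le_mul e2 e2 e3 (hw0 x t)]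
  have q1 := ca.tendsto_dint hab cφ.continuous z0 (continuous_dtcut (j + 1))
  have q2 := ca.tendsto_dint hab cφ.continuous_lap zl (continuous_tcut (j + 2))
  have q3 := cg.tendsto_dint hab cφ.continuous z0 (continuous_tcut (j + 2))
  have hq := hu.comp₂ hu (Φ := fun y _ => 1 / 2 * y ^ 2) csq
  have hg' := hu.comp₂ hF (Φ := fun y z => y * z) (by fun_prop)
  have t1 : ∀ t ∈ Icc (-1 : ℝ) 1, |dtcut (j + 1) t| ≤ 2 * (j + 5) * tcut j t := fun t ht => by
    have e1 := abs_dtcut_le (j + 1) ht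
    have e2 := tcut_le (show j ≤ j + 1 by omega) t
    push_cast at e1
    nlinarith [mul_nonneg (by positivity : (0:ℝ) ≤ j + 5) (sub_nonneg.2 e2)]
  have t2 : ∀ t ∈ Icc (-1 : ℝ) 1, |tcut (j + 2) t| ≤ 1 * tcut j t := fun t _ => by
    rw [abs_of_nonneg (tcut_nonneg _ _), one_mul]
    exact tcut_le (by omega) t
  have f1 : ∀ x : Eu n, |cut 1 x ^ (j + 5)| ≤ 1 * cut 1 x ^ (j + 3) := fun x => by
    rw [abs_of_nonneg (pow_nonneg (cut_nonneg _ _) _), one_mul]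
    exact cut_pow_le (by omega) x
  have f2 : ∀ x : Eu n, |lap (fun x : Eu n => cut 1 x ^ (j + 5)) x| ≤
      lapC n (j + 2) * cut 1 x ^ (j + 3) := fun x => by
    simpa using abs_lap_cut_pow one_pos (j + 2) x
  have hp0 : 0 < p := by linarith
  have b1 := (abs_le.1 (dint_le_wint hp0 hw hw0 hq (continuous_dtcut (j + 1)) cφ.continuous z0
    (by positivity) hN.le t1 f1 hasq)).2
  have b2 := (abs_le.1 (dint_le_wint hp0 hw hw0 hq (continuous_tcut (j + 2)) cφ.continuous_lap zl
    zero_le_one hN.le t2 f2 hasq)).2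
  have b3 := (abs_le.1 (dint_le_wint hp0 hw hw0 hg' (continuous_tcut (j + 2)) cφ.continuous z0
    zero_le_one hN.le t2 f1 (fun x hx t ht => by
      have e0 : 0 ≤ w x t ^ p := Real.rpow_nonneg (hw0 x t) _
      rw [abs_mul, abs_of_nonneg (hu0 x t)]
      refine mul_le_mul ((huw x t).trans (hwN x hx t ht)) ?_ (abs_nonneg _) hN.le
      linarith [hFw x t]))).2
  have hlim := (q1.add q2).add q3
  have hlt : 2 * ((j : ℝ) + 5) * 1 * N * wint n p j w + 1 * lapC n (j + 2) * N * wint n p j w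
      + 1 * 1 * N * wint n p j w < gradC n j * N * B := by
    have hNB : 0 < N * B := mul_pos hN hB
    have : (2 * ((j : ℝ) + 5) + lapC n (j + 2) + 1) * N * wint n p j w
        ≤ (2 * ((j : ℝ) + 5) + lapC n (j + 2) + 1) * N * B := by
      have := lapC_nonneg n (j + 2)
      gcongr
    unfold gradC
    linarith
  filter_upwards [hlim.eventually_lt_const ((add_le_add (add_le_add b1 b2) b3).trans_lt hlt)] with
      k hk
  rw [(h k).caccioppoli hab cφ z0 zl (hasDerivAt_tcut_succ (j + 1)) (continuous_dtcut (j + 1))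
    (tcut_neg_one _) (tcut_one _)]
  exact hk.le

end Approx

section EnergyEstimate

variable {n : ℕ}

theorem exists_nat_exponent {p : ℝ} (hp : 1 < p) : ∃ j : ℕ, (j : ℝ) + 3 ≤ p * (j + 1) := by
  obtain ⟨j, hj⟩ := exists_nat_ge (2 / (p - 1))
  rw [div_le_iff₀ (by linarith)] at hj
  exact ⟨j, by nlinarith⟩

theorem PowSol.exists_wint_le (n : ℕ) {p c : ℝ} {j : ℕ} (hp : 1 < p) (hc : 0 < c)
    (hj : (j : ℝ) + 3 ≤ p * (j + 1)) : ∃ B, 0 < B ∧ ∀ (w H : Eu n → ℝ → ℝ) (N : ℝ),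
      PowSol p c w H → (∀ x, ‖x‖ ≤ 2 → ∀ t ∈ Icc (-2 : ℝ) 2, w x t ≤ N) → wint n p j w ≤ B := by
  obtain ⟨A, hA⟩ := PowSol.exists_dint_le n hp hc hj
  refine ⟨2 * vb n 1 + |A| + 1, by have := vb_nonneg n 1; positivity, fun w H N h hb => ?_⟩
  have hab : (-1 : ℝ) ≤ 1 := by norm_num
  have hw : Bdd 1 (-1) 1 w := (h.reg hb).bdd.mono (by norm_num) (by norm_num) (by norm_num)
  have c2 : Continuous fun x : Eu n => cut 1 x ^ (j + 3) := (continuous_cut 1).pow _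
  have bt := bdd_time (n := n) (a := -1) (b := 1) (continuous_tcut j).continuousOn 1
  have l1 := ((bdd_space (continuous_const (y := (1 : ℝ))) 1 (-1) 1).mul_test c2
    (cut_pow_eq_zero (j + 2))).mul' bt
  have l2 := ((hw.rpow (by linarith : 0 < p)).mul_test c2 (cut_pow_eq_zero (j + 2))).mul' bt
  have e : wint n p j w = _ := (dint_congr hab fun x t _ => by ring).trans (dint_add hab l1 l2)
  have e1 := dint_le_vb hab l1 (M := 1) fun x _ t _ => by
    have h1 : tcut j t ≤ 1 := pow_le_one₀ (le_max_right _ _)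
      (max_le (by nlinarith [sq_nonneg t]) zero_le_one)
    have h2 : cut 1 x ^ (j + 3) ≤ 1 := pow_le_one₀ (cut_nonneg _ _) (cut_le_one _ _)
    rw [one_mul]
    exact mul_le_one₀ h1 (pow_nonneg (cut_nonneg _ _) _) h2
  have e2 := hA w H N h hb
  have := le_abs_self A
  rw [e]
  linarith

theorem SmoothSol.dint_test_le {a g b k : Eu n → ℝ → ℝ} (ha : SmoothSol 1 (-1) 1 a g)
    (hb : SmoothSol 1 (-1) 1 b k) (i j : ℕ) {φ : Eu n → ℝ} (hφ : Continuous φ)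
    (h0 : ∀ x, 1 / 2 < ‖x‖ → φ x = 0) {θ θ' : ℝ → ℝ} (hθ : ∀ t, HasDerivAt θ (θ' t) t)
    (hθ' : Continuous θ') (hθ0 : ∀ t, 1 / 2 ≤ |t| → θ t = 0) {s : ℝ} (hs : 0 < s) :
    |dint (-1) 1 fun x t => θ' t * ((a x t + b x t) * φ x)| ≤
      s * (((3 / 4 : ℝ) ^ (i + 3 + (j + 3)))⁻¹ *
        (dint (-1) 1 (fun x t => tcut i t * (rate a g x t ^ 2 * cut 1 x ^ (j + 3)))
        + dint (-1) 1 (fun x t => tcut i t * (rate b k x t ^ 2 * cut 1 x ^ (j + 3)))))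
      + s⁻¹ * dint (-1) 1 fun x t => θ t ^ 2 * φ x ^ 2 := by
  have hab : (-1 : ℝ) ≤ 1 := by norm_num
  have hθc : Continuous θ := continuous_iff_continuousAt.2 fun t => (hθ t).continuousAt
  have z : ∀ x, 1 < ‖x‖ → φ x = 0 := fun x hx => h0 x (by linarith)
  have c2 : Continuous fun x : Eu n => cut 1 x ^ (j + 3) := (continuous_cut 1).pow _
  have bi := bdd_time (n := n) (a := -1) (b := 1) (continuous_tcut i).continuousOn 1
  have bt := bdd_time (n := n) (a := -1) (b := 1) hθc.continuousOn 1
  have bt2 := bdd_time (n := n) (a := -1) (b := 1) (hθc.pow 2).continuousOn 1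
  have key := (ha.bdd.add hb.bdd).dint_deriv hab (ha.bdd_rate.add hb.bdd_rate)
    (fun x hx t ht => (ha.deriv x hx t (Ioo_subset_Icc_self ht)).add
      (hb.deriv x hx t (Ioo_subset_Icc_self ht))) hφ z hθ hθ' (hθ0 _ (by norm_num))
    (hθ0 _ (by norm_num))
  have l := ((ha.bdd_rate.add hb.bdd_rate).mul_test hφ z).mul' bt
  have l1 := ((ha.bdd_rate.pow 2).mul_test c2 (cut_pow_eq_zero (j + 2))).mul' bi
  have l2 := ((hb.bdd_rate.pow 2).mul_test c2 (cut_pow_eq_zero (j + 2))).mul' bi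
  have l3 : Loc 1 (-1) 1 fun (x : Eu n) t => θ t ^ 2 * φ x ^ 2 :=
    ⟨bt2.mul (bdd_space (hφ.pow 2) 1 (-1) 1), fun x hx t _ => by simp [z x hx]⟩
  rw [key, abs_neg]
  refine (abs_dint_le hab l).trans ?_
  rw [← dint_add hab l1 l2, ← mul_assoc, ← dint_const_mul, ← dint_const_mul,
    ← dint_add hab ((l1.add l2).const_mul _) (l3.const_mul _)]
  refine dint_mono hab l.abs (((l1.add l2).const_mul _).add (l3.const_mul _)) fun x t ht => ?_
  set A := rate a g x t
  set B := rate b k x t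
  set m := cut 1 x with hm
  have hm0 : 0 ≤ m := cut_nonneg 1 x
  have hti := tcut_nonneg i t
  have hrhs : 0 ≤ s * ((3 / 4 : ℝ) ^ (i + 3 + (j + 3)))⁻¹ *
      (tcut i t * (A ^ 2 * m ^ (j + 3)) + tcut i t * (B ^ 2 * m ^ (j + 3)))
      + s⁻¹ * (θ t ^ 2 * φ x ^ 2) := by positivity
  by_cases hz : θ t * φ x = 0
  · rw [show θ t * ((A + B) * φ x) = θ t * φ x * (A + B) by ring, hz, zero_mul, abs_zero]
    exact hrhs
  obtain ⟨hz1, hz2⟩ := mul_ne_zero_iff.1 hz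
  have hx : ‖x‖ ≤ 1 / 2 := by
    by_contra h; exact hz2 (h0 x (not_le.1 h))
  have htt : |t| < 1 / 2 := by
    by_contra h; exact hz1 (hθ0 t (not_lt.1 h))
  have e1 : (3 / 4 : ℝ) ≤ m := by
    have := le_cut one_pos (q := 1 / 2) (x := x) (by linarith)
    norm_num at this ⊢; exact this
  have e2 : (3 / 4 : ℝ) ^ (i + 3) ≤ tcut i t := by
    refine pow_le_pow_left₀ (by norm_num) (le_max_of_le_left ?_) _
    have := sq_abs t
    nlinarith [abs_nonneg t]
  have e3 : (3 / 4 : ℝ) ^ (i + 3 + (j + 3)) ≤ tcut i t * m ^ (j + 3) := by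
    rw [pow_add]; gcongr
  have e4 : 1 ≤ ((3 / 4 : ℝ) ^ (i + 3 + (j + 3)))⁻¹ * (tcut i t * m ^ (j + 3)) := by
    rw [inv_mul_eq_div, le_div_iff₀ (by positivity), one_mul]; exact e3
  have e5 : |θ t * ((A + B) * φ x)| ≤ s * (A ^ 2 + B ^ 2) + s⁻¹ * (θ t ^ 2 * φ x ^ 2) := by
    have hss : s * s⁻¹ = 1 := mul_inv_cancel₀ hs.ne'
    have hsi : 0 < s⁻¹ := inv_pos.2 hs
    set P := θ t * φ x
    have : θ t ^ 2 * φ x ^ 2 = P ^ 2 := by ring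
    rw [this, show θ t * ((A + B) * φ x) = P * (A + B) by ring, abs_le]
    have q : ∀ y : ℝ, y * (A + B) ≤ s * (A ^ 2 + B ^ 2) + s⁻¹ * y ^ 2 := by
      intro y
      have h1 : 0 ≤ s * (1 / 2 * (A + B) - s⁻¹ * y) ^ 2 := by positivity
      have h2 : s * (1 / 2 * (A + B) - s⁻¹ * y) ^ 2 = s / 4 * (A + B) ^ 2 - s * s⁻¹ * (y * (A + B))
        + s * s⁻¹ * (s⁻¹ * y ^ 2) := by ring
      rw [hss] at h2
      nlinarith [mul_nonneg hs.le (sq_nonneg (A - B)), mul_nonneg hs.le (sq_nonneg A),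
        mul_nonneg hs.le (sq_nonneg B)]
    have q1 := q P
    have q2 := q (-P)
    constructor
    · rw [neg_sq] at q2; linarith
    · exact q1
  have e6 := mul_le_mul_of_nonneg_left e4 (by positivity : 0 ≤ s * (A ^ 2 + B ^ 2))
  linarith

/-- The local energy estimate: time derivatives are controlled in a negative norm, linearly in
the supremum of the solution. -/
theorem Sol.exists_energy_le (n : ℕ) {r lam : ℝ} (hr : 0 < r) (h0 : 0 ≤ lam) (h1 : lam < 1) :
    ∃ C, 0 < C ∧ ∀ (u v : Eu n → ℝ → ℝ) (N : ℝ), 0 < N → Sol r lam u v →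
      (∀ x, ‖x‖ ≤ 2 → ∀ t ∈ Icc (-2 : ℝ) 2, u x t + v x t ≤ N) →
      ∀ (φ : Eu n → ℝ) (θ θ' : ℝ → ℝ), Continuous φ → (∀ x, 1 / 2 < ‖x‖ → φ x = 0) →
      (∀ t, HasDerivAt θ (θ' t) t) → Continuous θ' → (∀ t, 1 / 2 ≤ |t| → θ t = 0) →
      ∀ s, 0 < s → |dint (-1) 1 fun x t => θ' t * ((u x t + v x t) * φ x)| ≤
        s * (C * N) + s⁻¹ * dint (-1) 1 fun x t => θ t ^ 2 * φ x ^ 2 := by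
  have hp : 1 < 2 * r + 1 := by linarith
  obtain ⟨j, hj⟩ := exists_nat_exponent hp
  obtain ⟨B, hB, hWB⟩ := PowSol.exists_wint_le n hp
    (div_pos (sub_pos.2 h1) (by positivity : (0:ℝ) < 2 ^ (2 * r + 1))) hj
  set D := ((3 / 4 : ℝ) ^ (j + 2 + 2 + 3 + (j + 4 + 3)))⁻¹ with hD
  set c1 : ℝ := ((j + 2 : ℕ) + 5) + 4 * ((j + 2 : ℕ) + 5) ^ 2 with hc1
  have hc1p : 0 < c1 := by positivity
  have hgC : 0 < gradC n j := by
    have := lapC_nonneg n (j + 2); unfold gradC; positivity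
  set E := 2 * (2 * (c1 * (gradC n j * B)) + 2 + (2 * (j + 7) * B + 1)) with hE
  refine ⟨D * E, by positivity, fun u v N hN h hb φ θ θ' hφ hφ0 hθ hθ' hθ0 s hs => ?_⟩
  have hab : (-1 : ℝ) ≤ 1 := by norm_num
  have hps := h.powSol hr h0 h1
  have hwint := hWB _ _ N hps hb
  have hu : Reg 2 (-2) 2 N u := ⟨fun t => (h.left.cx t).continuous, fun x =>
      (h.left.ct x).continuous,
    fun x hx t ht => by
      rw [abs_of_nonneg (h.nonneg_left x t)]
      linarith [hb x hx t ht, h.nonneg_right x t]⟩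
  have hv : Reg 2 (-2) 2 N v := ⟨fun t => (h.right.cx t).continuous,
    fun x => (h.right.ct x).continuous, fun x hx t ht => by
      rw [abs_of_nonneg (h.nonneg_right x t)]
      linarith [hb x hx t ht, h.nonneg_left x t]⟩
  have hnl : ∀ a b, 0 ≤ a → 0 ≤ b → a + b ≤ N → |nl r lam a b| ≤ N ^ (2 * r + 1) :=
    fun a b ha hb hab => (abs_nl_le hr h0 h1 ha hb).trans (by gcongr)
  have hF : Reg 2 (-2) 2 (N ^ (2 * r + 1)) fun x t => nl r lam (u x t) (v x t) :=
    ⟨h.left.gx, h.left.gt, fun x hx t ht => hnl _ _ (h.nonneg_left x t) (h.nonneg_right x t)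
      (hb x hx t ht)⟩
  have hG : Reg 2 (-2) 2 (N ^ (2 * r + 1)) fun x t => nl r lam (v x t) (u x t) :=
    ⟨h.right.gx, h.right.gt, fun x hx t ht => hnl _ _ (h.nonneg_right x t) (h.nonneg_left x t)
      (by linarith [hb x hx t ht])⟩
  choose κ hκ using fun k : ℕ => exists_isMoll n (ε := 1 / ((k : ℝ) + 2)) (by positivity)
  have hε : Tendsto (fun k : ℕ => 1 / ((k : ℝ) + 2)) atTop (𝓝 0) :=
    tendsto_const_nhds.div_atTop (tendsto_natCast_atTop_atTop.atTop_add tendsto_const_nhds)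
  have hε2 : ∀ k : ℕ, 1 / ((k : ℝ) + 2) ≤ 1 / 2 := fun k =>
    one_div_le_one_div_of_le (by norm_num) (by linarith [(Nat.cast_nonneg k : (0:ℝ) ≤ k)])
  have conv : ∀ {M : ℝ} {f : Eu n → ℝ → ℝ}, Reg 2 (-2) 2 M f →
      Conv 1 (-1) 1 (fun k x t => mol (κ k) (fun y => f y t) x) f := fun hf =>
    hf.conv_mol hκ hε (fun k => by linarith [hε2 k]) (by norm_num) (by norm_num)
  set a : ℕ → Eu n → ℝ → ℝ := fun k x t => mol (κ k) (fun y => u y t) x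
  set b : ℕ → Eu n → ℝ → ℝ := fun k x t => mol (κ k) (fun y => v y t) x
  set g : ℕ → Eu n → ℝ → ℝ := fun k x t => mol (κ k) (fun y => nl r lam (u y t) (v y t)) x
  set q : ℕ → Eu n → ℝ → ℝ := fun k x t => mol (κ k) (fun y => nl r lam (v y t) (u y t)) x
  have sa : ∀ k, SmoothSol 1 (-1) 1 (a k) (g k) := fun k =>
    (h.left.weakEq' hu hF).smoothSol_mol hu hF (hκ k) (by linarith [hε2 k]) (by norm_num)
      (by norm_num)
  have sb : ∀ k, SmoothSol 1 (-1) 1 (b k) (q k) := fun k =>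
    (h.right.weakEq' hv hG).smoothSol_mol hv hG (hκ k) (by linarith [hε2 k]) (by norm_num)
      (by norm_num)
  have ca : Conv 1 (-1) 1 a u := conv hu
  have cb : Conv 1 (-1) 1 b v := conv hv
  have cg : Conv 1 (-1) 1 g _ := conv hF
  have cq : Conv 1 (-1) 1 q _ := conv hG
  have mono1 : ∀ {f : Eu n → ℝ → ℝ}, Bdd 2 (-2) 2 f → Bdd 1 (-1) 1 f := fun hf =>
    hf.mono (by norm_num) (by norm_num) (by norm_num)
  have hw : Bdd 1 (-1) 1 fun x t => u x t + v x t := mono1 (hps.reg hb).bdd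
  have hwN : ∀ x, ‖x‖ ≤ 1 → ∀ t ∈ Icc (-1 : ℝ) 1, u x t + v x t ≤ N := fun x hx t ht =>
    hb x (by linarith) t ⟨by linarith [ht.1], by linarith [ht.2]⟩
  have ga := SmoothSol.dint_gsq_eventually hp hN hB sa ca cg (mono1 hu.bdd) (mono1 hF.bdd) hw
    h.nonneg_left (fun x t => by linarith [h.nonneg_right x t])
    (fun x t => abs_nl_le hr h0 h1 (h.nonneg_left x t) (h.nonneg_right x t)) hwN hwint
  have gb := SmoothSol.dint_gsq_eventually hp hN hB sb cb cq (mono1 hv.bdd) (mono1 hG.bdd) hw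
    h.nonneg_right (fun x t => by linarith [h.nonneg_left x t])
    (fun x t => by
      rw [add_comm]; exact abs_nl_le hr h0 h1 (h.nonneg_right x t) (h.nonneg_left x t)) hwN hwint
  have c5 : Continuous fun x : Eu n => cut 1 x ^ (j + 2 + 5) := (continuous_cut 1).pow _
  have z5 : ∀ x : Eu n, 1 < ‖x‖ → cut 1 x ^ (j + 2 + 5) = 0 := cut_pow_eq_zero (j + 6)
  have cnl := continuous_nl (X := ℝ × ℝ) hr lam continuous_fst continuous_snd
  have sqd : Continuous fun z : ℝ × ℝ => (z.1 - z.2) ^ 2 := by fun_prop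
  have ma := ca.comp₂ cb (Φ := fun y z => nl r lam y z) cnl
  have mb := cb.comp₂ ca (Φ := fun y z => nl r lam y z) cnl
  have da := (cg.comp₂ ma (Φ := fun y z => (y - z) ^ 2) sqd).tendsto_dint hab c5 z5
    (continuous_tcut (j + 2 + 2))
  have db := (cq.comp₂ mb (Φ := fun y z => (y - z) ^ 2) sqd).tendsto_dint hab c5 z5
    (continuous_tcut (j + 2 + 2))
  have dz : dint (-1) 1 (fun (_ : Eu n) (_ : ℝ) => (0 : ℝ)) = 0 := by simp [dint]
  simp only [sub_self, ne_eq, OfNat.ofNat_ne_zero, not_false_eq_true, zero_pow, zero_mul, mul_zero,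
    dz] at da db
  have dp := ((ca.comp₂ cb (Φ := fun y z => pot r lam y z) (continuous_pot hr lam)).tendsto_dint hab
    c5 z5 (continuous_dtcut (j + 2 + 1))).abs
  have hpb := dint_le_wint (j := j) (p := 2 * r + 1) (by linarith) hw hps.nonneg (f := fun x t =>
    pot r lam (u x t) (v x t)) ((mono1 hu.bdd).comp₂ (mono1 hv.bdd) (continuous_pot hr lam))
    (continuous_dtcut (j + 2 + 1)) c5 z5 (c := 2 * (j + 7)) (d := 1) (by positivity) hN.le
    (fun t ht => by
      have e1 := abs_dtcut_le (j + 2 + 1) ht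
      have e2 := tcut_le (show j ≤ j + 2 + 1 by omega) t
      push_cast at e1
      nlinarith [mul_nonneg (by positivity : (0:ℝ) ≤ j + 7) (sub_nonneg.2 e2)])
    (fun x => by
      rw [abs_of_nonneg (pow_nonneg (cut_nonneg _ _) _), one_mul]
      exact cut_pow_le (by omega) x)
    (fun x hx t ht => by
      refine (abs_pot_le hr h0 h1 (h.nonneg_left x t) (h.nonneg_right x t)).trans ?_
      have := Real.rpow_nonneg (hps.nonneg x t) (2 * r + 1)
      exact mul_le_mul (hwN x hx t ht) (by linarith) this hN.le)
  have hpb' : 2 * ((j : ℝ) + 7) * 1 * N * wint n (2 * r + 1) j (fun x t => u x t + v x t)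
      < (2 * (j + 7) * B + 1) * N := by
    have : 2 * ((j : ℝ) + 7) * N * wint n (2 * r + 1) j (fun x t => u x t + v x t)
      ≤ 2 * ((j : ℝ) + 7) * N * B := by gcongr
    linarith
  have hlim := ((ca.comp₂ cb (Φ := fun y z => y + z) (by fun_prop)).tendsto_dint hab hφ
    (fun x hx => hφ0 x (by linarith)) hθ').abs
  refine le_of_tendsto hlim ?_
  filter_upwards [ga, gb, da.eventually_lt_const hN, db.eventually_lt_const hN,
    dp.eventually_lt_const (hpb.trans_lt hpb')] with k k1 k2 k3 k4 k5
  have ea := (sa k).energy_le (j + 2) (ma.bdd k)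
  have eb := (sb k).energy_le (j + 2) (mb.bdd k)
  have ep := (((sa k).bdd.comp₂ (sb k).bdd (continuous_pot hr lam))).dint_deriv hab
    (((ma.bdd k).mul (sa k).bdd_rate).add ((mb.bdd k).mul (sb k).bdd_rate))
    (fun x hx t ht => hasDerivAt_pot hr lam ((sa k).deriv x hx t (Ioo_subset_Icc_self ht))
      ((sb k).deriv x hx t (Ioo_subset_Icc_self ht))) c5 z5 (hasDerivAt_tcut_succ (j + 2 + 1))
    (continuous_dtcut _) (tcut_neg_one _) (tcut_one _)
  have bt := bdd_time (n := n) (a := -1) (b := 1) (continuous_tcut (j + 2 + 2)).continuousOn 1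
  have ep2 := dint_add hab ((((ma.bdd k).mul (sa k).bdd_rate).mul_test c5 z5).mul' bt)
    ((((mb.bdd k).mul (sb k).bdd_rate).mul_test c5 z5).mul' bt)
  have ep3 : dint (-1) 1 (fun x t => tcut (j + 2 + 2) t * ((nl r lam (a k x t) (b k x t) *
      rate (a k) (g k) x t + nl r lam (b k x t) (a k x t) * rate (b k) (q k) x t) *
        cut 1 x ^ (j + 2 + 5))) = _ := (dint_congr hab fun x t _ => by ring).trans ep2
  have e5 := (abs_lt.1 k5).1
  have fin := (sa k).dint_test_le (sb k) (j + 2 + 2) (j + 4) hφ hφ0 hθ hθ' hθ0 hs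
  refine fin.trans (add_le_add (mul_le_mul_of_nonneg_left ?_ hs.le) le_rfl)
  rw [← hD, mul_assoc]
  refine mul_le_mul_of_nonneg_left ?_ (by positivity)
  have k1' := mul_le_mul_of_nonneg_left k1 hc1p.le
  have k2' := mul_le_mul_of_nonneg_left k2 hc1p.le
  rw [hE]
  simp only [← hc1] at ea eb
  linarith

end EnergyEstimate

section Chi

/-- A smooth convex function vanishing on the negative half-line and of slope one near infinity. -/
noncomputable def chi (q : ℝ) : ℝ := ∫ x in (0:ℝ)..q, Real.smoothTransition x

theorem hasDerivAt_chi (q : ℝ) : HasDerivAt chi (Real.smoothTransition q) q :=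
  intervalIntegral.integral_hasDerivAt_right
    (Real.smoothTransition.continuous.intervalIntegrable _ _)
    (Real.smoothTransition.continuous.stronglyMeasurableAtFilter _ _)
    Real.smoothTransition.continuous.continuousAt

theorem deriv_chi : deriv chi = Real.smoothTransition := funext fun q => (hasDerivAt_chi q).deriv

theorem contDiff_chi : ContDiff ℝ 2 chi := by
  rw [show (2 : WithTop ℕ∞) = 1 + 1 by norm_num, contDiff_succ_iff_deriv]
  refine ⟨fun q => (hasDerivAt_chi q).differentiableAt, by simp, ?_⟩
  rw [deriv_chi]
  exact Real.smoothTransition.contDiff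

theorem chi_eq_zero {q : ℝ} (hq : q ≤ 0) : chi q = 0 := by
  unfold chi
  rw [intervalIntegral.integral_congr (g := fun _ => 0), intervalIntegral.integral_zero]
  intro x hx
  rw [uIcc_of_ge hq] at hx
  exact Real.smoothTransition.zero_of_nonpos hx.2

theorem chi_nonneg (q : ℝ) : 0 ≤ chi q := by
  rcases le_total q 0 with h | h
  · rw [chi_eq_zero h]
  · exact intervalIntegral.integral_nonneg h fun x _ => Real.smoothTransition.nonneg x

theorem monotone_chi : Monotone chi :=
  monotone_of_deriv_nonneg (fun q => (hasDerivAt_chi q).differentiableAt) fun q => by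
    rw [deriv_chi]; exact Real.smoothTransition.nonneg q

theorem chi_le {q : ℝ} (hq : 0 ≤ q) : chi q ≤ q := by
  have := intervalIntegral.integral_mono_on (μ := volume) hq
    (Real.smoothTransition.continuous.intervalIntegrable 0 q)
    (continuous_const.intervalIntegrable 0 q) fun x _ => Real.smoothTransition.le_one x
  simpa [chi] using this

theorem le_chi (q : ℝ) : q - 1 ≤ chi q := by
  rcases le_total q 1 with h | h
  · linarith [chi_nonneg q]
  · have h1 : chi 1 + ∫ x in (1:ℝ)..q, Real.smoothTransition x = chi q :=
      intervalIntegral.integral_add_adjacent_intervals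
        (Real.smoothTransition.continuous.intervalIntegrable _ _)
        (Real.smoothTransition.continuous.intervalIntegrable _ _)
    have h2 : ∫ x in (1:ℝ)..q, Real.smoothTransition x = ∫ _ in (1:ℝ)..q, (1:ℝ) := by
      refine intervalIntegral.integral_congr fun x hx => ?_
      rw [uIcc_of_le h] at hx
      exact Real.smoothTransition.one_of_one_le hx.1
    rw [intervalIntegral.integral_const, smul_eq_mul, mul_one] at h2
    linarith [chi_nonneg 1]

theorem chi_pos {q : ℝ} (hq : 0 < q) : 0 < chi q :=
  intervalIntegral.intervalIntegral_pos_of_pos_on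
    (Real.smoothTransition.continuous.intervalIntegrable _ _)
    (fun _ hx => Real.smoothTransition.pos_of_pos hx.1) hq

theorem deriv_smoothTransition_nonneg (q : ℝ) : 0 ≤ deriv Real.smoothTransition q :=
  Real.smoothTransition.monotone.deriv_nonneg

theorem continuous_deriv_smoothTransition : Continuous (deriv Real.smoothTransition) :=
  (Real.smoothTransition.contDiff (n := 1)).continuous_deriv le_rfl

theorem exists_deriv_smoothTransition_le : ∃ C, 0 ≤ C ∧ ∀ q, deriv Real.smoothTransition q ≤ C ∧
    (q < 0 ∨ 1 < q → deriv Real.smoothTransition q = 0) := by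
  obtain ⟨C, hC⟩ := (isCompact_Icc (a := (0:ℝ)) (b := 1)).exists_bound_of_continuousOn
    continuous_deriv_smoothTransition.continuousOn
  have h0 : ∀ q : ℝ, q < 0 ∨ 1 < q → deriv Real.smoothTransition q = 0 := by
    rintro q (h | h)
    · have : Real.smoothTransition =ᶠ[𝓝 q] fun _ => 0 := by
        filter_upwards [Iio_mem_nhds h] with x hx using
          Real.smoothTransition.zero_of_nonpos (le_of_lt hx)
      rw [this.deriv_eq]; simp
    · have : Real.smoothTransition =ᶠ[𝓝 q] fun _ => 1 := by
        filter_upwards [Ioi_mem_nhds h] with x hx using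
          Real.smoothTransition.one_of_one_le (le_of_lt hx)
      rw [this.deriv_eq]; simp
  have hC0 : 0 ≤ C := (norm_nonneg _).trans (hC 0 ⟨le_rfl, zero_le_one⟩)
  refine ⟨C, hC0, fun q => ⟨?_, h0 q⟩⟩
  by_cases hq : q < 0 ∨ 1 < q
  · rw [h0 q hq]; exact hC0
  · push Not at hq
    exact (le_abs_self _).trans (hC q hq)

end Chi

section HeatKernel

variable {n : ℕ}

/-- The heat kernel of `ℝⁿ` as a function of the squared distance and of time. -/
noncomputable def gk (n : ℕ) (ρ σ : ℝ) : ℝ :=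
  (4 * Real.pi * σ) ^ (-((n : ℝ) / 2)) * Real.exp (-ρ / (4 * σ))

theorem gk_pos (n : ℕ) (ρ : ℝ) {σ : ℝ} (hσ : 0 < σ) : 0 < gk n ρ σ :=
  mul_pos (Real.rpow_pos_of_pos (by positivity) _) (Real.exp_pos _)

theorem hasDerivAt_gk_left (n : ℕ) (ρ σ : ℝ) :
    HasDerivAt (fun ρ => gk n ρ σ) (-(gk n ρ σ / (4 * σ))) ρ := by
  have := (((hasDerivAt_id ρ).neg.div_const (4 * σ)).exp).const_mul
    ((4 * Real.pi * σ) ^ (-((n : ℝ) / 2)))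
  refine this.congr_deriv ?_
  simp only [gk, id, Pi.neg_apply]
  ring

theorem hasDerivAt_gk_right (n : ℕ) (ρ : ℝ) {σ : ℝ} (hσ : 0 < σ) :
    HasDerivAt (gk n ρ) (gk n ρ σ * (-(n / (2 * σ)) + ρ / (4 * σ ^ 2))) σ := by
  have hb : 4 * Real.pi * σ ≠ 0 := by positivity
  have h1 := ((hasDerivAt_id σ).const_mul (4 * Real.pi)).rpow_const
    (p := -((n : ℝ) / 2)) (Or.inl hb)
  have h2 := ((hasDerivAt_const σ (-ρ)).div ((hasDerivAt_id σ).const_mul 4)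
    (by simpa using hσ.ne')).exp
  refine (h1.mul h2).congr_deriv ?_
  simp only [gk, id, Pi.div_apply]
  rw [Real.rpow_sub_one hb]
  field_simp
  ring

theorem contDiff_gk_left (n : ℕ) (σ : ℝ) : ContDiff ℝ 2 fun ρ => gk n ρ σ := by
  unfold gk
  fun_prop

theorem gk_anti (n : ℕ) {ρ ρ' σ : ℝ} (hσ : 0 < σ) (h : ρ ≤ ρ') : gk n ρ' σ ≤ gk n ρ σ := by
  unfold gk
  gcongr

theorem integral_gk (n : ℕ) {σ : ℝ} (hσ : 0 < σ) : ∫ x : Eu n, gk n (‖x‖ ^ 2) σ = 1 := by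
  unfold gk
  rw [integral_const_mul]
  have h := GaussianFourier.integral_rexp_neg_mul_sq_norm (V := Eu n) (b := 1 / (4 * σ))
    (by positivity)
  have e : ∀ x : Eu n, Real.exp (-(1 / (4 * σ)) * ‖x‖ ^ 2) = Real.exp (-‖x‖ ^ 2 / (4 * σ)) :=
    fun x => by congr 1; ring
  simp only [e] at h
  rw [h, finrank_euclideanSpace, Fintype.card_fin, show Real.pi / (1 / (4 * σ)) = 4 * Real.pi * σ by
    field_simp, ← Real.rpow_add (by positivity)]
  simp

theorem gk_sq (n : ℕ) (ρ : ℝ) {σ : ℝ} (hσ : 0 < σ) :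
    gk n ρ σ ^ 2 = ((4 * Real.pi * σ) ^ n)⁻¹ * Real.exp (-ρ / (2 * σ)) := by
  unfold gk
  rw [mul_pow, ← Real.rpow_natCast _ 2, ← Real.rpow_mul (by positivity), ← Real.exp_nat_mul,
    ← Real.rpow_natCast _ n, ← Real.rpow_neg (by positivity)]
  congr 2
  · push_cast; ring
  · push_cast; field_simp; ring

theorem exists_gk_div_sq_le (n k : ℕ) {a : ℝ} (ha : 0 < a) :
    ∃ C, 0 ≤ C ∧ ∀ ρ σ, a ≤ ρ → 0 < σ → (gk n ρ σ / σ ^ k) ^ 2 ≤ C := by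
  refine ⟨(n + 2 * k).factorial * (2 / a) ^ (n + 2 * k), by positivity, fun ρ σ hρ hσ => ?_⟩
  set m := n + 2 * k
  have hz : 0 ≤ a / (2 * σ) := by positivity
  have h1 := Real.pow_div_factorial_le_exp _ hz m
  have hpi : (1:ℝ) ≤ (4 * Real.pi) ^ n := one_le_pow₀ (by linarith [Real.pi_gt_three])
  have h2 : Real.exp (-ρ / (2 * σ)) ≤ Real.exp (-(a / (2 * σ))) := by
    refine Real.exp_le_exp.2 ?_
    rw [neg_div]
    gcongr
  have h3 : Real.exp (-(a / (2 * σ))) ≤ m.factorial * (2 / a) ^ m * σ ^ m := by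
    rw [Real.exp_neg]
    refine inv_le_of_inv_le₀ (by positivity) (le_trans (le_of_eq ?_) h1)
    rw [mul_assoc, ← mul_pow, mul_inv, ← inv_pow, div_eq_mul_inv _ (m.factorial : ℝ), mul_comm]
    congr 2
    field_simp
  rw [div_pow, gk_sq n ρ hσ, div_le_iff₀ (by positivity), mul_pow _ σ, mul_inv, ← pow_mul]
  have h4 : σ ^ m = σ ^ n * σ ^ (k * 2) := by rw [← pow_add]; congr 1; omega
  calc ((4 * Real.pi) ^ n)⁻¹ * (σ ^ n)⁻¹ * Real.exp (-ρ / (2 * σ))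
      ≤ 1 * (σ ^ n)⁻¹ * (m.factorial * (2 / a) ^ m * σ ^ m) := by
        gcongr
        · exact inv_le_one_of_one_le₀ hpi
        · exact h2.trans h3
    _ = m.factorial * (2 / a) ^ m * σ ^ (k * 2) := by
        rw [h4]; field_simp

theorem gk_rescale (n : ℕ) (ρ : ℝ) {c : ℝ} (hc : 0 < c) :
    gk n ρ (1 / c ^ 2) = c ^ n * gk n (c ^ 2 * ρ) 1 := by
  unfold gk
  rw [show 4 * Real.pi * (1 / c ^ 2) = (4 * Real.pi * 1) * (c ^ 2)⁻¹ by ring,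
    Real.mul_rpow (by positivity) (by positivity), Real.inv_rpow (by positivity),
    ← Real.rpow_neg (by positivity), neg_neg, ← Real.rpow_natCast c 2, ← Real.rpow_mul hc.le,
    show ((2:ℕ):ℝ) * ((n:ℝ) / 2) = (n:ℝ) by push_cast; ring, Real.rpow_natCast,
    Real.rpow_natCast, mul_comm (_ ^ _) (c ^ n), mul_assoc]
  congr 3
  field_simp

theorem tendsto_integral_mul_gk {f : Eu n → ℝ} (hf : Integrable f) (hc : ContinuousAt f 0) :
    Tendsto (fun c : ℝ => ∫ x, f x * gk n (‖x‖ ^ 2) (1 / c ^ 2)) atTop (𝓝 (f 0)) := by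
  obtain ⟨C, hC0, hC⟩ := exists_gk_div_sq_le n 0 one_pos
  have hlim : Tendsto (fun x : Eu n => ‖x‖ ^ Module.finrank ℝ (Eu n) * gk n (‖x‖ ^ 2) 1)
      (Bornology.cobounded (Eu n)) (𝓝 0) := by
    rw [finrank_euclideanSpace, Fintype.card_fin]
    have h1 : Tendsto (fun s : ℝ => s ^ n * Real.exp (-(1/4) * s ^ 2)) atTop (𝓝 0) := by
      have h := (rpow_mul_exp_neg_mul_sq_isLittleO_exp_neg (b := 1/4) (by norm_num)
        (n : ℝ))
      have h' := h.isBigO.trans_tendsto ((Real.tendsto_exp_atBot.comp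
        (tendsto_id.const_mul_atTop_of_neg (by norm_num : (-(1/2) : ℝ) < 0))))
      simpa using h'
    have h2 := (h1.const_mul ((4 * Real.pi * 1) ^ (-((n : ℝ) / 2)))).comp
      (tendsto_norm_cobounded_atTop (E := Eu n))
    rw [mul_zero] at h2
    refine h2.congr fun x => ?_
    simp only [Function.comp, gk]
    rw [show -‖x‖ ^ 2 / (4 * 1) = -(1/4) * ‖x‖ ^ 2 by ring]
    ring
  have h := tendsto_integral_comp_smul_smul_of_integrable (μ := volume)
    (φ := fun x : Eu n => gk n (‖x‖ ^ 2) 1)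
    (fun x => (gk_pos n _ one_pos).le) (integral_gk n one_pos) hlim hf hc
  refine h.congr' ?_
  filter_upwards [eventually_gt_atTop 0] with c hc0
  refine integral_congr_ae (Eventually.of_forall fun x => ?_)
  simp only [smul_eq_mul]
  rw [gk_rescale n _ hc0, norm_smul, Real.norm_of_nonneg hc0.le, mul_pow, finrank_euclideanSpace,
    Fintype.card_fin, mul_comm]

theorem gk_le_of_le (n : ℕ) {ρ σ τ : ℝ} (hσ : 0 < σ) (hστ : σ ≤ τ) (hρ : 2 * n * τ ≤ ρ) :
    gk n ρ σ ≤ gk n ρ τ := by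
  have hτ : 0 < τ := hσ.trans_le hστ
  have hz : 0 < τ / σ := by positivity
  have h1 : (τ / σ) ^ ((n : ℝ) / 2) ≤ Real.exp (ρ / (4 * τ) * (τ / σ - 1)) := by
    calc (τ / σ) ^ ((n : ℝ) / 2) ≤ Real.exp (τ / σ - 1) ^ ((n : ℝ) / 2) := by
          gcongr
          linarith [Real.add_one_le_exp (τ / σ - 1)]
      _ = Real.exp ((τ / σ - 1) * (n / 2)) := (Real.exp_mul _ _).symm
      _ ≤ _ := by
          refine Real.exp_le_exp.2 ?_
          rw [mul_comm]
          have : (1:ℝ) ≤ τ / σ := by rwa [one_le_div hσ]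
          refine mul_le_mul_of_nonneg_right ?_ (by linarith)
          rw [div_le_div_iff₀ two_pos (by positivity)]
          nlinarith
  unfold gk
  rw [show -ρ / (4 * τ) = ρ / (4 * τ) * (τ / σ - 1) + -ρ / (4 * σ) by field_simp; ring,
    Real.exp_add, ← mul_assoc]
  gcongr
  have h2 : (4 * Real.pi * σ) ^ (-((n:ℝ) / 2))
      = (4 * Real.pi * τ) ^ (-((n:ℝ) / 2)) * (τ / σ) ^ ((n:ℝ) / 2) := by
    rw [show 4 * Real.pi * σ = 4 * Real.pi * τ * (τ / σ)⁻¹ by field_simp,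
      Real.mul_rpow (by positivity) (by positivity), Real.inv_rpow hz.le, Real.rpow_neg hz.le,
      inv_inv]
  rw [h2]
  exact mul_le_mul_of_nonneg_left h1 (by positivity)

end HeatKernel

section Bump

variable {n : ℕ}

/-- A heat kernel with pole at time `t₀`, corrected by affine functions of `|x|²` and time. -/
noncomputable def kq (n : ℕ) (t₀ b B D ρ t : ℝ) : ℝ :=
  gk n ρ (t₀ - t) + b - B * ρ - D * (t₀ - t)

/-- The time derivative of `kq`. -/
noncomputable def kq' (n : ℕ) (t₀ D ρ t : ℝ) : ℝ :=
  gk n ρ (t₀ - t) * (n / (2 * (t₀ - t)) - ρ / (4 * (t₀ - t) ^ 2)) + D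

theorem continuousOn_gk {I : Set ℝ} {t₀ : ℝ} (hI : ∀ t ∈ I, t < t₀) :
    ContinuousOn (fun z : Eu n × ℝ => gk n (‖z.1‖ ^ 2) (t₀ - z.2)) (univ ×ˢ I) := by
  have h : ∀ z ∈ (univ : Set (Eu n)) ×ˢ I, t₀ - z.2 ≠ 0 := fun z hz =>
    (sub_pos.2 (hI z.2 hz.2)).ne'
  unfold gk
  refine ContinuousOn.mul (ContinuousOn.rpow_const (by fun_prop) fun z hz => Or.inl ?_)
    (ContinuousOn.rexp (ContinuousOn.div (by fun_prop) (by fun_prop) fun z hz => ?_))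
  · have := h z hz; positivity
  · have := h z hz; positivity

theorem hasDerivAt_kq (n : ℕ) {t₀ t : ℝ} (b B D ρ : ℝ) (ht : t < t₀) :
    HasDerivAt (kq n t₀ b B D ρ) (kq' n t₀ D ρ t) t := by
  have hs : HasDerivAt (fun t : ℝ => t₀ - t) (-1) t := (hasDerivAt_id t).const_sub t₀
  have h1 := (hasDerivAt_gk_right n ρ (sub_pos.2 ht)).comp t hs
  refine (((h1.add_const b).sub_const (B * ρ)).sub (hs.const_mul D)).congr_deriv ?_
  rw [kq']
  ring

theorem contDiff_chi_kq (n : ℕ) (t₀ b B D t : ℝ) :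
    ContDiff ℝ 2 fun ρ => chi (kq n t₀ b B D ρ t) := by
  refine contDiff_chi.comp ?_
  unfold kq
  have := contDiff_gk_left n (t₀ - t)
  fun_prop

theorem timeTest_chi_kq {I : Set ℝ} {t₀ b B D ρ₀ R : ℝ} (hI : ∀ t ∈ I, t < t₀) (hR : ρ₀ < R)
    (h0 : ∀ t ∈ I, ∀ x : Eu n, ρ₀ < ‖x‖ → kq n t₀ b B D (‖x‖ ^ 2) t ≤ 0) :
    TimeTest (n := n) R I (fun x t => chi (kq n t₀ b B D (‖x‖ ^ 2) t))
      (fun x t => Real.smoothTransition (kq n t₀ b B D (‖x‖ ^ 2) t) * kq' n t₀ D (‖x‖ ^ 2) t) where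
  smooth t _ := (contDiff_chi_kq n t₀ b B D t).comp (contDiff_norm_sq ℝ)
  supp := ⟨ρ₀, hR, fun t ht x hx => chi_eq_zero (h0 t ht x hx)⟩
  deriv x t ht := (hasDerivAt_chi _).comp t (hasDerivAt_kq n b B D _ (hI t ht))
  cont := by
    have h := continuousOn_gk (n := n) hI
    have hz : ∀ z ∈ (univ : Set (Eu n)) ×ˢ I, t₀ - z.2 ≠ 0 := fun z hz =>
      (sub_pos.2 (hI z.2 hz.2)).ne'
    refine ContinuousOn.mul (Real.smoothTransition.continuous.comp_continuousOn ?_) ?_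
    · unfold kq; fun_prop
    · unfold kq'
      refine ContinuousOn.add (h.mul (ContinuousOn.sub (ContinuousOn.div (by fun_prop)
        (by fun_prop) fun z h' => ?_) (ContinuousOn.div (by fun_prop) (by fun_prop)
          fun z h' => ?_))) continuousOn_const
      · have := hz z h'; positivity
      · have := hz z h'; positivity

theorem lap_chi_kq {t₀ t : ℝ} (b B D : ℝ) (ht : t < t₀) (x : Eu n) :
    Real.smoothTransition (kq n t₀ b B D (‖x‖ ^ 2) t) * kq' n t₀ D (‖x‖ ^ 2) t
      + lap (fun x : Eu n => chi (kq n t₀ b B D (‖x‖ ^ 2) t)) x =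
    Real.smoothTransition (kq n t₀ b B D (‖x‖ ^ 2) t) * (D - 2 * n * B) +
      4 * ‖x‖ ^ 2 * (deriv Real.smoothTransition (kq n t₀ b B D (‖x‖ ^ 2) t) *
        (gk n (‖x‖ ^ 2) (t₀ - t) / (4 * (t₀ - t)) + B) ^ 2) := by
  have hk : ∀ ρ, HasDerivAt (fun ρ => kq n t₀ b B D ρ t)
      (-(gk n ρ (t₀ - t) / (4 * (t₀ - t))) - B) ρ := fun ρ => by
    have := (((hasDerivAt_gk_left n ρ (t₀ - t)).add_const b).sub
      ((hasDerivAt_id ρ).const_mul B)).sub_const (D * (t₀ - t))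
    exact this.congr_deriv (by ring)
  have h1 : deriv (fun ρ => chi (kq n t₀ b B D ρ t)) = fun ρ =>
      Real.smoothTransition (kq n t₀ b B D ρ t) * (-(gk n ρ (t₀ - t) / (4 * (t₀ - t))) - B) :=
    funext fun ρ => ((hasDerivAt_chi _).comp ρ (hk ρ)).deriv
  have hd : ∀ q, HasDerivAt Real.smoothTransition (deriv Real.smoothTransition q) q := fun q =>
    ((Real.smoothTransition.contDiff (n := 1)).differentiable (by simp) q).hasDerivAt
  have h2 : ∀ ρ, deriv (deriv fun ρ => chi (kq n t₀ b B D ρ t)) ρ =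
      deriv Real.smoothTransition (kq n t₀ b B D ρ t)
        * (-(gk n ρ (t₀ - t) / (4 * (t₀ - t))) - B) * (-(gk n ρ (t₀ - t) / (4 * (t₀ - t))) - B)
      + Real.smoothTransition (kq n t₀ b B D ρ t) *
        (-(-(gk n ρ (t₀ - t) / (4 * (t₀ - t))) / (4 * (t₀ - t)))) := fun ρ => by
    rw [h1]
    exact (((hd _).comp ρ (hk ρ)).mul
      (((hasDerivAt_gk_left n ρ (t₀ - t)).div_const (4 * (t₀ - t))).neg.sub_const B)).deriv
  rw [lap_radial (contDiff_chi_kq n t₀ b B D t), h2, h1, kq']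
  have : t₀ - t ≠ 0 := (sub_pos.2 ht).ne'
  generalize t₀ - t = σ at *
  field_simp
  ring

end Bump

section LowerBound

variable {n : ℕ}

theorem PowSol.rhs_nonneg {p c : ℝ} {w H : Eu n → ℝ → ℝ} (h : PowSol p c w H) (hc : 0 ≤ c)
    (x : Eu n) (t : ℝ) : 0 ≤ H x t :=
  le_trans (mul_nonneg hc (Real.rpow_nonneg (h.nonneg x t) p)) (h.lower x t)

theorem tendsto_integral_indicator_mul_gk {f : Eu n → ℝ} (hf : Continuous f) {R : ℝ} (hR : 0 < R) :
    Tendsto (fun c : ℝ => ∫ x, (closedBall 0 R).indicator f x * gk n (‖x‖ ^ 2) (1 / c ^ 2)) atTop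
      (𝓝 (f 0)) := by
  have h0 : (closedBall (0 : Eu n) R).indicator f 0 = f 0 :=
    indicator_of_mem (mem_closedBall_self hR.le) f
  rw [← h0]
  refine tendsto_integral_mul_gk ?_ ?_
  · exact (hf.continuousOn.integrableOn_compact (isCompact_closedBall 0 R)).integrable_indicator
      measurableSet_closedBall
  · have : (closedBall (0 : Eu n) R).indicator f =ᶠ[𝓝 0] f := by
      filter_upwards [closedBall_mem_nhds (0 : Eu n) hR] with x hx using indicator_of_mem hx f
    exact hf.continuousAt.congr this.symm

theorem integrable_indicator_mul_gk {f : Eu n → ℝ} (hf : Continuous f) (R σ : ℝ) :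
    Integrable fun x => (closedBall (0 : Eu n) R).indicator f x *
      gk n (‖x‖ ^ 2) σ := by
  have h : Continuous fun x : Eu n => gk n (‖x‖ ^ 2) σ :=
    ((contDiff_gk_left n σ).comp (contDiff_norm_sq ℝ)).continuous
  have := ((hf.mul h).continuousOn.integrableOn_compact (μ := volume)
    (isCompact_closedBall (0 : Eu n) R)).integrable_indicator measurableSet_closedBall
  refine this.congr (Eventually.of_forall fun x => ?_)
  simp only [indicator]
  split_ifs <;> simp

/-- A weak Harnack inequality: the mass in a ball is controlled by later values. -/
theorem exists_integral_le_of_powSol (n : ℕ) {R R' τ : ℝ} (hτ : 0 < τ) (hR0 : 0 < R)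
    (hR : 4 * n * τ ≤ R ^ 2) (hRR : 2 * R' ^ 2 < R ^ 2) : ∃ C, 0 < C ∧
      ∀ (p c : ℝ) (w H : Eu n → ℝ → ℝ), 0 ≤ p → 0 ≤ c → PowSol p c w H → ∀ η N : ℝ, 0 < η →
        (∀ x, ‖x‖ ≤ R + η → ∀ t ∈ Icc (-η) (τ + η), w x t ≤ N) →
        ∀ φ : Eu n → ℝ, Continuous φ → (∀ x, 0 ≤ φ x) → (∀ x, φ x ≤ 1) →
          (∀ x, R' < ‖x‖ → φ x = 0) → ∫ x, w x 0 * φ x ≤ C * w 0 τ := by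
  set c0 := gk n (R ^ 2) (2 * τ) with hc0
  set δ := (4 * Real.pi * (2 * τ)) ^ (-((n : ℝ) / 2)) * Real.exp (-R' ^ 2 / (4 * τ)) - c0 with hδ
  have hδ0 : 0 < δ := by
    rw [hδ, hc0, gk, ← mul_sub]
    refine mul_pos (Real.rpow_pos_of_pos (by positivity) _) (sub_pos.2 (Real.exp_lt_exp.2 ?_))
    rw [div_lt_div_iff₀ (by positivity) (by positivity)]
    nlinarith
  refine ⟨(chi δ)⁻¹, inv_pos.2 (chi_pos hδ0), fun p c w H hp hc h η N hη hb φ hφ hφ0 hφ1 hφs => ?_⟩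
  have hreg := h.reg hb
  have hweak := h.weakEq hp hc hb
  rw [inv_mul_eq_div, le_div_iff₀ (chi_pos hδ0)]
  refine ge_of_tendsto (tendsto_integral_indicator_mul_gk (h.sol.cx τ).continuous hR0) ?_
  have hsmall : ∀ᶠ c : ℝ in atTop, 1 / c ^ 2 < min η τ := by
    have : Tendsto (fun c : ℝ => 1 / c ^ 2) atTop (𝓝 0) :=
      tendsto_const_nhds.div_atTop (tendsto_pow_atTop two_ne_zero)
    exact this.eventually_lt_const (lt_min hη hτ)
  filter_upwards [hsmall, eventually_gt_atTop 0] with k hk hk0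
  set ε := 1 / k ^ 2 with hε
  have hε0 : 0 < ε := by positivity
  obtain ⟨hεη, hετ⟩ := lt_min_iff.1 hk
  set I : Set ℝ := Ioo (ε - τ) (τ + ε) with hIdef
  have hI : ∀ t ∈ I, t < τ + ε := fun t ht => ht.2
  have hq : ∀ t ∈ I, ∀ x : Eu n, R < ‖x‖ → kq n (τ + ε) (-c0) 0 0 (‖x‖ ^ 2) t ≤ 0 := by
    intro t ht x hx
    have hx2 : R ^ 2 ≤ ‖x‖ ^ 2 := by gcongr
    have h1 : gk n (‖x‖ ^ 2) (τ + ε - t) ≤ c0 :=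
      (gk_anti n (by linarith [ht.2]) hx2).trans
        (gk_le_of_le n (by linarith [ht.2]) (by linarith [ht.1]) (by linarith))
    simp only [kq]
    linarith
  have hT := timeTest_chi_kq (n := n) (b := -c0) (B := 0) (D := 0) hI
    (show R < R + η by linarith) hq
  set ψ : Eu n → ℝ → ℝ := fun x t => chi (kq n (τ + ε) (-c0) 0 0 (‖x‖ ^ 2) t) with hψ
  have hint : ∀ s ∈ I, ∀ t, Integrable fun x => w x t * ψ x s := fun s hs t =>
    ((hreg.cx t).mul (hT.smooth s hs).continuous).integrable_of_hasCompactSupport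
      (hT.test hs).hasCompactSupport.mul_left
  have hsub : Icc 0 τ ⊆ I := fun t ht => ⟨by linarith [ht.1], by linarith [ht.2]⟩
  have hder := fun t (ht : t ∈ Icc 0 τ) => hweak.hasDerivAt_integral hreg h.sol.gx hT isOpen_Ioo
    (t := t) ⟨by linarith [ht.1], by linarith [ht.2]⟩ (hsub ht)
  have hmono : MonotoneOn (fun t => ∫ x, w x t * ψ x t) (Icc 0 τ) := by
    refine monotoneOn_of_deriv_nonneg (convex_Icc 0 τ)
      (fun t ht => (hder t ht).continuousAt.continuousWithinAt)
      (fun t ht => (hder t (interior_subset ht)).differentiableAt.differentiableWithinAt) ?_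
    intro t ht
    rw [(hder t (interior_subset ht)).deriv]
    refine integral_nonneg fun x => ?_
    have htt : t < τ + ε := hI t (hsub (interior_subset ht))
    rw [Pi.zero_apply, lap_chi_kq _ _ _ htt]
    refine add_nonneg (mul_nonneg (h.nonneg x t) ?_) (mul_nonneg (h.rhs_nonneg hc x t)
      (chi_nonneg _))
    have := deriv_smoothTransition_nonneg (kq n (τ + ε) (-c0) 0 0 (‖x‖ ^ 2) t)
    simp only [mul_zero, sub_zero, zero_add]
    positivity
  have h0τ := hmono (left_mem_Icc.2 hτ.le) (right_mem_Icc.2 hτ.le) hτ.le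
  have hlow : (∫ x, w x 0 * φ x) * chi δ ≤ ∫ x, w x 0 * ψ x 0 := by
    rw [← integral_mul_const]
    refine integral_mono_of_nonneg (Eventually.of_forall fun x => ?_)
      (hint 0 (hsub (left_mem_Icc.2 hτ.le)) 0) (Eventually.of_forall fun x => ?_)
    · exact mul_nonneg (mul_nonneg (h.nonneg x 0) (hφ0 x)) (chi_nonneg _)
    · simp only
      rw [mul_assoc]
      refine mul_le_mul_of_nonneg_left ?_ (h.nonneg x 0)
      rcases lt_or_ge R' ‖x‖ with hx | hx
      · rw [hφs x hx, zero_mul]; exact chi_nonneg _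
      · refine (mul_le_of_le_one_left (chi_nonneg _) (hφ1 x)).trans (monotone_chi ?_)
        have hx2 : ‖x‖ ^ 2 ≤ R' ^ 2 := by gcongr
        rw [hδ, kq]
        have : (4 * Real.pi * (2 * τ)) ^ (-((n : ℝ) / 2)) * Real.exp (-R' ^ 2 / (4 * τ))
            ≤ gk n (‖x‖ ^ 2) (τ + ε - 0) := by
          unfold gk
          have h1 : (4 * Real.pi * (2 * τ)) ^ (-((n : ℝ) / 2))
              ≤ (4 * Real.pi * (τ + ε - 0)) ^ (-((n : ℝ) / 2)) := by
            refine Real.rpow_le_rpow_of_nonpos ?_ ?_ ?_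
            · rw [sub_zero]; positivity
            · have := Real.pi_pos
              gcongr
              linarith
            · have : (0:ℝ) ≤ n := Nat.cast_nonneg n
              linarith
          have h2 : Real.exp (-R' ^ 2 / (4 * τ)) ≤ Real.exp (-‖x‖ ^ 2 / (4 * (τ + ε - 0))) := by
            rw [Real.exp_le_exp, neg_div, neg_div, neg_le_neg_iff]
            gcongr
            linarith
          exact mul_le_mul h1 h2 (Real.exp_pos _).le
            (Real.rpow_nonneg (by rw [sub_zero]; positivity) _)
        linarith
  have hup : ∫ x, w x τ * ψ x τ
      ≤ ∫ x, (closedBall 0 R).indicator (fun x => w x τ) x * gk n (‖x‖ ^ 2) ε := by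
    have hτI := hsub (right_mem_Icc.2 hτ.le)
    refine integral_mono (hint τ hτI τ) (integrable_indicator_mul_gk (h.sol.cx τ).continuous R ε)
      fun x => ?_
    simp only
    by_cases hx : x ∈ closedBall (0 : Eu n) R
    · rw [indicator_of_mem hx]
      refine mul_le_mul_of_nonneg_left ?_ (h.nonneg x τ)
      have hg := (gk_pos n (‖x‖ ^ 2) hε0).le
      have hle : kq n (τ + ε) (-c0) 0 0 (‖x‖ ^ 2) τ ≤ gk n (‖x‖ ^ 2) ε := by
        have : 0 ≤ c0 := (gk_pos n _ (by positivity)).le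
        rw [kq, add_sub_cancel_left]
        linarith
      exact (monotone_chi hle).trans (chi_le hg)
    · rw [indicator_of_notMem hx, zero_mul]
      rw [mem_closedBall_zero_iff, not_le] at hx
      rw [hψ]
      simp only
      rw [chi_eq_zero (hq τ hτI x hx), mul_zero]
  exact hlow.trans (h0τ.trans hup)

end LowerBound

section UpperBound

variable {n : ℕ}

theorem PowSol.rhs_le {p c A : ℝ} {w H : Eu n → ℝ → ℝ} (h : PowSol p c w H) (hp : 1 < p)
    {x : Eu n} {t : ℝ} (hA : w x t ≤ A) : H x t ≤ 2 * A ^ (p - 1) * w x t := by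
  have hw := h.nonneg x t
  refine (h.upper x t).trans ?_
  rcases hw.eq_or_lt with h0 | h0
  · rw [← h0, Real.zero_rpow (by linarith)]; simp
  · have : w x t ^ p = w x t ^ (p - 1) * w x t := by
      rw [← Real.rpow_add_one h0.ne']; congr 1; ring
    rw [this, mul_assoc]
    have : w x t ^ (p - 1) ≤ A ^ (p - 1) := Real.rpow_le_rpow hw hA (by linarith)
    gcongr

theorem exists_error_le (n : ℕ) : ∃ B D C : ℝ, 0 < B ∧ 3 ≤ D ∧ 0 < C ∧
    ∀ t₀ t, t < t₀ → t₀ - t ≤ 3 →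
    (∀ x : Eu n, 1 / 2 < ‖x‖ → kq n t₀ 2 B D (‖x‖ ^ 2) t ≤ 0) ∧
    ∀ x : Eu n, Real.smoothTransition (kq n t₀ 2 B D (‖x‖ ^ 2) t) * kq' n t₀ D (‖x‖ ^ 2) t
      + lap (fun x : Eu n => chi (kq n t₀ 2 B D (‖x‖ ^ 2) t)) x ≤ C * cut 1 x := by
  obtain ⟨C₀, hC₀, h₀⟩ := exists_gk_div_sq_le n 0 (a := 1 / 4) (by norm_num)
  set B := 4 * (Real.sqrt C₀ + 2) with hB
  have hB0 : 0 < B := by positivity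
  set D := 2 * n * B + 3 with hD
  have hD3 : 3 ≤ D := by rw [hD]; have : 0 ≤ 2 * n * B := by positivity
                         linarith
  obtain ⟨C₁, hC₁, h₁⟩ := exists_gk_div_sq_le n 1 (a := 3 / (4 * B)) (by positivity)
  obtain ⟨C₂, hC₂, h₂⟩ := exists_deriv_smoothTransition_le
  set M := B + 3 * D with hM
  set C₃ := C₂ * (2 * (M ^ 2 * D ^ 2 + C₁) + 2 * B ^ 2) + 3 with hC₃
  have hC₃0 : 0 < C₃ := by positivity
  refine ⟨B, D, 2 * C₃, hB0, hD3, by positivity, fun t₀ t ht ht3 => ?_⟩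
  have hσ : 0 < t₀ - t := sub_pos.2 ht
  have hneg : ∀ x : Eu n, 1 / 2 < ‖x‖ → kq n t₀ 2 B D (‖x‖ ^ 2) t < 0 := by
    intro x hx
    have hx2 : 1 / 4 ≤ ‖x‖ ^ 2 := by nlinarith
    have h3 : gk n (‖x‖ ^ 2) (t₀ - t) ≤ Real.sqrt C₀ := by
      refine Real.le_sqrt_of_sq_le ?_
      simpa using h₀ _ _ hx2 hσ
    have h4 : B * (1 / 4) ≤ B * ‖x‖ ^ 2 := by gcongr
    have h5 : 0 < D * (t₀ - t) := by positivity
    rw [kq]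
    linarith
  refine ⟨fun x hx => (hneg x hx).le, fun x => ?_⟩
  rw [lap_chi_kq 2 B D ht]
  rcases lt_or_ge (1 / 2) ‖x‖ with hx | hx
  · rw [Real.smoothTransition.zero_of_nonpos (hneg x hx).le, (h₂ _).2 (Or.inl (hneg x hx))]
    have := cut_nonneg 1 x
    simp only [zero_mul, mul_zero, add_zero]
    positivity
  have hρ : ‖x‖ ^ 2 ≤ 1 / 4 := by nlinarith [norm_nonneg x]
  have hcut : 3 / 4 ≤ cut 1 x := by
    have := le_cut (q := 1 / 2) one_pos (x := x) (by linarith)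
    linarith
  set q := kq n t₀ 2 B D (‖x‖ ^ 2) t with hq
  have e1 : Real.smoothTransition q * (D - 2 * n * B) ≤ 3 := by
    rw [hD, add_sub_cancel_left]
    linarith [Real.smoothTransition.le_one q]
  set g := gk n (‖x‖ ^ 2) (t₀ - t) with hg
  have hg0 : 0 < g := gk_pos n _ hσ
  have e2 : deriv Real.smoothTransition q * (g / (4 * (t₀ - t)) + B) ^ 2 ≤ C₃ - 3 := by
    by_cases hq01 : q < 0 ∨ 1 < q
    · rw [(h₂ q).2 hq01, zero_mul, hC₃, add_sub_cancel_right]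
      positivity
    push Not at hq01
    have hqe : q = g + 2 - B * ‖x‖ ^ 2 - D * (t₀ - t) := rfl
    have hgD : (g / (4 * (t₀ - t))) ^ 2 ≤ M ^ 2 * D ^ 2 + C₁ := by
      rcases le_total (1 / 4) (D * (t₀ - t)) with hc | hc
      · have h5 : g ≤ M := by nlinarith
        have h6 : g / (4 * (t₀ - t)) ≤ M * D := by
          rw [div_le_iff₀ (by positivity)]
          have : M * (1 / 4) ≤ M * (D * (t₀ - t)) := by gcongr
          linarith
        have h7 : (g / (4 * (t₀ - t))) ^ 2 ≤ (M * D) ^ 2 := by gcongr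
        rw [mul_pow] at h7
        linarith
      · have h5 : 3 / (4 * B) ≤ ‖x‖ ^ 2 := by
          rw [div_le_iff₀ (by positivity)]
          linarith
        have h6 := h₁ _ _ h5 hσ
        rw [pow_one, ← hg] at h6
        have h7 : (g / (4 * (t₀ - t))) ^ 2 = (g / (t₀ - t)) ^ 2 / 16 := by
          rw [mul_comm (4:ℝ), ← div_div, div_pow _ (4:ℝ)]; norm_num
        have h8 : 0 ≤ (g / (t₀ - t)) ^ 2 := sq_nonneg _
        have h9 : 0 ≤ M ^ 2 * D ^ 2 := by positivity
        linarith
    have h8 : (g / (4 * (t₀ - t)) + B) ^ 2 ≤ 2 * (M ^ 2 * D ^ 2 + C₁) + 2 * B ^ 2 := by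
      nlinarith [sq_nonneg (g / (4 * (t₀ - t)) - B)]
    rw [hC₃, add_sub_cancel_right]
    exact mul_le_mul (h₂ q).1 h8 (sq_nonneg _) hC₂
  have e3 : 0 ≤ deriv Real.smoothTransition q * (g / (4 * (t₀ - t)) + B) ^ 2 :=
    mul_nonneg (deriv_smoothTransition_nonneg q) (sq_nonneg _)
  have e4 : 4 * ‖x‖ ^ 2 * (deriv Real.smoothTransition q * (g / (4 * (t₀ - t)) + B) ^ 2)
      ≤ 1 * (deriv Real.smoothTransition q * (g / (4 * (t₀ - t)) + B) ^ 2) := by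
    gcongr
    linarith
  have e5 : 2 * C₃ * (3 / 4) ≤ 2 * C₃ * cut 1 x := by gcongr
  linarith

/-- Local boundedness of subsolutions by their local mass in the past. -/
theorem exists_le_dint (n : ℕ) {p A : ℝ} (hp : 1 < p) (hA : 0 < A) : ∃ C, 0 < C ∧
    ∀ (c : ℝ) (w H : Eu n → ℝ → ℝ), 0 ≤ c → PowSol p c w H →
      (∀ x, ‖x‖ ≤ 1 → ∀ t ∈ Icc (-2 : ℝ) 1, w x t ≤ A) →
      w 0 0 ≤ C * dint (-1) 0 fun x t => w x t * cut 1 x := by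
  obtain ⟨B, D, C, hB, hD, hC, hE⟩ := exists_error_le n
  set L := 2 * A ^ (p - 1) with hL
  have hL0 : 0 < L := by positivity
  refine ⟨C * Real.exp L, by positivity, fun c w H hc h hb => ?_⟩
  have hreg := h.reg hb
  have hweak := h.weakEq (by linarith) hc hb
  set b := Real.sqrt (1 / (2 * B)) with hbdef
  have hb0 : 0 < b := Real.sqrt_pos.2 (by positivity)
  have hb2 : b ^ 2 = 1 / (2 * B) := Real.sq_sqrt (by positivity)
  refine le_of_tendsto (tendsto_integral_indicator_mul_gk (h.sol.cx 0).continuous hb0) ?_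
  have hsmall : ∀ᶠ c : ℝ in atTop, 1 / c ^ 2 < min (1 / (2 * D)) 1 := by
    have : Tendsto (fun c : ℝ => 1 / c ^ 2) atTop (𝓝 0) :=
      tendsto_const_nhds.div_atTop (tendsto_pow_atTop two_ne_zero)
    exact this.eventually_lt_const (by positivity)
  filter_upwards [hsmall, eventually_gt_atTop 0] with k hk hk0
  set ε := 1 / k ^ 2 with hε
  have hε0 : 0 < ε := by positivity
  obtain ⟨hεD, hε1⟩ := lt_min_iff.1 hk
  set I : Set ℝ := Ioo (-2) ε with hIdef
  have hT := timeTest_chi_kq (n := n) (I := I) (b := 2) (B := B) (D := D) (fun t ht => ht.2)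
    (show (1 / 2 : ℝ) < 1 by norm_num)
    fun t ht => (hE ε t ht.2 (by linarith [ht.1])).1
  have hlap : ∀ t ∈ I, ∀ x : Eu n, _ := fun t ht => (hE ε t ht.2 (by linarith [ht.1])).2
  set ψ : Eu n → ℝ → ℝ := fun x t => chi (kq n ε 2 B D (‖x‖ ^ 2) t) with hψ
  have hint : ∀ s ∈ I, ∀ t, Integrable fun x => w x t * ψ x s := fun s hs t =>
    ((hreg.cx t).mul (hT.smooth s hs).continuous).integrable_of_hasCompactSupport
      (hT.test hs).hasCompactSupport.mul_left
  have hsub : Icc (-1) 0 ⊆ I := fun t ht => ⟨by linarith [ht.1], by linarith [ht.2]⟩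
  have hder := fun t (ht : t ∈ Icc (-1 : ℝ) 0) => hweak.hasDerivAt_integral hreg h.sol.gx hT
    isOpen_Ioo (t := t) ⟨by linarith [ht.1], by linarith [ht.2]⟩ (hsub ht)
  have hloc : Loc 1 (-2) 1 fun x t => w x t * cut 1 x :=
    hreg.bdd.mul_test (continuous_cut 1) fun x hx => cut_eq_zero one_pos hx.le
  set m : ℝ → ℝ := fun t => ∫ x, w x t * cut 1 x with hm
  have hmc : ContinuousOn m (Icc (-2) 1) := hloc.continuousOn
  have hm0 : ∀ t, 0 ≤ m t := fun t => integral_nonneg fun x => mul_nonneg (h.nonneg x t)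
    (cut_nonneg 1 x)
  have hmI : ∀ t ∈ Icc (-1 : ℝ) 0, HasDerivAt (fun t => ∫ s in (-1 : ℝ)..t, m s) (m t) t := by
    intro t ht
    have hto : t ∈ Ioo (-2 : ℝ) 1 := ⟨by linarith [ht.1], by linarith [ht.2]⟩
    refine intervalIntegral.integral_hasDerivAt_right ?_
      ((hmc.mono Ioo_subset_Icc_self).stronglyMeasurableAtFilter isOpen_Ioo t hto)
      (hmc.continuousAt (Icc_mem_nhds hto.1 hto.2))
    refine (hmc.mono ?_).intervalIntegrable
    rw [uIcc_of_le ht.1]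
    exact Icc_subset_Icc (by norm_num) hto.2.le
  have hF : ∀ t ∈ Icc (-1 : ℝ) 0, ∫ x, (w x t * (Real.smoothTransition (kq n ε 2 B D (‖x‖ ^ 2) t) *
      kq' n ε D (‖x‖ ^ 2) t + lap (fun y => ψ y t) x) + H x t * ψ x t)
      ≤ C * m t + L * ∫ x, w x t * ψ x t := by
    intro t ht
    have ht2 : t ∈ Icc (-2 : ℝ) 1 := ⟨by linarith [ht.1], by linarith [ht.2]⟩
    have hcx := hloc.integrable ht2
    have hw := hint t (hsub ht) t
    rw [hm, ← integral_const_mul, ← integral_const_mul,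
      ← integral_add (hcx.const_mul C) (hw.const_mul L)]
    have hi1 : Integrable fun x => H x t * ψ x t :=
      ((h.sol.gx t).mul (hT.smooth t (hsub ht)).continuous).integrable_of_hasCompactSupport
        (hT.test (hsub ht)).hasCompactSupport.mul_left
    by_cases hi : Integrable fun x => w x t * (Real.smoothTransition (kq n ε 2 B D (‖x‖ ^ 2) t) *
      kq' n ε D (‖x‖ ^ 2) t + lap (fun y => ψ y t) x) + H x t * ψ x t
    · refine integral_mono hi ((hcx.const_mul C).add (hw.const_mul L)) fun x => ?_
      have h1 := mul_le_mul_of_nonneg_left (hlap t (hsub ht) x) (h.nonneg x t)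
      have h2 : H x t * ψ x t ≤ L * (w x t * ψ x t) := by
        rcases le_total ‖x‖ 1 with hx | hx
        · rw [← mul_assoc]
          exact mul_le_mul_of_nonneg_right (h.rhs_le hp (hb x hx t ht2)) (chi_nonneg _)
        · have : ψ x t = 0 := chi_eq_zero ((hE ε t (hsub ht).2 (by linarith [ht.1])).1 x
            (by linarith))
          simp [this]
      simp only
      simp only [hψ] at h2 ⊢
      linarith
    · rw [integral_undef hi]
      refine integral_nonneg fun x => ?_
      have := h.nonneg x t
      have h1 := cut_nonneg 1 x
      have h2 : 0 ≤ ψ x t := chi_nonneg _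
      simp only [Pi.zero_apply]
      positivity
  have hanti : AntitoneOn (fun t => Real.exp (-L * t) * (∫ x, w x t * ψ x t)
      - C * Real.exp L * ∫ s in (-1 : ℝ)..t, m s) (Icc (-1) 0) := by
    have hd := fun t (ht : t ∈ Icc (-1 : ℝ) 0) =>
      ((((hasDerivAt_id t).const_mul (-L)).exp).mul (hder t ht)).sub
        ((hmI t ht).const_mul (C * Real.exp L))
    refine antitoneOn_of_deriv_nonpos (convex_Icc _ _)
      (fun t ht => (hd t ht).continuousAt.continuousWithinAt)
      (fun t ht => (hd t (interior_subset ht)).differentiableAt.differentiableWithinAt) ?_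
    intro t ht
    have ht' := interior_subset ht
    refine (hd t ht').deriv.trans_le ?_
    have h1 := hF t ht'
    have h2 : Real.exp (-L * t) ≤ Real.exp L := Real.exp_le_exp.2 (by nlinarith [ht'.1])
    have h3 : Real.exp (-L * t) * (C * m t) ≤ Real.exp L * (C * m t) :=
      mul_le_mul_of_nonneg_right h2 (mul_nonneg hC.le (hm0 t))
    have h4 := mul_le_mul_of_nonneg_left h1 (Real.exp_pos (-L * t)).le
    simp only [id, mul_one]
    linarith
  have hfin := hanti (left_mem_Icc.2 (by norm_num)) (right_mem_Icc.2 (by norm_num))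
    (by norm_num : (-1 : ℝ) ≤ 0)
  have hz : ∀ x : Eu n, ψ x (-1) = 0 := by
    intro x
    refine chi_eq_zero ?_
    have h1 : gk n (‖x‖ ^ 2) (ε - -1) ≤ 1 := by
      unfold gk
      refine mul_le_one₀ (Real.rpow_le_one_of_one_le_of_nonpos ?_ ?_) (Real.exp_pos _).le ?_
      · nlinarith [Real.pi_gt_three]
      · have : (0:ℝ) ≤ n := Nat.cast_nonneg n
        linarith
      · rw [Real.exp_le_one_iff, neg_div, neg_nonpos]
        have : 0 < ε - -1 := by linarith
        positivity
    have h2 : 0 ≤ B * ‖x‖ ^ 2 := by positivity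
    have h3 : D * 1 ≤ D * (ε - -1) := by gcongr; linarith
    rw [kq]
    linarith
  simp only [hz, mul_zero, integral_zero, intervalIntegral.integral_same, sub_zero,
    Real.exp_zero, one_mul] at hfin
  have hlow : ∫ x, (closedBall 0 b).indicator (fun x => w x 0) x * gk n (‖x‖ ^ 2) ε
      ≤ ∫ x, w x 0 * ψ x 0 := by
    refine integral_mono (integrable_indicator_mul_gk (h.sol.cx 0).continuous b ε)
      (hint 0 (hsub (right_mem_Icc.2 (by norm_num))) 0) fun x => ?_
    simp only
    by_cases hx : x ∈ closedBall (0 : Eu n) b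
    · rw [indicator_of_mem hx]
      refine mul_le_mul_of_nonneg_left ?_ (h.nonneg x 0)
      rw [mem_closedBall_zero_iff] at hx
      have h1 : B * ‖x‖ ^ 2 ≤ 1 / 2 := by
        calc B * ‖x‖ ^ 2 ≤ B * b ^ 2 := by gcongr
          _ = 1 / 2 := by rw [hb2]; field_simp
      have h2 : D * ε ≤ 1 / 2 := by
        calc D * ε ≤ D * (1 / (2 * D)) := by gcongr
          _ = 1 / 2 := by field_simp
      refine le_trans ?_ (le_chi _)
      rw [kq, sub_zero]
      linarith
    · rw [indicator_of_notMem hx, zero_mul]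
      exact mul_nonneg (h.nonneg x 0) (chi_nonneg _)
  have : dint (-1) 0 (fun x t => w x t * cut 1 x) = ∫ s in (-1 : ℝ)..0, m s := rfl
  rw [this]
  linarith

end UpperBound

section Mass

variable {n : ℕ}

theorem neg_mul_le_lap_cut_pow (n : ℕ) (x : Eu n) :
    -(2 * (n + 4) ^ 2) * cut 2 x ^ 3 ≤ lap (fun x : Eu n => cut 2 x ^ 3) x := by
  have hd : ∀ ρ : ℝ, HasDerivAt (fun ρ : ℝ => 1 - ρ / 4) (-(1 / 4)) ρ := fun ρ =>
    ((hasDerivAt_id ρ).div_const 4).const_sub 1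
  have hh : ContDiff ℝ 2 fun ρ : ℝ => max (1 - ρ / 4) 0 ^ 3 :=
    (contDiff_posPow 0).comp (by fun_prop)
  have h1 : deriv (fun ρ : ℝ => max (1 - ρ / 4) 0 ^ 3)
      = fun ρ => -(3 / 4) * max (1 - ρ / 4) 0 ^ 2 := funext fun ρ => by
    refine (((hasDerivAt_posPow 1 _).comp ρ (hd ρ)).deriv).trans ?_
    norm_num
    ring
  have h2 : deriv (deriv fun ρ : ℝ => max (1 - ρ / 4) 0 ^ 3)
      = fun ρ => 3 / 8 * max (1 - ρ / 4) 0 := funext fun ρ => by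
    rw [h1]
    refine ((((hasDerivAt_posPow 0 _).comp ρ (hd ρ)).const_mul (-(3 / 4))).deriv).trans ?_
    norm_num
    ring
  have hc : ∀ x : Eu n, cut 2 x = max (1 - ‖x‖ ^ 2 / 4) 0 := fun x => by
    unfold cut
    rw [norm_smul, mul_pow]
    congr 2
    norm_num
    ring
  simp only [hc]
  rw [lap_radial hh x, h2, h1]
  simp only
  rcases le_total (1 - ‖x‖ ^ 2 / 4) 0 with h0 | h0
  · rw [max_eq_right h0]; simp
  · rw [max_eq_left h0]
    set z := 1 - ‖x‖ ^ 2 / 4 with hz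
    have hx : ‖x‖ ^ 2 = 4 * (1 - z) := by rw [hz]; ring
    rw [hx]
    have key : 0 ≤ 6 * (1 - z) - 3 / 2 * n * z + 2 * (n + 4) ^ 2 * z ^ 2 := by
      nlinarith [sq_nonneg ((n + 4) * z * 2 - 3), Nat.cast_nonneg (α := ℝ) n]
    nlinarith [mul_nonneg h0 key]

theorem exists_integral_cut_le (n : ℕ) : ∃ C, 0 < C ∧ ∀ (p c : ℝ) (w H : Eu n → ℝ → ℝ), 0 ≤ p →
    0 ≤ c → PowSol p c w H → ∀ N : ℝ, (∀ x, ‖x‖ ≤ 3 → ∀ t ∈ Icc (-2 : ℝ) 1, w x t ≤ N) →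
    dint (-1) 0 (fun x t => w x t * cut 1 x) ≤ C * ∫ x, w x 0 * cut 2 x ^ 3 := by
  set L : ℝ := 2 * (n + 4) ^ 2 with hL
  refine ⟨3 * Real.exp L, by positivity, fun p c w H hp hc h N hb => ?_⟩
  have hreg := h.reg hb
  have hweak := h.weakEq hp hc hb
  have hφ : Test (n := n) 3 fun x => cut 2 x ^ 3 := test_cut_pow two_pos (by norm_num) 0
  have hloc : Loc 3 (-2) 1 fun x t => w x t * cut 1 x :=
    hreg.bdd.mul_test (continuous_cut 1) fun x hx => cut_eq_zero one_pos (by linarith)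
  have hint : ∀ t, Integrable fun x => w x t * cut 2 x ^ 3 := fun t =>
    ((hreg.cx t).mul hφ.smooth.continuous).integrable_of_hasCompactSupport
      hφ.hasCompactSupport.mul_left
  have hder := fun t (ht : t ∈ Icc (-1 : ℝ) 0) =>
    hweak _ hφ t ⟨by linarith [ht.1], by linarith [ht.2]⟩
  have hmono : MonotoneOn (fun t => Real.exp (L * t) * ∫ x, w x t * cut 2 x ^ 3) (Icc (-1) 0) := by
    have hd := fun t (ht : t ∈ Icc (-1 : ℝ) 0) =>
      (((hasDerivAt_id t).const_mul L).exp).mul (hder t ht)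
    refine monotoneOn_of_deriv_nonneg (convex_Icc _ _)
      (fun t ht => (hd t ht).continuousAt.continuousWithinAt)
      (fun t ht => (hd t (interior_subset ht)).differentiableAt.differentiableWithinAt) ?_
    intro t ht
    have ht' := interior_subset ht
    refine le_of_le_of_eq ?_ (hd t ht').deriv.symm
    have hi : Integrable fun x => w x t * lap (fun x => cut 2 x ^ 3) x + H x t * cut 2 x ^ 3 := by
      refine Integrable.add ?_ ?_
      · exact ((hreg.cx t).mul hφ.smooth.continuous_lap).integrable_of_hasCompactSupport
          hφ.hasCompactSupport.lap.mul_left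
      · exact ((h.sol.gx t).mul hφ.smooth.continuous).integrable_of_hasCompactSupport
          hφ.hasCompactSupport.mul_left
    have h1 : -L * ∫ x, w x t * cut 2 x ^ 3
        ≤ ∫ x, (w x t * lap (fun x => cut 2 x ^ 3) x + H x t * cut 2 x ^ 3) := by
      rw [← integral_const_mul]
      refine integral_mono ((hint t).const_mul _) hi fun x => ?_
      have e1 := mul_le_mul_of_nonneg_left (neg_mul_le_lap_cut_pow n x) (h.nonneg x t)
      have e2 := mul_nonneg (h.rhs_nonneg hc x t) (pow_nonneg (cut_nonneg 2 x) 3)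
      simp only
      linarith
    have h2 := mul_le_mul_of_nonneg_left h1 (Real.exp_pos (L * t)).le
    simp only [id, mul_one]
    linarith
  have hm : ∀ t ∈ Icc (-1 : ℝ) 0, ∫ x, w x t * cut 1 x
      ≤ 3 * Real.exp L * ∫ x, w x 0 * cut 2 x ^ 3 := by
    intro t ht
    have h1 := hmono ht (right_mem_Icc.2 (by norm_num)) ht.2
    simp only [mul_zero, Real.exp_zero, one_mul] at h1
    have hpos : 0 ≤ ∫ x, w x t * cut 2 x ^ 3 :=
      integral_nonneg fun x => mul_nonneg (h.nonneg x t) (pow_nonneg (cut_nonneg 2 x) 3)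
    have h2 : ∫ x, w x t * cut 1 x ≤ 3 * ∫ x, w x t * cut 2 x ^ 3 := by
      rw [← integral_const_mul]
      refine integral_mono (hloc.integrable ⟨by linarith [ht.1], by linarith [ht.2]⟩)
        ((hint t).const_mul 3) fun x => ?_
      simp only
      rw [mul_left_comm]
      refine mul_le_mul_of_nonneg_left ?_ (h.nonneg x t)
      rcases le_total 1 ‖x‖ with hx | hx
      · rw [cut_eq_zero one_pos hx]
        have := cut_nonneg 2 x
        positivity
      · have := le_cut (q := 1 / 2) two_pos (x := x) (by linarith)
        have h3 : (3 / 4 : ℝ) ^ 3 ≤ cut 2 x ^ 3 := by gcongr; linarith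
        have := cut_le_one 1 x
        norm_num at h3
        linarith
    have h3 : ∫ x, w x t * cut 2 x ^ 3
        = Real.exp (-(L * t)) * (Real.exp (L * t) * ∫ x, w x t * cut 2 x ^ 3) := by
      rw [← mul_assoc, ← Real.exp_add]; simp
    have h4 : Real.exp (-(L * t)) ≤ Real.exp L := Real.exp_le_exp.2 (by nlinarith [ht.1])
    have h5 : ∫ x, w x t * cut 2 x ^ 3 ≤ Real.exp L * ∫ x, w x 0 * cut 2 x ^ 3 := by
      rw [h3]
      exact mul_le_mul h4 h1 (mul_nonneg (Real.exp_pos _).le hpos) (Real.exp_pos _).le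
    linarith
  have := intervalIntegral.integral_mono_on (μ := volume) (by norm_num : (-1 : ℝ) ≤ 0)
    ((hloc.continuousOn.mono (Icc_subset_Icc (by norm_num) (by norm_num))).intervalIntegrable_of_Icc
      (by norm_num)) (continuous_const.intervalIntegrable _ _) hm
  simpa [dint] using this

end Mass

section Key

variable {n : ℕ}

theorem dint_comp_scale {k : ℝ} (hk : 0 < k) (F : Eu n → ℝ → ℝ) :
    dint (-1) 1 (fun x t => F (k • x) (k ^ 2 * t))
      = (k ^ n)⁻¹ * (k ^ 2)⁻¹ * dint (-k ^ 2) (k ^ 2) F := by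
  have h1 : ∀ t, ∫ x : Eu n, F (k • x) (k ^ 2 * t) = (k ^ n)⁻¹ * ∫ x, F x (k ^ 2 * t) := fun t => by
    have := Measure.integral_comp_smul (volume : Measure (Eu n)) (fun x => F x (k ^ 2 * t)) k
    rw [this, finrank_euclideanSpace, Fintype.card_fin, abs_of_pos (by positivity), smul_eq_mul]
  simp only [dint, h1, intervalIntegral.integral_const_mul]
  have h2 := intervalIntegral.integral_comp_mul_left (a := -1) (b := 1)
    (fun t => ∫ x, F x t) (pow_pos hk 2).ne'
  rw [h2, smul_eq_mul, mul_assoc, mul_neg_one, mul_one]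

theorem dint_eq_of_support {a : ℝ} {F : Eu n → ℝ → ℝ} {b : ℝ} (hab : a ≤ b)
    (h : ∀ x t, a ≤ |t| → F x t = 0) : dint (-b) b F = dint (-a) a F := by
  have hs : Function.support (fun t => ∫ x, F x t) ⊆ Ioc (-a) a := fun t ht => by
    by_contra hc
    refine ht ?_
    have : a ≤ |t| := by
      by_contra hlt
      have := abs_lt.1 (not_le.1 hlt)
      exact hc ⟨this.1, this.2.le⟩
    simp [h _ t this]
  rw [dint, dint, intervalIntegral.integral_eq_integral_of_support_subset hs,
    intervalIntegral.integral_eq_integral_of_support_subset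
      (hs.trans (Ioc_subset_Ioc (by linarith) hab))]

theorem dint_mono_interval {R R' a b a' b' : ℝ} (ha : a' ≤ a) (hab : a ≤ b) (hb : b ≤ b')
    {f g : Eu n → ℝ → ℝ} (hf : Loc R a' b' f) (hg : Loc R' a' b' g)
    (h : ∀ x, ∀ t ∈ Icc a b, f x t ≤ g x t) (hg0 : ∀ x, ∀ t ∈ Icc a' b', 0 ≤ g x t) :
    dint a b f ≤ dint a' b' g := by
  have hsub : Icc a b ⊆ Icc a' b' := Icc_subset_Icc ha hb
  refine le_trans (b := dint a b g) ?_ ?_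
  · exact intervalIntegral.integral_mono_on hab
      ((hf.continuousOn.mono hsub).intervalIntegrable_of_Icc hab)
      ((hg.continuousOn.mono hsub).intervalIntegrable_of_Icc hab)
      fun t ht => integral_mono (hf.integrable (hsub ht)) (hg.integrable (hsub ht))
          fun x => h x t ht
  · refine intervalIntegral.integral_mono_interval ha hab hb ?_
      (hg.intervalIntegrable (ha.trans (hab.trans hb)))
    refine (ae_restrict_mem measurableSet_Ioc).mono fun t ht => ?_
    exact integral_nonneg fun x => hg0 x t (Ioc_subset_Icc_self ht)

theorem tendsto_young_mul_vb (n : ℕ) {p δ L : ℝ} (hδ : 0 < δ) (hL : 0 ≤ L)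
    (hpn : (n : ℝ) < 2 + 2 * (1 / (p - 1))) :
    Tendsto (fun R : ℝ => young p δ (L * R⁻¹ ^ 2) * vb n R) atTop (𝓝 0) := by
  set e := 1 / (p - 1) with he
  have h := (tendsto_rpow_neg_atTop (y := 2 + 2 * e - n) (by linarith)).const_mul
    (L * (L / δ) ^ e * vb n 1)
  rw [mul_zero] at h
  refine h.congr' ?_
  filter_upwards [eventually_gt_atTop 0] with R hR
  rw [young, ← he, vb_mul n hR, show L * R⁻¹ ^ 2 / δ = L / δ * R⁻¹ ^ 2 by ring,
    Real.mul_rpow (by positivity) (by positivity), ← Real.rpow_natCast R n,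
    ← Real.rpow_natCast R⁻¹ 2, ← Real.rpow_mul (by positivity), Real.inv_rpow hR.le,
    Real.inv_rpow hR.le, ← Real.rpow_neg hR.le, ← Real.rpow_neg hR.le,
    show -(2 + 2 * e - (n : ℝ)) = -((2 : ℕ) : ℝ) + -(((2 : ℕ) : ℝ) * e) + n by push_cast; ring,
    Real.rpow_add hR, Real.rpow_add hR]
  ring

theorem le_add_rpow_mul {p σ X : ℝ} (hp : 1 < p) (hσ : 0 < σ) (hX : 0 ≤ X) :
    X ≤ σ + σ ^ (1 - p) * X ^ p := by
  rcases le_total X σ with h | h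
  · have := mul_nonneg (Real.rpow_nonneg hσ.le (1 - p)) (Real.rpow_nonneg hX p)
    linarith
  · have hX0 : 0 < X := hσ.trans_le h
    have h1 : X ^ (1 - p) ≤ σ ^ (1 - p) := Real.rpow_le_rpow_of_nonpos hσ h (by linarith)
    have h2 : X ^ (1 - p) * X ^ p = X := by
      rw [← Real.rpow_add hX0]; simp
    have h3 := mul_le_mul_of_nonneg_right h1 (Real.rpow_nonneg hX p)
    linarith

/-- A solution of size one at a point cannot be bounded on a large neighbourhood: mass version. -/
theorem exists_le_abs_dint (n : ℕ) {r lam A : ℝ} (hr : 0 < r) (h0 : 0 ≤ lam) (h1 : lam < 1)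
    (hn : (n : ℝ) < 2 + 1 / r) (hA : 0 < A) : ∃ (m : ℕ) (R η : ℝ), 1 ≤ R ∧ 0 < η ∧
    ∀ u v : Eu n → ℝ → ℝ, Sol r lam u v →
      (∀ x, ‖x‖ ≤ 2 * R → ∀ t ∈ Icc (-5 : ℝ) 5, u x t + v x t ≤ A) → u 0 0 + v 0 0 = 1 →
      η ≤ |dint (-4) 4 fun x t => dtcut 0 (t / 4) / 4 * ((u x t + v x t) * cut R x ^ (m + 3))| := by
  set p := 2 * r + 1 with hp
  have hp1 : 1 < p := by linarith
  obtain ⟨C, hC, hD⟩ := exists_le_dint n hp1 hA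
  obtain ⟨j, hj⟩ := exists_nat_exponent hp1
  set c := (1 - lam) / 2 ^ p with hc
  have hc0 : 0 < c := div_pos (by linarith) (by positivity)
  set V := vb n 1 with hV
  have hV0 : 0 ≤ V := vb_nonneg n 1
  set σ := 1 / (2 * C * (V + 1)) with hσ
  have hσ0 : 0 < σ := by positivity
  set S := σ ^ (1 - p) with hS
  have hS0 : 0 < S := by positivity
  set Q : ℝ := 2 * (4 / 3) ^ (j + 3) with hQ
  have hQ0 : 0 < Q := by positivity
  set η := c / 2 * (1 / (2 * C * S * Q)) / 2 with hη
  have hη0 : 0 < η := by positivity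
  have hev := (tendsto_young_mul_vb n (p := p) (δ := c / 2) (L := lapC n j) (by positivity)
    (lapC_nonneg n j) (by
      have : 2 * (1 / (p - 1)) = 1 / r := by rw [hp, add_sub_cancel_right]; field_simp
      rw [this]; exact hn)).eventually_lt_const (show 0 < η / 8 by positivity)
  obtain ⟨R, hR, hR2⟩ := (hev.and (eventually_ge_atTop 2)).exists
  refine ⟨j, R, η, by linarith, hη0, fun u v h hb hw1 => ?_⟩
  have hps := h.powSol hr h0 h1
  rw [← hp, ← hc] at hps
  have hreg := hps.reg hb
  have hwb := hreg.bdd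
  have hloc1 : Loc (2 * R) (-5) 5 fun x t => (u x t + v x t) * cut 1 x :=
    hwb.mul_test (continuous_cut 1) fun x hx => cut_eq_zero one_pos (by linarith)
  have hwp : Bdd (2 * R) (-5) 5 fun x t => (u x t + v x t) ^ p := hwb.rpow (by linarith)
  have hlocp : Loc (2 * R) (-5) 5 fun x t => (u x t + v x t) ^ p * cut 1 x :=
    hwp.mul_test (continuous_cut 1) fun x hx => cut_eq_zero one_pos (by linarith)
  have hcR : Continuous fun x : Eu n => cut R x ^ (j + 3) := (continuous_cut R).pow _
  have hzR : ∀ x : Eu n, 2 * R < ‖x‖ → cut R x ^ (j + 3) = 0 := fun x hx => by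
    rw [cut_eq_zero (by linarith) (by linarith), zero_pow (by omega)]
  have hlocR : Loc (2 * R) (-5) 5 fun x t => (u x t + v x t) ^ p * cut R x ^ (j + 3) :=
    hwp.mul_test hcR hzR
  have e1 := hD c _ _ hc0.le hps fun x hx t ht =>
    hb x (by linarith) t ⟨by linarith [ht.1], by linarith [ht.2]⟩
  rw [hw1] at e1
  have r10 : ∀ {f : Eu n → ℝ → ℝ}, Loc (2 * R) (-5) 5 f → Loc (2 * R) (-1) 0 f := fun hf =>
    ⟨hf.toBdd.mono le_rfl (by norm_num) (by norm_num), fun x hx t ht =>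
      hf.supp x hx t ⟨by linarith [ht.1], by linarith [ht.2]⟩⟩
  have r44 : ∀ {f : Eu n → ℝ → ℝ}, Loc (2 * R) (-5) 5 f → Loc (2 * R) (-4) 4 f := fun hf =>
    ⟨hf.toBdd.mono le_rfl (by norm_num) (by norm_num), fun x hx t ht =>
      hf.supp x hx t ⟨by linarith [ht.1], by linarith [ht.2]⟩⟩
  have lc : Loc (n := n) 1 (-1) 0 fun x _ => σ * cut 1 x :=
    ⟨bdd_space (by have := continuous_cut (n := n) 1; fun_prop) 1 (-1) 0, fun x hx t _ => by
      rw [cut_eq_zero one_pos hx.le, mul_zero]⟩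
  have lp := (r10 hlocp).const_mul S
  have e2 : dint (-1) 0 (fun x t => (u x t + v x t) * cut 1 x)
      ≤ dint (-1) 0 (fun x _ => σ * cut (n := n) 1 x)
        + S * dint (-1) 0 fun x t => (u x t + v x t) ^ p * cut 1 x := by
    have lc' : Loc (n := n) (2 * R) (-1) 0 fun x _ => σ * cut 1 x :=
      ⟨bdd_space (by have := continuous_cut (n := n) 1; fun_prop) _ (-1) 0, fun x hx t _ => by
        rw [cut_eq_zero one_pos (by linarith), mul_zero]⟩
    rw [← dint_const_mul, ← dint_add (by norm_num) lc' lp]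
    refine dint_mono (by norm_num) (r10 hloc1) (lc'.add lp) fun x t _ => ?_
    have := mul_le_mul_of_nonneg_right (le_add_rpow_mul hp1 hσ0 (hps.nonneg x t)) (cut_nonneg 1 x)
    linarith
  have e3 : dint (-1) 0 (fun x _ => σ * cut (n := n) 1 x) ≤ σ * V := by
    have := dint_le_vb (M := σ) (by norm_num) lc fun x _ t _ =>
      mul_le_of_le_one_right hσ0.le (cut_le_one 1 x)
    linarith
  have e4 : 1 / (2 * C * S) ≤ dint (-1) 0 fun x t => (u x t + v x t) ^ p * cut 1 x := by
    rw [div_le_iff₀ (by positivity)]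
    have e5 : C * (σ * V) ≤ 1 / 2 := by
      calc C * (σ * V) ≤ C * (σ * (V + 1)) := by gcongr; linarith
        _ = 1 / 2 := by rw [hσ]; field_simp
    have e6 := mul_le_mul_of_nonneg_left (e2.trans (add_le_add_left e3 _)) hC.le
    nlinarith
  set θ : ℝ → ℝ := fun t => tcut 1 (t / 4) with hθ
  have hθd : ∀ t, HasDerivAt θ (dtcut 0 (t / 4) / 4) t := fun t => by
    refine ((hasDerivAt_tcut_succ 0 (t / 4)).comp t ((hasDerivAt_id t).div_const 4)).congr_deriv ?_
    ring
  have hθc : Continuous fun t : ℝ => dtcut 0 (t / 4) / 4 := by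
    have := continuous_dtcut 0
    fun_prop
  have hθ0 : ∀ t, 0 ≤ θ t := fun t => tcut_nonneg 1 _
  have hm0 : ∀ t : ℝ, max (1 - t ^ 2) 0 ≤ 1 := fun t =>
    max_le (by linarith [sq_nonneg t]) zero_le_one
  have hθ1 : ∀ t, θ t ≤ 1 := fun t => pow_le_one₀ (le_max_right _ _) (hm0 _)
  have hθh : ∀ t ∈ Icc (-1 : ℝ) 0, 1 / 2 ≤ θ t := fun t ht => by
    have h5 : 15 / 16 ≤ max (1 - (t / 4) ^ 2) 0 := le_max_of_le_left (by nlinarith [ht.1, ht.2])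
    have h6 : (15 / 16 : ℝ) ^ 4 ≤ max (1 - (t / 4) ^ 2) 0 ^ 4 := by gcongr
    have : θ t = max (1 - (t / 4) ^ 2) 0 ^ 4 := rfl
    rw [this]
    norm_num at h6 ⊢
    linarith
  have hθe : θ (-4) = 0 ∧ θ 4 = 0 := by
    constructor
    · have : θ (-4) = tcut 1 (-1) := by rw [hθ]; norm_num
      rw [this, tcut_neg_one]
    · have : θ 4 = tcut 1 1 := by rw [hθ]; norm_num
      rw [this, tcut_one]
  have hθcont : Continuous θ := continuous_iff_continuousAt.2 fun t => (hθd t).continuousAt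
  have lθ : Loc (2 * R) (-4) 4 fun x t => θ t * ((u x t + v x t) ^ p * cut R x ^ (j + 3)) :=
    (r44 hlocR).mul' (bdd_time hθcont.continuousOn _)
  have e7 : dint (-1) 0 (fun x t => (u x t + v x t) ^ p * cut 1 x)
      ≤ Q * dint (-4) 4 fun x t => θ t * ((u x t + v x t) ^ p * cut R x ^ (j + 3)) := by
    rw [← dint_const_mul]
    have hnn : ∀ x : Eu n, ∀ t, 0 ≤ Q * (θ t * ((u x t + v x t) ^ p * cut R x ^ (j + 3))) :=
      fun x t => by
        have := hθ0 t
        have := cut_nonneg R x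
        have := Real.rpow_nonneg (hps.nonneg x t) p
        positivity
    refine dint_mono_interval (by norm_num) (by norm_num) (by norm_num) (r44 hlocp)
      (lθ.const_mul Q) (fun x t ht => ?_) fun x t _ => hnn x t
    rcases le_total 1 ‖x‖ with hx | hx
    · rw [cut_eq_zero one_pos hx, mul_zero]
      exact hnn x t
    · have h5 : 3 / 4 ≤ cut R x := by
        have := le_cut (q := 1 / 2) (show 0 < R by linarith) (x := x) (by linarith)
        linarith
      have h6 : (3 / 4 : ℝ) ^ (j + 3) ≤ cut R x ^ (j + 3) := by gcongr
      have h7 : (1 : ℝ) ≤ Q * (θ t * cut R x ^ (j + 3)) := by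
        calc (1 : ℝ) = Q * (1 / 2 * (3 / 4) ^ (j + 3)) := by
              rw [hQ, show (2 : ℝ) * (4 / 3) ^ (j + 3) * (1 / 2 * (3 / 4) ^ (j + 3))
                = (4 / 3) ^ (j + 3) * (3 / 4) ^ (j + 3) by ring, ← mul_pow]
              norm_num
          _ ≤ _ := by
              have := hθh t ht
              gcongr
      have h8 := Real.rpow_nonneg (hps.nonneg x t) p
      calc (u x t + v x t) ^ p * cut 1 x ≤ (u x t + v x t) ^ p * 1 := by
            gcongr; exact cut_le_one 1 x
        _ ≤ (u x t + v x t) ^ p * (Q * (θ t * cut R x ^ (j + 3))) := by gcongr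
        _ = _ := by ring
  have e8 := hps.dint_le (j := j) (R := R) hp1 hc0 hj (by linarith) (by linarith) hb hθd hθc hθ0
    hθ1 (s := -4) (e := 4) (by norm_num) (by norm_num) (by norm_num) hθe.1 hθe.2
  have e9 : c / 2 * (1 / (2 * C * S * Q)) ≤ c / 2 *
      dint (-4) 4 fun x t => θ t * ((u x t + v x t) ^ p * cut R x ^ (j + 3)) := by
    refine mul_le_mul_of_nonneg_left ?_ (by positivity)
    rw [← div_div, div_le_iff₀ hQ0]
    exact (e4.trans e7).trans_eq (mul_comm _ _)
  have e10 := neg_le_abs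
    (dint (-4) 4 fun x t => dtcut 0 (t / 4) / 4 * ((u x t + v x t) * cut R x ^ (j + 3)))
  linarith

end Key

section Key

variable {n : ℕ}

/-- A solution of size one at a point cannot be bounded on a large neighbourhood. -/
theorem exists_scale_not_le (n : ℕ) {r lam : ℝ} (hr : 0 < r) (h0 : 0 ≤ lam) (h1 : lam < 1)
    (hn : (n : ℝ) < 2 + 1 / r) : ∃ K, 0 < K ∧ ∀ u v : Eu n → ℝ → ℝ, Sol r lam u v →
      u 0 0 + v 0 0 = 1 → ∃ x t, ‖x‖ ≤ K ∧ |t| ≤ K ^ 2 ∧ 4 < (u x t + v x t) ^ r := by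
  set q := 1 / r with hq
  have hq0 : 0 < q := by positivity
  set A : ℝ := 4 ^ q with hA
  have hA0 : 0 < A := by positivity
  obtain ⟨m, R, η, hR, hη, hG⟩ := exists_le_abs_dint n hr h0 h1 hn hA0
  obtain ⟨C, hC, hE⟩ := Sol.exists_energy_le n hr h0 h1
  set θ : ℝ → ℝ := fun t => tcut 1 (t / 4) with hθ
  set E := dint (-4) 4 fun (x : Eu n) t => θ t ^ 2 * (cut R x ^ (m + 3)) ^ 2 with hEd
  set σ := ((n : ℝ) + 2 + q) / 2 with hσ
  have hlim : Tendsto (fun k : ℝ => C * A * k ^ (-(σ - n)) + E * k ^ (-(2 + q - σ))) atTop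
      (𝓝 0) := by
    have := ((tendsto_rpow_neg_atTop (y := σ - n) (by linarith)).const_mul (C * A)).add
      ((tendsto_rpow_neg_atTop (y := 2 + q - σ) (by linarith)).const_mul E)
    simpa using this
  obtain ⟨k, hk1, hk2, hk3⟩ := ((hlim.eventually_lt_const hη).and
    ((eventually_ge_atTop (2 * R)).and (eventually_ge_atTop 4))).exists
  have hk : 0 < k := by linarith
  refine ⟨2 * k, by linarith, fun u v h hw => ?_⟩
  by_contra! hcon
  have hb : ∀ x, ‖x‖ ≤ 2 * k → ∀ t, |t| ≤ (2 * k) ^ 2 → u x t + v x t ≤ A := fun x hx t ht => by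
    have h2 := hcon x t hx ht
    have h3 : 0 ≤ u x t + v x t := add_nonneg (h.nonneg_left x t) (h.nonneg_right x t)
    have h4 := Real.rpow_le_rpow (by positivity) h2 hq0.le
    rwa [← Real.rpow_mul h3, hq, mul_one_div_cancel hr.ne', Real.rpow_one] at h4
  have hlow := hG u v h (fun x hx t ht => hb x (by linarith) t (by
    rw [abs_le]; constructor <;> nlinarith [ht.1, ht.2])) hw
  set c := k ^ q with hc
  have hc0 : 0 < c := by positivity
  have hck : c ^ r = k := by
    rw [hc, ← Real.rpow_mul hk.le, hq, one_div_mul_cancel hr.ne', Real.rpow_one]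
  have hsc := h.scale hr 0 0 hc0 hck
  have hm0 : ∀ t : ℝ, 4 ≤ |t| → max (1 - (t / 4) ^ 2) 0 = 0 := fun t ht =>
    max_eq_right (by nlinarith [sq_abs t])
  have hdt : ∀ t : ℝ, 4 ≤ |t| → dtcut 0 (t / 4) = 0 := fun t ht => by simp [dtcut, hm0 t ht]
  have htc : ∀ t : ℝ, 4 ≤ |t| → θ t = 0 := fun t ht => by simp [hθ, tcut, hm0 t ht]
  have hk48 : ∀ t : ℝ, 1 / 2 ≤ |t| → 4 ≤ |k ^ 2 * t| := fun t ht => by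
    rw [abs_mul, abs_of_pos (by positivity)]; nlinarith [abs_nonneg t]
  have hd1 : ∀ t, HasDerivAt θ (dtcut 0 (t / 4) / 4) t := fun t => by
    refine ((hasDerivAt_tcut_succ 0 (t / 4)).comp t ((hasDerivAt_id t).div_const 4)).congr_deriv ?_
    ring
  have hen := hE _ _ (c * A) (by positivity) hsc (fun x hx t ht => by
      rw [← mul_add]
      refine mul_le_mul_of_nonneg_left (hb _ ?_ _ ?_) hc0.le
      · rw [zero_add, norm_smul, Real.norm_of_nonneg hk.le]; nlinarith
      · rw [zero_add, abs_mul, abs_of_pos (by positivity : 0 < k ^ 2)]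
        have := abs_le.2 ht
        nlinarith [sq_nonneg k])
    (fun x => cut R (k • x) ^ (m + 3)) (fun t => θ (k ^ 2 * t))
    (fun t => k ^ 2 * (dtcut 0 (k ^ 2 * t / 4) / 4))
    (((continuous_cut R).comp (continuous_const_smul k)).pow _)
    (fun x hx => by
      rw [cut_eq_zero (by linarith), zero_pow (by omega)]
      rw [norm_smul, Real.norm_of_nonneg hk.le]; nlinarith)
    (fun t => by
      refine ((hd1 (k ^ 2 * t)).comp t ((hasDerivAt_id t).const_mul (k ^ 2))).congr_deriv ?_
      ring)
    (by have := continuous_dtcut 0; fun_prop)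
    (fun t ht => htc _ (hk48 t ht)) (k ^ (-σ)) (by positivity)
  have h16 : (4 : ℝ) ≤ k ^ 2 := by nlinarith
  have e1 : (dint (-1) 1 fun x t => k ^ 2 * (dtcut 0 (k ^ 2 * t / 4) / 4) *
      ((c * u (0 + k • x) (0 + k ^ 2 * t) + c * v (0 + k • x) (0 + k ^ 2 * t)) *
        cut R (k • x) ^ (m + 3))) = c * (k ^ n)⁻¹ *
      dint (-4) 4 fun x t => dtcut 0 (t / 4) / 4 * ((u x t + v x t) * cut R x ^ (m + 3)) := by
    have := dint_comp_scale hk fun x t =>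
      dtcut 0 (t / 4) / 4 * ((u x t + v x t) * cut R x ^ (m + 3))
    rw [dint_eq_of_support h16 fun x t ht => by rw [hdt t ht]; simp] at this
    rw [show c * (k ^ n)⁻¹ = c * k ^ 2 * ((k ^ n)⁻¹ * (k ^ 2)⁻¹) by field_simp, mul_assoc _ _
        (dint _ _ _),
      ← this, ← dint_const_mul]
    refine dint_congr (by norm_num) fun x t _ => ?_
    rw [zero_add, zero_add]; ring
  have e2 : (dint (-1) 1 fun (x : Eu n) t => θ (k ^ 2 * t) ^ 2 * (cut R (k • x) ^ (m + 3)) ^ 2)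
      = (k ^ n)⁻¹ * (k ^ 2)⁻¹ * E := by
    rw [dint_comp_scale hk fun (x : Eu n) t => θ t ^ 2 * (cut R x ^ (m + 3)) ^ 2,
      dint_eq_of_support h16 fun x t ht => by rw [htc t ht]; simp]
  rw [e2, e1, abs_mul, abs_of_pos (by positivity)] at hen
  have e3 := (mul_le_mul_of_nonneg_left hlow (by positivity : 0 ≤ c * (k ^ n)⁻¹)).trans hen
  have e4 : k ^ (-σ) * (C * (c * A)) + (k ^ (-σ))⁻¹ * ((k ^ n)⁻¹ * (k ^ 2)⁻¹ * E)
      = c * (k ^ n)⁻¹ * (C * A * k ^ (-(σ - n)) + E * k ^ (-(2 + q - σ))) := by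
    rw [show -(σ - (n : ℝ)) = -σ + n by ring, show -(2 + q - σ) = -((2 : ℕ) : ℝ) + -q + σ by
      push_cast; ring, Real.rpow_add hk, Real.rpow_add hk, Real.rpow_add hk, Real.rpow_natCast,
      Real.rpow_neg hk.le, Real.rpow_neg hk.le, Real.rpow_neg hk.le, Real.rpow_natCast, ← hc]
    field_simp
  rw [e4] at e3
  exact absurd (le_of_mul_le_mul_left e3 (by positivity)) (not_le.2 hk1)

end Key

section Univ

variable {n : ℕ}

theorem sqrt_abs_add_le (s t : ℝ) : √|s + t| ≤ √|s| + √|t| :=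
  Real.sqrt_le_iff.2 ⟨by positivity, (abs_add_le s t).trans (by
    nlinarith [Real.sq_sqrt (abs_nonneg s), Real.sq_sqrt (abs_nonneg t),
      mul_nonneg (Real.sqrt_nonneg |s|) (Real.sqrt_nonneg |t|)])⟩

/-- Doubling argument. -/
theorem exists_rpow_le_of_bdd (n : ℕ) {r lam : ℝ} (hr : 0 < r) (h0 : 0 ≤ lam) (h1 : lam < 1)
    (hn : (n : ℝ) < 2 + 1 / r) : ∃ C, 0 < C ∧ ∀ (u v : Eu n → ℝ → ℝ) (N : ℝ), Sol r lam u v →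
      (∀ x, ‖x‖ ≤ 1 → ∀ t, |t| ≤ 1 → u x t + v x t ≤ N) → (u 0 0 + v 0 0) ^ r ≤ C := by
  obtain ⟨K, hK, hkey⟩ := exists_scale_not_le n hr h0 h1 hn
  refine ⟨4 * K, by positivity, fun u v N h hb => ?_⟩
  by_contra! hlt
  have hw : ∀ x t, 0 ≤ u x t + v x t := fun x t =>
    add_nonneg (h.nonneg_left x t) (h.nonneg_right x t)
  set d : Eu n × ℝ → ℝ := fun z => min (1 - ‖z.1‖) (1 - √|z.2|) with hd
  set M : Eu n × ℝ → ℝ := fun z => (u z.1 z.2 + v z.1 z.2) ^ r * d z with hM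
  set Q : Set (Eu n × ℝ) := {z | 0 ≤ d z} with hQ
  have hQx : ∀ z ∈ Q, ‖z.1‖ ≤ 1 ∧ |z.2| ≤ 1 := fun z hz => by
    have h2 := le_min_iff.1 (show 0 ≤ min (1 - ‖z.1‖) (1 - √|z.2|) from hz)
    refine ⟨by linarith, ?_⟩
    have h3 : √|z.2| ≤ 1 := by linarith
    rwa [Real.sqrt_le_one] at h3
  have hd1 : ∀ z, d z ≤ 1 := fun z => (min_le_left _ _).trans (by linarith [norm_nonneg z.1])
  have hbdd : BddAbove (M '' Q) := by
    refine ⟨N ^ r, ?_⟩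
    rintro _ ⟨z, hz, rfl⟩
    have h2 := hb z.1 (hQx z hz).1 z.2 (hQx z hz).2
    have h3 := Real.rpow_le_rpow (hw _ _) h2 hr.le
    have h4 := Real.rpow_nonneg (hw z.1 z.2) r
    calc M z ≤ (u z.1 z.2 + v z.1 z.2) ^ r * 1 := mul_le_mul_of_nonneg_left (hd1 z) h4
      _ ≤ N ^ r := by rwa [mul_one]
  have hd0 : d 0 = 1 := by simp [hd]
  have h0Q : (0 : Eu n × ℝ) ∈ Q := by simp [hQ, hd0]
  set S := sSup (M '' Q) with hS
  have hS0 : 4 * K < S := by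
    have h2 : M 0 ≤ S := le_csSup hbdd (mem_image_of_mem _ h0Q)
    have h3 : M 0 = (u 0 0 + v 0 0) ^ r := by simp [hM, hd0]
    linarith
  obtain ⟨_, ⟨z, hz, rfl⟩, hzS⟩ := exists_lt_of_lt_csSup (⟨_, mem_image_of_mem M h0Q⟩)
    (show S / 2 < S by linarith)
  set a := u z.1 z.2 + v z.1 z.2 with ha
  have hMz : M z = a ^ r * d z := rfl
  have ha0 : 0 < a := by
    refine (hw _ _).lt_of_ne fun h2 => ?_
    have : M z = 0 := by rw [hMz, ha, ← h2, Real.zero_rpow hr.ne', zero_mul]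
    linarith
  have har : 0 < a ^ r := by positivity
  have hdz : 0 < d z := by
    by_contra! h2
    have := mul_nonpos_of_nonneg_of_nonpos har.le h2
    linarith
  set c := a⁻¹ with hc
  have hc0 : 0 < c := by positivity
  have hμ : 0 < c ^ r := by positivity
  have hμa : c ^ r * a ^ r = 1 := by
    rw [← Real.mul_rpow hc0.le ha0.le, hc, inv_mul_cancel₀ ha0.ne', Real.one_rpow]
  have hμK : c ^ r * K ≤ d z / 2 := by
    have : K ≤ a ^ r * (d z / 2) := by linarith
    calc c ^ r * K ≤ c ^ r * (a ^ r * (d z / 2)) := by gcongr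
      _ = d z / 2 := by rw [← mul_assoc, hμa, one_mul]
  obtain ⟨x, t, hx, ht, h4⟩ := hkey _ _ (h.scale hr z.1 z.2 hc0 rfl) (by
    simp only [smul_zero, mul_zero, add_zero]
    rw [← mul_add, ← ha, hc, inv_mul_cancel₀ ha0.ne'])
  set y : Eu n × ℝ := (z.1 + c ^ r • x, z.2 + (c ^ r) ^ 2 * t) with hy
  have hdy : d z / 2 ≤ d y := by
    have e1 : ‖y.1‖ ≤ ‖z.1‖ + d z / 2 := by
      refine (norm_add_le _ _).trans (add_le_add_right ?_ _)
      rw [norm_smul, Real.norm_of_nonneg hμ.le]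
      exact (mul_le_mul_of_nonneg_left hx hμ.le).trans hμK
    have e2 : √|y.2| ≤ √|z.2| + d z / 2 := by
      refine (sqrt_abs_add_le _ _).trans (add_le_add_right ?_ _)
      refine Real.sqrt_le_iff.2 ⟨by positivity, ?_⟩
      rw [abs_mul, abs_of_pos (by positivity)]
      calc (c ^ r) ^ 2 * |t| ≤ (c ^ r) ^ 2 * K ^ 2 := by gcongr
        _ = (c ^ r * K) ^ 2 := by ring
        _ ≤ _ := by gcongr
    have e3 : d z ≤ 1 - ‖z.1‖ := min_le_left _ _
    have e4 : d z ≤ 1 - √|z.2| := min_le_right _ _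
    exact le_min (by linarith) (by linarith)
  have hyQ : y ∈ Q := by
    show 0 ≤ d y
    linarith
  have h5 : M y ≤ S := le_csSup hbdd (mem_image_of_mem _ hyQ)
  have h6 : (u y.1 y.2 + v y.1 y.2) ^ r * (d z / 2) ≤ 4 * a ^ r * (d z / 2) := by
    calc (u y.1 y.2 + v y.1 y.2) ^ r * (d z / 2) ≤ (u y.1 y.2 + v y.1 y.2) ^ r * d y :=
          mul_le_mul_of_nonneg_left hdy (Real.rpow_nonneg (hw _ _) r)
      _ ≤ S := h5
      _ ≤ _ := by linarith
  have h7 := le_of_mul_le_mul_right h6 (by positivity)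
  rw [← mul_add, Real.mul_rpow hc0.le (hw _ _)] at h4
  have h8 := mul_le_mul_of_nonneg_left h7 hμ.le
  have h9 : c ^ r * (4 * a ^ r) = 4 := by linarith
  rw [h9] at h8
  exact absurd h8 (not_le.2 h4)

theorem exists_rpow_mul_le (n : ℕ) {r lam : ℝ} (hr : 0 < r) (h0 : 0 ≤ lam) (h1 : lam < 1)
    (hn : (n : ℝ) < 2 + 1 / r) : ∃ C, 0 < C ∧ ∀ (u v : Eu n → ℝ → ℝ) (N : ℝ), Sol r lam u v →
      ∀ (x₀ : Eu n) (t₀ ρ : ℝ), 0 < ρ →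
      (∀ x, ‖x - x₀‖ ≤ ρ → ∀ t, |t - t₀| ≤ ρ ^ 2 → u x t + v x t ≤ N) →
      (u x₀ t₀ + v x₀ t₀) ^ r * ρ ≤ C := by
  obtain ⟨C, hC, hU⟩ := exists_rpow_le_of_bdd n hr h0 h1 hn
  refine ⟨C, hC, fun u v N h x₀ t₀ ρ hρ hb => ?_⟩
  set c := ρ ^ (1 / r) with hc
  have hc0 : 0 < c := by positivity
  have hcr : c ^ r = ρ := by
    rw [hc, ← Real.rpow_mul hρ.le, one_div_mul_cancel hr.ne', Real.rpow_one]
  have h2 := hU _ _ (c * N) (h.scale hr x₀ t₀ hc0 hcr) fun x hx t ht => by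
    rw [← mul_add]
    refine mul_le_mul_of_nonneg_left (hb _ ?_ _ ?_) hc0.le
    · rw [add_sub_cancel_left, norm_smul, Real.norm_of_nonneg hρ.le]
      exact mul_le_of_le_one_right hρ.le hx
    · rw [add_sub_cancel_left, abs_mul, abs_of_pos (by positivity)]
      exact mul_le_of_le_one_right (by positivity) ht
  simp only [smul_zero, mul_zero, add_zero] at h2
  rw [← mul_add, Real.mul_rpow hc0.le (add_nonneg (h.nonneg_left _ _) (h.nonneg_right _ _)), hcr,
    mul_comm] at h2
  exact h2

end Univ

section Har

variable {n : ℕ}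

/-- The set of points near which a function is bounded above. -/
def LB (w : Eu n → ℝ → ℝ) : Set (Eu n × ℝ) := {z | ∃ N, ∀ᶠ z' in 𝓝 z, w z'.1 z'.2 ≤ N}

theorem isOpen_LB (w : Eu n → ℝ → ℝ) : IsOpen (LB w) := by
  refine isOpen_iff_mem_nhds.2 fun z ⟨N, hN⟩ => ?_
  filter_upwards [eventually_eventually_nhds.2 hN] with z' hz' using ⟨N, hz'⟩

theorem exists_bound_of_compact {w : Eu n → ℝ → ℝ} {s : Set (Eu n × ℝ)} (hs : IsCompact s)
    (h : s ⊆ LB w) : ∃ N, ∀ᶠ z in 𝓝ˢ s, w z.1 z.2 ≤ N := by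
  refine hs.induction_on (p := fun s => ∃ N, ∀ᶠ z : Eu n × ℝ in 𝓝ˢ s, w z.1 z.2 ≤ N) ⟨0, by simp⟩
    (fun s t hst ⟨N, hN⟩ => ⟨N, hN.filter_mono (nhdsSet_mono hst)⟩)
    (fun s t ⟨N, hN⟩ ⟨M, hM⟩ => ⟨max N M, ?_⟩) fun z hz => ?_
  · rw [nhdsSet_union, eventually_sup]
    exact ⟨hN.mono fun z hz => hz.trans (le_max_left _ _),
      hM.mono fun z hz => hz.trans (le_max_right _ _)⟩
  · obtain ⟨N, hN⟩ := h hz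
    refine ⟨{z' | ∀ᶠ z'' : Eu n × ℝ in 𝓝 z', w z''.1 z''.2 ≤ N}, mem_nhdsWithin_of_mem_nhds
      (eventually_eventually_nhds.2 hN), N, ?_⟩
    rw [eventually_nhdsSet_iff_forall]
    exact fun z' hz' => hz'

theorem exists_bound_of_prod {w : Eu n → ℝ → ℝ} {x : Eu n} {R a b : ℝ} (hR : 0 ≤ R) (hab : a ≤ b)
    (h : ∀ y, ‖y - x‖ ≤ R → ∀ t ∈ Icc a b, (y, t) ∈ LB w) : ∃ η N, 0 < η ∧
      ∀ y, ‖y - x‖ ≤ R + η → ∀ t ∈ Icc (a - η) (b + η), w y t ≤ N := by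
  obtain ⟨N, hN⟩ := exists_bound_of_compact ((isCompact_closedBall x R).prod
    (isCompact_Icc (a := a) (b := b))) (fun z hz => h z.1 (mem_closedBall_iff_norm.1 hz.1) z.2 hz.2)
  obtain ⟨O, hO, hsO, hOb⟩ := eventually_nhdsSet_iff_exists.1 hN
  obtain ⟨U, V, hU, hV, hxU, htV, hUV⟩ := generalized_tube_lemma (isCompact_closedBall x R)
    (isCompact_Icc (a := a) (b := b)) hO hsO
  obtain ⟨δ, hδ, hδU⟩ := (isCompact_closedBall x R).exists_cthickening_subset_open hU hxU
  obtain ⟨ε, hε, hεV⟩ := (isCompact_Icc (a := a) (b := b)).exists_cthickening_subset_open hV htV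
  rw [cthickening_closedBall hδ.le hR] at hδU
  rw [Real.Icc_eq_closedBall, cthickening_closedBall hε.le (by linarith)] at hεV
  refine ⟨min δ ε, N, lt_min hδ hε, fun y hy t ht => hOb (y, t) (hUV ⟨hδU ?_, hεV ?_⟩)⟩
  · rw [mem_closedBall_iff_norm]; linarith [min_le_left δ ε]
  · rw [Real.closedBall_eq_Icc]
    constructor <;> linarith [min_le_right δ ε, ht.1, ht.2]

theorem exists_harnack_of_bdd (n : ℕ) {r lam : ℝ} (hr : 0 < r) (h0 : 0 ≤ lam) (h1 : lam < 1)
    (hn : (n : ℝ) < 2 + 1 / r) {K : ℝ} (hK : 0 ≤ K) : ∃ C, 0 < C ∧ ∀ (u v : Eu n → ℝ → ℝ) (N η : ℝ),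
      Sol r lam u v → ∀ x₀ : Eu n, ‖x₀‖ ≤ K → 0 < η →
      (∀ x, ‖x‖ ≤ 3 → ∀ t ∈ Icc (-3 : ℝ) 3, u x t + v x t ≤ N) →
      (∀ x, ‖x - x₀‖ ≤ 2 * (K + 2) + η → ∀ t ∈ Icc (-η) (1 / (n + 1) + η), u x t + v x t ≤ N) →
      u 0 0 + v 0 0 ≤ C * (u x₀ (1 / (n + 1)) + v x₀ (1 / (n + 1))) := by
  obtain ⟨C0, hC0, hU⟩ := exists_rpow_mul_le n hr h0 h1 hn
  set p := 2 * r + 1 with hp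
  have hp1 : 1 < p := by linarith
  set A := C0 ^ (1 / r) with hA
  have hA0 : 0 < A := by positivity
  obtain ⟨C1, hC1, hD⟩ := exists_le_dint n hp1 hA0
  obtain ⟨C2, hC2, hE⟩ := exists_integral_cut_le n
  obtain ⟨C3, hC3, hF⟩ := exists_integral_le_of_powSol n (R := 2 * (K + 2)) (R' := K + 2)
    (τ := 1 / (n + 1)) (by positivity) (by linarith)
    (by
      have : 4 * (n : ℝ) * (1 / (n + 1)) ≤ 4 := by
        rw [mul_one_div, div_le_iff₀ (by positivity)]; linarith
      nlinarith) (by nlinarith)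
  refine ⟨C1 * (C2 * C3), by positivity, fun u v N η h x₀ hx₀ hη hb hb' => ?_⟩
  set c := (1 - lam) / 2 ^ p with hc
  have hc0 : 0 < c := div_pos (by linarith) (by positivity)
  have hps := h.powSol hr h0 h1
  rw [← hp, ← hc] at hps
  have e1 := hD c _ _ hc0.le hps fun x hx t ht => by
    have h2 := hU u v N h x t 1 one_pos fun y hy s hs => hb y (by
      have := norm_sub_norm_le y x
      linarith) s (by
      have := abs_le.1 hs
      constructor <;> linarith [ht.1, ht.2])
    rw [mul_one] at h2
    have h3 := Real.rpow_le_rpow (Real.rpow_nonneg (hps.nonneg x t) r) h2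
      (by positivity : 0 ≤ 1 / r)
    rwa [← Real.rpow_mul (hps.nonneg x t), mul_one_div_cancel hr.ne', Real.rpow_one] at h3
  have e2 := hE p c _ _ (by linarith) hc0.le hps N fun x hx t ht =>
    hb x hx t ⟨by linarith [ht.1], by linarith [ht.2]⟩
  have hs := h.scale hr x₀ 0 one_pos (Real.one_rpow r)
  simp only [one_mul, one_smul, one_pow, zero_add] at hs
  have e3 := hF p c _ _ (by linarith) hc0.le (hs.powSol hr h0 h1) η N hη
    (fun x hx t ht => hb' (x₀ + x) (by rwa [add_sub_cancel_left]) t ht)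
    (fun x => cut 2 (x₀ + x) ^ 3) (((continuous_cut 2).comp (continuous_const_add x₀)).pow 3)
    (fun x => pow_nonneg (cut_nonneg _ _) 3)
        (fun x => pow_le_one₀ (cut_nonneg _ _) (cut_le_one _ _))
    (fun x hx => by
      rw [cut_eq_zero two_pos, zero_pow (by norm_num)]
      have := norm_sub_norm_le x (-x₀)
      rw [norm_neg, sub_neg_eq_add, add_comm x] at this
      linarith)
  rw [integral_add_left_eq_self (fun x => (u x 0 + v x 0) * cut 2 x ^ 3) x₀] at e3
  simp only [add_zero] at e3
  calc _ ≤ _ := e1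
    _ ≤ C1 * (C2 * (C3 * _)) := by gcongr; exact e2.trans (by gcongr)
    _ = _ := by ring

theorem exists_harnack (n : ℕ) {r lam : ℝ} (hr : 0 < r) (h0 : 0 ≤ lam) (h1 : lam < 1)
    (hn : (n : ℝ) < 2 + 1 / r) {K : ℝ} (hK : 0 ≤ K) : ∃ C, 0 < C ∧ ∀ (u v : Eu n → ℝ → ℝ),
      Sol r lam u v → ∀ (y x : Eu n) (t ℓ : ℝ), 0 < ℓ → ‖x - y‖ ≤ K * ℓ →
      (∀ x', ‖x' - y‖ ≤ 3 * ℓ → ∀ s ∈ Icc (t - 3 * ℓ ^ 2) (t + 3 * ℓ ^ 2),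
        (x', s) ∈ LB fun x t => u x t + v x t) →
      (∀ x', ‖x' - x‖ ≤ 2 * (K + 2) * ℓ → ∀ s ∈ Icc t (t + ℓ ^ 2 / (n + 1)),
        (x', s) ∈ LB fun x t => u x t + v x t) →
      u y t + v y t ≤ C * (u x (t + ℓ ^ 2 / (n + 1)) + v x (t + ℓ ^ 2 / (n + 1))) := by
  obtain ⟨C, hC, hH⟩ := exists_harnack_of_bdd n hr h0 h1 hn hK
  refine ⟨C, hC, fun u v h y x t ℓ hℓ hxy hg hg' => ?_⟩
  have hℓ2 : 0 < ℓ ^ 2 := by positivity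
  obtain ⟨η₁, N₁, hη₁, hb₁⟩ := exists_bound_of_prod (by positivity) (by linarith) hg
  obtain ⟨η, N₂, hη, hb₂⟩ := exists_bound_of_prod (by positivity)
    (le_add_of_nonneg_right (by positivity)) hg'
  set c := ℓ ^ (1 / r) with hc
  have hc0 : 0 < c := by positivity
  have hcr : c ^ r = ℓ := by
    rw [hc, ← Real.rpow_mul hℓ.le, one_div_mul_cancel hr.ne', Real.rpow_one]
  set ε := min (η / ℓ) (η / ℓ ^ 2) with hε
  have hε0 : 0 < ε := lt_min (by positivity) (by positivity)
  have hε1 : ε * ℓ ≤ η := (le_div_iff₀ hℓ).1 (min_le_left _ _)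
  have hε2 : ε * ℓ ^ 2 ≤ η := (le_div_iff₀ hℓ2).1 (min_le_right _ _)
  have hx : ℓ • ℓ⁻¹ • (x - y) = x - y := smul_inv_smul₀ hℓ.ne' _
  have key := hH _ _ (c * max N₁ N₂) ε (h.scale hr y t hc0 hcr) (ℓ⁻¹ • (x - y)) (by
      rw [norm_smul, norm_inv, Real.norm_of_nonneg hℓ.le, inv_mul_le_iff₀ hℓ]
      linarith) hε0 (fun x' hx' s hs => by
      rw [← mul_add]
      refine mul_le_mul_of_nonneg_left ((hb₁ _ ?_ _ ?_).trans (le_max_left _ _)) hc0.le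
      · rw [add_sub_cancel_left, norm_smul, Real.norm_of_nonneg hℓ.le]
        nlinarith
      · constructor <;> nlinarith [hs.1, hs.2]) (fun x' hx' s hs => by
      rw [← mul_add]
      refine mul_le_mul_of_nonneg_left ((hb₂ _ ?_ _ ?_).trans (le_max_right _ _)) hc0.le
      · rw [show y + ℓ • x' - x = ℓ • (x' - ℓ⁻¹ • (x - y)) by rw [smul_sub, hx]; abel, norm_smul,
          Real.norm_of_nonneg hℓ.le]
        nlinarith
      · have e : ℓ ^ 2 / (n + 1 : ℝ) = ℓ ^ 2 * (1 / (n + 1)) := by ring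
        rw [e]
        constructor <;> nlinarith [hs.1, hs.2])
  have e : ℓ ^ 2 * (1 / (n + 1 : ℝ)) = ℓ ^ 2 / (n + 1) := by ring
  simp only [smul_zero, mul_zero, add_zero, hx, add_sub_cancel, e] at key
  refine le_of_mul_le_mul_left ?_ hc0
  linarith

end Har

section Liouville

variable {n : ℕ}

/-- Points through which both the time line and the space slice carry a quantitative bound. -/
def lineBound (w : Eu n → ℝ → ℝ) (m : ℕ) : Set (Eu n × ℝ) :=
  {z | (∀ s, |s - z.2| < 1 / (m + 1 : ℝ) → w z.1 s ≤ m) ∧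
    ∀ y, ‖y - z.1‖ < 1 / (m + 1 : ℝ) → w y z.2 ≤ m}

theorem isClosed_lineBound {w : Eu n → ℝ → ℝ} (hx : ∀ t, Continuous fun x => w x t)
    (ht : ∀ x, Continuous fun t => w x t) (m : ℕ) : IsClosed (lineBound w m) := by
  refine isClosed_of_closure_subset fun z hz => ⟨fun s hs => ?_, fun y hy => ?_⟩
  · refine isClosed_Iic.closure_subset (s := Iic (m : ℝ)) ?_
    have hc : ContinuousAt (fun z' : Eu n × ℝ => w z'.1 s) z :=
      ((hx s).comp continuous_fst).continuousAt
    refine mem_closure_iff_frequently.2 ?_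
    refine (hc.tendsto.frequently (p := fun a => a ∈ Iic (m : ℝ)) ?_)
    have h1 : ∀ᶠ z' : Eu n × ℝ in 𝓝 z, |s - z'.2| < 1 / (m + 1 : ℝ) :=
      (Continuous.abs (by fun_prop : Continuous fun z' : Eu n × ℝ => s -
          z'.2)).continuousAt.eventually_lt_const hs
    exact ((mem_closure_iff_frequently.1 hz).and_eventually h1).mono fun z' h => h.1.1 s h.2
  · refine isClosed_Iic.closure_subset (s := Iic (m : ℝ)) ?_
    have hc : ContinuousAt (fun z' : Eu n × ℝ => w y z'.2) z :=
      ((ht y).comp continuous_snd).continuousAt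
    refine mem_closure_iff_frequently.2 ?_
    refine (hc.tendsto.frequently (p := fun a => a ∈ Iic (m : ℝ)) ?_)
    have h1 : ∀ᶠ z' : Eu n × ℝ in 𝓝 z, ‖y - z'.1‖ < 1 / (m + 1 : ℝ) :=
      (Continuous.norm (by fun_prop : Continuous fun z' : Eu n × ℝ => y -
          z'.1)).continuousAt.eventually_lt_const hy
    exact ((mem_closure_iff_frequently.1 hz).and_eventually h1).mono fun z' h => h.1.2 y h.2

theorem exists_mem_lineBound {w : Eu n → ℝ → ℝ} (hx : ∀ t, Continuous fun x => w x t)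
    (ht : ∀ x, Continuous fun t => w x t) (z : Eu n × ℝ) : ∃ m, z ∈ lineBound w m := by
  obtain ⟨δ, hδ, h1⟩ := Metric.eventually_nhds_iff.1
    ((ht z.1).continuousAt.eventually_lt_const (lt_add_one (w z.1 z.2)))
  obtain ⟨ε, hε, h2⟩ := Metric.eventually_nhds_iff.1
    ((hx z.2).continuousAt.eventually_lt_const (lt_add_one (w z.1 z.2)))
  obtain ⟨m₁, hm₁⟩ := exists_nat_one_div_lt (lt_min hδ hε)
  obtain ⟨m₂, hm₂⟩ := exists_nat_ge (w z.1 z.2 + 1)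
  refine ⟨max m₁ m₂, ?_⟩
  have e1 : 1 / (((max m₁ m₂ : ℕ) : ℝ) + 1) ≤ 1 / ((m₁ : ℝ) + 1) := by
    gcongr; exact le_max_left _ _
  have e2 : (m₂ : ℝ) ≤ ((max m₁ m₂ : ℕ) : ℝ) := by
    gcongr; exact le_max_right _ _
  refine ⟨fun s hs => ?_, fun y hy => ?_⟩
  · have := h1 (show dist s z.2 < δ by
      rw [Real.dist_eq]; linarith [min_le_left δ ε])
    linarith
  · have := h2 (show dist y z.1 < ε by
      rw [dist_eq_norm]; linarith [min_le_right δ ε])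
    linarith

theorem Sol.LB_eq_univ {r lam : ℝ} (hr : 0 < r) (h0 : 0 ≤ lam) (h1 : lam < 1)
    (hn : (n : ℝ) < 2 + 1 / r) {u v : Eu n → ℝ → ℝ} (h : Sol r lam u v) :
    LB (fun x t => u x t + v x t) = univ := by
  have hps := h.powSol hr h0 h1
  set w : Eu n → ℝ → ℝ := fun x t => u x t + v x t with hw
  have hwx : ∀ t, Continuous fun x => w x t := fun t => (hps.sol.cx t).continuous
  have hwt : ∀ x, Continuous fun t => w x t := fun x => (hps.sol.ct x).continuous
  obtain ⟨C, hC, hH⟩ := exists_harnack n hr h0 h1 hn le_rfl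
  obtain ⟨D, hD, hH'⟩ := exists_harnack n hr h0 h1 hn (show (0 : ℝ) ≤ 5 by norm_num)
  by_contra hne
  have hZ : IsClosed (LB w)ᶜ := (isOpen_LB w).isClosed_compl
  obtain ⟨m, U, hU, ⟨⟨xs, ts⟩, hzZ, hzU⟩, hUm⟩ := exists_isOpen_inter_subset hZ.isLocallyClosed
    (nonempty_compl.2 hne)
    (fun m => (isClosed_lineBound hwx hwt m).preimage continuous_subtype_val)
    fun z _ => exists_mem_lineBound hwx hwt z
  obtain ⟨ρ₀, hρ₀, hρU⟩ := Metric.nhds_basis_closedBall.mem_iff.1 (hU.mem_nhds hzU)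
  obtain ⟨ρ, hρ, hρ1, hρm⟩ : ∃ ρ, 0 < ρ ∧ ρ ≤ ρ₀ ∧ 4 * ρ ≤ 1 / (m + 1 : ℝ) :=
    ⟨min ρ₀ (1 / (m + 1 : ℝ) / 4), lt_min hρ₀ (by positivity), min_le_left _ _, by
      linarith [min_le_right ρ₀ (1 / (m + 1 : ℝ) / 4)]⟩
  have hm1 : 1 / (m + 1 : ℝ) ≤ 1 := by
    rw [div_le_one (by positivity)]; linarith [Nat.cast_nonneg (α := ℝ) m]
  have hO : ∀ x t, ‖x - xs‖ ≤ ρ → |t - ts| ≤ ρ → (x, t) ∉ LB w → (x, t) ∈ lineBound w m :=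
    fun x t hx ht hz => hUm ⟨hz, hρU (by
      rw [mem_closedBall, Prod.dist_eq, dist_eq_norm, Real.dist_eq]
      exact max_le (hx.trans hρ1) (ht.trans hρ1))⟩
  set Q : Set (Eu n × ℝ) := (LB w)ᶜ ∩ closedBall (xs, ts) ρ with hQ
  have hQmem : ∀ x t, (x, t) ∈ Q ↔ (x, t) ∉ LB w ∧ ‖x - xs‖ ≤ ρ ∧ |t - ts| ≤ ρ := fun x t => by
    rw [hQ, mem_inter_iff, mem_closedBall, Prod.dist_eq, dist_eq_norm, Real.dist_eq, max_le_iff]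
    rfl
  have hQc : IsCompact Q := (isCompact_closedBall _ _).inter_left hZ
  set X : Set (Eu n) := Prod.fst '' Q with hX
  have hXc : IsCompact X := hQc.image continuous_fst
  have hxsX : xs ∈ X := ⟨(xs, ts), (hQmem _ _).2
      ⟨hzZ, by simpa using hρ.le, by simpa using hρ.le⟩, rfl⟩
  have hXw : ∀ x ∈ X, ∀ t, |t - ts| ≤ ρ → w x t ≤ m := by
    rintro _ ⟨⟨x, s⟩, hz, rfl⟩ t ht
    obtain ⟨e1, e2, e3⟩ := (hQmem x s).1 hz
    refine (hO x s e2 e3 e1).1 t ?_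
    have := abs_sub_le t ts s
    rw [abs_sub_comm ts s] at this
    show |t - s| < _
    linarith
  have hXg : ∀ x, ‖x - xs‖ ≤ ρ → x ∉ X → ∀ t, |t - ts| ≤ ρ → (x, t) ∈ LB w :=
      fun x hx hxX t ht => by
    by_contra hc
    exact hxX ⟨(x, t), (hQmem _ _).2 ⟨hc, hx, ht⟩, rfl⟩
  have hTw : ∀ s ∈ Prod.snd '' Q, ∀ y, ‖y - xs‖ ≤ ρ → w y s ≤ m := by
    rintro _ ⟨⟨x, s⟩, hz, rfl⟩ y hy
    obtain ⟨e1, e2, e3⟩ := (hQmem x s).1 hz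
    refine (hO x s e2 e3 e1).2 y ?_
    have := norm_sub_le_norm_sub_add_norm_sub y xs x
    rw [norm_sub_rev xs x] at this
    show ‖y - x‖ < _
    linarith
  have hTg : ∀ t, |t - ts| ≤ ρ → t ∉ Prod.snd '' Q → ∀ x, ‖x - xs‖ ≤ ρ → (x, t) ∈ LB w :=
    fun t ht htT x hx => by
      by_contra hc
      exact htT ⟨(x, t), (hQmem _ _).2 ⟨hc, hx, ht⟩, rfl⟩
  refine hzZ ⟨max 1 (max C D) * m, ?_⟩
  have hle1 : (m : ℝ) ≤ max 1 (max C D) * m :=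
    le_mul_of_one_le_left (Nat.cast_nonneg m) (le_max_left _ _)
  have hleC : C * m ≤ max 1 (max C D) * m := by
    gcongr; exact (le_max_left _ _).trans (le_max_right _ _)
  have hleD : D * m ≤ max 1 (max C D) * m := by
    gcongr; exact (le_max_right _ _).trans (le_max_right _ _)
  refine Metric.eventually_nhds_iff.2 ⟨ρ / 5, by positivity, ?_⟩
  rintro ⟨y, t⟩ hyt
  rw [Prod.dist_eq, dist_eq_norm, Real.dist_eq, max_lt_iff] at hyt
  obtain ⟨hy, ht⟩ := hyt
  show w y t ≤ _
  change ‖y - xs‖ < ρ / 5 at hy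
  change |t - ts| < ρ / 5 at ht
  have htabs := abs_lt.1 ht
  by_cases hyX : y ∈ X
  · exact (hXw y hyX t (by linarith)).trans hle1
  by_cases htT : t ∈ Prod.snd '' Q
  · exact (hTw t htT y (by linarith)).trans hle1
  obtain ⟨x, hxX, hxd⟩ := hXc.exists_infDist_eq_dist ⟨xs, hxsX⟩ y
  set δ := infDist y X with hδ
  have hδ0 : 0 < δ := (hXc.isClosed.notMem_iff_infDist_pos ⟨xs, hxsX⟩).1 hyX
  have hδ1 : δ < ρ / 5 := by
    have := infDist_le_dist_of_mem (x := y) hxsX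
    rw [dist_eq_norm] at this
    linarith
  have hδX : ∀ x', ‖x' - y‖ < δ → x' ∉ X := fun x' hx' hc => by
    have := infDist_le_dist_of_mem (x := y) hc
    rw [dist_comm, dist_eq_norm] at this
    linarith
  have hδ2 : δ ^ 2 ≤ ρ / 5 := by nlinarith
  have hbox : ∀ ℓ, 0 < ℓ → 4 * ℓ < δ → ∀ x', ‖x' - y‖ ≤ 4 * ℓ →
      ∀ s ∈ Icc (t - 3 * ℓ ^ 2) (t + 3 * ℓ ^ 2), (x', s) ∈ LB w := fun ℓ hℓ hℓδ x' hx' s hs => by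
    have e1 := norm_sub_le_norm_sub_add_norm_sub x' y xs
    have e2 : 3 * ℓ ^ 2 ≤ δ ^ 2 := by nlinarith
    refine hXg x' (by linarith) (hδX x' (by linarith)) s (abs_le.2 ⟨?_, ?_⟩)
    · linarith [hs.1]
    · linarith [hs.2]
  have hn0 : (0 : ℝ) < n + 1 := by positivity
  have hdiv : ∀ ℓ : ℝ, 0 ≤ ℓ ^ 2 / (n + 1) ∧ ℓ ^ 2 / (n + 1) ≤ ℓ ^ 2 := fun ℓ =>
    ⟨by positivity, div_le_self (sq_nonneg ℓ) (by linarith [Nat.cast_nonneg (α := ℝ) n])⟩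
  by_cases hB : ∃ s ∈ Prod.snd '' Q, t < s ∧ s < t + (δ / 4) ^ 2 / (n + 1)
  · obtain ⟨s, hsT, hs1, hs2⟩ := hB
    set ℓ := √((n + 1) * (s - t)) with hℓ
    have hℓ0 : 0 < ℓ := Real.sqrt_pos.2 (mul_pos hn0 (by linarith))
    have hℓ2 : ℓ ^ 2 = (n + 1) * (s - t) := Real.sq_sqrt (mul_pos hn0 (by linarith)).le
    have hℓδ : ℓ < δ / 4 := by
      refine lt_of_pow_lt_pow_left₀ 2 (by positivity) ?_
      rw [hℓ2, ← lt_div_iff₀' hn0]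
      linarith
    have e := hH u v h y y t ℓ hℓ0 (by simp) (fun x' hx' s hs =>
        hbox ℓ hℓ0 (by linarith) x' (by linarith) s hs) fun x' hx' s hs =>
      hbox ℓ hℓ0 (by linarith) x' (by linarith) s
        ⟨by nlinarith [hs.1], by linarith [hs.2, (hdiv ℓ).2, sq_nonneg ℓ]⟩
    rw [show t + ℓ ^ 2 / (n + 1) = s by rw [hℓ2]; field_simp; ring] at e
    exact e.trans ((mul_le_mul_of_nonneg_left (hTw s hsT y (by linarith)) hC.le).trans hleC)
  · push Not at hB
    have hℓ0 : 0 < δ / 5 := by positivity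
    have hxy : ‖x - y‖ = δ := by rw [← dist_eq_norm, dist_comm, hxd]
    have hsq : (δ / 5) ^ 2 ≤ δ ^ 2 := by gcongr; linarith
    have e := hH' u v h y x t (δ / 5) hℓ0 (by linarith) (fun x' hx' s hs =>
        hbox _ hℓ0 (by linarith) x' (by linarith) s hs) fun x' hx' s hs => by
      have e1 := norm_sub_le_norm_sub_add_norm_sub x' x xs
      have e2 := norm_sub_le_norm_sub_add_norm_sub x y xs
      refine hTg s (abs_le.2 ⟨?_, ?_⟩) (fun hsT => ?_) x' (by linarith)
      · linarith [hs.1]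
      · linarith [hs.2, (hdiv (δ / 5)).2]
      · rcases hs.1.eq_or_lt with e3 | e3
        · exact htT (e3 ▸ hsT)
        · have e4 := hB s hsT e3
          have e5 : (δ / 5) ^ 2 / (n + 1 : ℝ) < (δ / 4) ^ 2 / (n + 1) := by
            gcongr; linarith
          linarith [hs.2]
    refine e.trans ((mul_le_mul_of_nonneg_left (hXw x hxX _ (abs_le.2 ⟨?_, ?_⟩)) hD.le).trans hleD)
    · linarith [(hdiv (δ / 5)).1]
    · linarith [(hdiv (δ / 5)).2]

theorem Sol.add_eq_zero {r lam : ℝ} (hr : 0 < r) (h0 : 0 ≤ lam) (h1 : lam < 1)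
    (hn : (n : ℝ) < 2 + 1 / r) {u v : Eu n → ℝ → ℝ} (h : Sol r lam u v) (x : Eu n) (t : ℝ) :
    u x t + v x t = 0 := by
  obtain ⟨C, hC, hU⟩ := exists_rpow_mul_le n hr h0 h1 hn
  have hw : 0 ≤ u x t + v x t := add_nonneg (h.nonneg_left x t) (h.nonneg_right x t)
  refine hw.antisymm' (le_of_not_gt fun hpos => ?_)
  have hpr : 0 < (u x t + v x t) ^ r := by positivity
  set ρ := (C + 1) / (u x t + v x t) ^ r with hρ
  have hρ0 : 0 < ρ := by positivity
  obtain ⟨η, N, hη, hN⟩ := exists_bound_of_prod (w := fun x t => u x t + v x t) (x := x) (R := ρ)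
    (a := t - ρ ^ 2) (b := t + ρ ^ 2) hρ0.le (by nlinarith) fun y _ s _ => by
      rw [h.LB_eq_univ hr h0 h1 hn]; trivial
  have := hU u v N h x t ρ hρ0 fun y hy s hs => hN y (by linarith) s (by
    have := abs_le.1 hs
    constructor <;> linarith)
  rw [hρ, mul_div_cancel₀ _ hpr.ne'] at this
  linarith

end Liouville

/-- Liouville theorem for the explicit system
`∂ₜu₁ = Δu₁ + u₁^p - λ u₁^r u₂^{r+1}`, `∂ₜu₂ = Δu₂ + u₂^p - λ u₁^{r+1} u₂^r`
with `p = 2r+1 > 1`, `0 ≤ λ < 1` and `(n-2)p < n`: there is no nontrivial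
nonnegative classical solution `(u₁, u₂)` on `ℝⁿ × ℝ`. -/
theorem no_nontrivial_nonneg_solution_explicit_system
    (r : ℝ) (hr : 0 < r) (p : ℝ) (hpr : p = 2 * r + 1)
    (lam : ℝ) (hlam0 : 0 ≤ lam) (hlam1 : lam < 1)
    (n : ℕ) (hn : 1 ≤ n) (hpn : ((n : ℝ) - 2) * p < n) :
    ¬ ∃ u₁ u₂ : EuclideanSpace ℝ (Fin n) × ℝ → ℝ,
        (∀ t, ContDiff ℝ 2 fun x => u₁ (x, t)) ∧
        (∀ t, ContDiff ℝ 2 fun x => u₂ (x, t)) ∧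
        (∀ x, ContDiff ℝ 1 fun t => u₁ (x, t)) ∧
        (∀ x, ContDiff ℝ 1 fun t => u₂ (x, t)) ∧
        (∀ x t, 0 ≤ u₁ (x, t)) ∧
        (∀ x t, 0 ≤ u₂ (x, t)) ∧
        ((∃ x t, u₁ (x, t) ≠ 0) ∨ (∃ x t, u₂ (x, t) ≠ 0)) ∧
        (∀ x t, deriv (fun s => u₁ (x, s)) t
            = lap (fun y => u₁ (y, t)) x
              + (u₁ (x, t) ^ p - lam * u₁ (x, t) ^ r * u₂ (x, t) ^ (r + 1))) ∧
        (∀ x t, deriv (fun s => u₂ (x, s)) t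
            = lap (fun y => u₂ (y, t)) x
              + (u₂ (x, t) ^ p - lam * u₁ (x, t) ^ (r + 1) * u₂ (x, t) ^ r)) := by
  rintro ⟨u, v, hux, hvx, hut, hvt, hu, hv, hne, hequ, heqv⟩
  have hn' : (n : ℝ) < 2 + 1 / r := by
    have h : ((n : ℝ) - 2) * r < 1 := by rw [hpr] at hpn; linarith
    have := (lt_div_iff₀ hr).2 h
    linarith
  have cux : ∀ t, Continuous fun x => u (x, t) := fun t => (hux t).continuous
  have cvx : ∀ t, Continuous fun x => v (x, t) := fun t => (hvx t).continuous
  have cut : ∀ x, Continuous fun t => u (x, t) := fun x => (hut x).continuous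
  have cvt : ∀ x, Continuous fun t => v (x, t) := fun x => (hvt x).continuous
  have hs : Sol r lam (fun x t => u (x, t)) (fun x t => v (x, t)) :=
    { left := ⟨hux, hut, fun t => continuous_nl hr lam (cux t) (cvx t),
        fun x => continuous_nl hr lam (cut x) (cvt x), fun x t => by rw [hequ, hpr]; rfl⟩
      right := ⟨hvx, hvt, fun t => continuous_nl hr lam (cvx t) (cux t),
        fun x => continuous_nl hr lam (cvt x) (cut x), fun x t => by
          rw [heqv, hpr, mul_right_comm]; rfl⟩
      nonneg_left := hu
      nonneg_right := hv }
  have h0 := fun x t => hs.add_eq_zero hr hlam0 hlam1 hn' x t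
  obtain ⟨x, t, hxt⟩ | ⟨x, t, hxt⟩ := hne
  · exact hxt (by linarith [h0 x t, hu x t, hv x t])
  · exact hxt (by linarith [h0 x t, hu x t, hv x t])
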